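/- Let c>0, let c_1,…,c_N>0 be fixed, let κ≥1 and μ>0. Then there exists a constant C>0, depending only on κ, μ, c and c_1,…,c_N, such that the following holds: if G:[0,∞)×ℝ³→ℝ is smooth and u is a smooth solution of ∂_t²u−c²Δ_x u=G on (0,∞)×ℝ³ with u(0,·)=0 and ∂_t u(0,·)=0, then for every (t,x)∈[0,∞)×ℝ³ and every a∈{0,1,2,3}, ⟨|x|⟩·⟨ct−|x|⟩^{κ}·Ψ_{κ−1}(t)^{−1}·|∂_a u(t,x)| ≤ C·A_{κ,μ,1}[G;c](t,x), where Ψ_ρ(t)=log(2+t) if ρ=0 and Ψ_ρ(t)=1 if ρ>0, and ∂_0=∂_t. -/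

import Mathlib

noncomputable section

namespace PaperKatayama

/-- Euclidean 3-space. -/
abbrev E3 := EuclideanSpace ℝ (Fin 3)

/-- Space-time functions. -/
abbrev Fn := ℝ → E3 → ℝ

/-- Functions of the space variable alone. -/
abbrev SFn := E3 → ℝ

/-- The Japanese bracket `⟨a⟩ = √(1+a²)`. -/
def jb (a : ℝ) : ℝ := Real.sqrt (1 + a ^ 2)

/-- Time derivative `∂_t`. -/
def pt (f : Fn) : Fn := fun t x => deriv (fun s => f s x) t

/-- Spatial derivative `∂_j` (j = 1,2,3, here indexed by `Fin 3`). -/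
def pd (j : Fin 3) (f : Fn) : Fn :=
  fun t x => fderiv ℝ (f t) x (EuclideanSpace.single j 1)

/-- `∂_a` for `a ∈ {0,1,2,3}`, with `∂_0 = ∂_t`. -/
def pda (a : Fin 4) : Fn → Fn := Fin.cases pt (fun j => pd j) a

/-- Rotation field `Ω_{jk} = x_j ∂_k − x_k ∂_j`, extended antisymmetrically
(so `rotA k j = − rotA j k`, and `rotA j j = 0`). -/
def rotA (j k : Fin 3) (f : Fn) : Fn :=
  fun t x => x j * pd k f t x - x k * pd j f t x

/-- Radial derivative `∂_r = Σ_j (x_j/r) ∂_j`. -/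
def pr (f : Fn) : Fn := fun t x => ∑ j, (x j / ‖x‖) * pd j f t x

/-- `D_{+,c} = ∂_t + c ∂_r`. -/
def Dp (c : ℝ) (f : Fn) : Fn := fun t x => pt f t x + c * pr f t x

/-- `D_{−,c} = ∂_t − c ∂_r`. -/
def Dm (c : ℝ) (f : Fn) : Fn := fun t x => pt f t x - c * pr f t x

/-- The seven fields `Z = {∂_t, ∂_1, ∂_2, ∂_3, Ω_{12}, Ω_{13}, Ω_{23}}`. -/
def Zop : Fin 7 → Fn → Fn :=
  ![pt, pd 0, pd 1, pd 2, rotA 0 1, rotA 0 2, rotA 1 2]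

/-- `Z^α = Z_1^{α_1} ⋯ Z_7^{α_7}`. -/
def Zpow (α : Fin 7 → ℕ) (f : Fn) : Fn :=
  (Zop 0)^[α 0] <| (Zop 1)^[α 1] <| (Zop 2)^[α 2] <| (Zop 3)^[α 3] <|
    (Zop 4)^[α 4] <| (Zop 5)^[α 5] <| (Zop 6)^[α 6] f

/-- Multi-indices `α` (for the seven fields) with `|α| ≤ s`. -/
def multiIdx (s : ℕ) : Finset (Fin 7 → ℕ) :=
  (Fintype.piFinset fun _ => Finset.range (s + 1)).filter fun α => ∑ i, α i ≤ s

/-- `|v(t,x)|_s = Σ_{|α| ≤ s} |Z^α v(t,x)|`. -/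
def vnorm (s : ℕ) (f : Fn) (t : ℝ) (x : E3) : ℝ :=
  ∑ α ∈ multiIdx s, |Zpow α f t x|

/-- Smoothness of a space-time function. -/
def Smooth (f : Fn) : Prop := ContDiff ℝ (⊤ : ℕ∞) (fun p : ℝ × E3 => f p.1 p.2)

/-- `u` is a smooth solution of `∂_t²u − c²Δu = G` on `(0,∞)×ℝ³`
with zero initial data. -/
def IsWaveSol (c : ℝ) (G u : Fn) : Prop :=
  Smooth u ∧
    (∀ t x, 0 < t → pt (pt u) t x - c ^ 2 * ∑ j, pd j (pd j u) t x = G t x) ∧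
    (∀ x, u 0 x = 0) ∧ (∀ x, pt u 0 x = 0)

/-- `u` is a smooth solution of the free wave equation `∂_t²u − c²Δu = 0`
on `(0,∞)×ℝ³` with initial data `φ, ψ`. -/
def IsFreeWaveSol (c : ℝ) (φ ψ : SFn) (u : Fn) : Prop :=
  Smooth u ∧
    (∀ t x, 0 < t → pt (pt u) t x - c ^ 2 * ∑ j, pd j (pd j u) t x = 0) ∧
    (∀ x, u 0 x = φ x) ∧ (∀ x, pt u 0 x = ψ x)

/-- Extension of the speeds `c_1, …, c_N` by `c_0 = 0`. -/
def cs0 {N : ℕ} (cs : Fin N → ℝ) : Fin (N + 1) → ℝ := Fin.cases 0 cs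

/-- The weight `w(t,r) = min_{0 ≤ j ≤ N} ⟨c_j t − r⟩` (with `c_0 = 0`). -/
def wgt {N : ℕ} (cs : Fin N → ℝ) (t r : ℝ) : ℝ :=
  Finset.univ.inf' Finset.univ_nonempty fun j : Fin (N + 1) => jb (cs0 cs j * t - r)

/-- The weighted sup `A_{ρ,μ,s}[G;c](t,x)` over the backward cone `Λ_c(t,x)`. -/
def Afun (ρ μ : ℝ) (s : ℕ) (G : Fn) (c : ℝ) {N : ℕ} (cs : Fin N → ℝ)
    (t : ℝ) (x : E3) : ℝ :=
  sSup {a : ℝ | ∃ τ : ℝ, ∃ y : E3, 0 ≤ τ ∧ τ ≤ t ∧ ‖y - x‖ ≤ c * (t - τ) ∧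
    a = ‖y‖ * jb (τ + ‖y‖) ^ ρ * wgt cs τ ‖y‖ ^ (1 + μ) * vnorm s G τ y}

/-- Spatial derivative of a function of `x` alone. -/
def sd (j : Fin 3) (φ : SFn) : SFn :=
  fun x => fderiv ℝ φ x (EuclideanSpace.single j 1)

/-- Spatial rotation field for functions of `x` alone. -/
def srot (j k : Fin 3) (φ : SFn) : SFn :=
  fun x => x j * sd k φ x - x k * sd j φ x

/-- The six spatial fields `{∂_1, ∂_2, ∂_3, Ω_{12}, Ω_{13}, Ω_{23}}`. -/
def Sop : Fin 6 → SFn → SFn :=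
  ![sd 0, sd 1, sd 2, srot 0 1, srot 0 2, srot 1 2]

/-- `Z^α` for the spatial fields. -/
def Spow (α : Fin 6 → ℕ) (φ : SFn) : SFn :=
  (Sop 0)^[α 0] <| (Sop 1)^[α 1] <| (Sop 2)^[α 2] <| (Sop 3)^[α 3] <|
    (Sop 4)^[α 4] <| (Sop 5)^[α 5] φ

/-- Spatial multi-indices with `|α| ≤ s`. -/
def smultiIdx (s : ℕ) : Finset (Fin 6 → ℕ) :=
  (Fintype.piFinset fun _ => Finset.range (s + 1)).filter fun α => ∑ i, α i ≤ s

/-- `|φ(x)|_s` for a function of `x` alone. -/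
def snorm (s : ℕ) (φ : SFn) (x : E3) : ℝ :=
  ∑ α ∈ smultiIdx s, |Spow α φ x|

/-- The weighted sup `B_{ρ,s}[φ,ψ;c](t,x)`. -/
def Bfun (ρ : ℝ) (s : ℕ) (φ ψ : SFn) (c t : ℝ) (x : E3) : ℝ :=
  sSup {b : ℝ | ∃ y : E3, ‖y - x‖ ≤ c * t ∧
    b = jb ‖y‖ ^ ρ * (snorm (s + 1) φ y + snorm s ψ y)}

/-- `Φ_ρ(t,r)`. -/
def Phi (ρ t r : ℝ) : ℝ :=
  if ρ = 0 then Real.log (2 + jb (t + r) / jb (t - r)) else jb (t - r) ^ (-ρ)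

/-- `Ψ_ρ(t)`. -/
def Psi (ρ t : ℝ) : ℝ := if ρ = 0 then Real.log (2 + t) else 1

/-- The null form `Q_0(v,w;c) = (∂_t v)(∂_t w) − c²(∇v)·(∇w)`. -/
def Q0f (c : ℝ) (v w : Fn) : Fn :=
  fun t x => pt v t x * pt w t x - c ^ 2 * ∑ j, pd j v t x * pd j w t x

/-- The null form `Q_{ab}(v,w) = (∂_a v)(∂_b w) − (∂_b v)(∂_a w)`. -/
def Qab (a b : Fin 4) (v w : Fn) : Fn :=
  fun t x => pda a v t x * pda b w t x - pda b v t x * pda a w t x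

/-- Lorentz boost `L_{c,j} = (x_j/c)∂_t + c t ∂_j`. -/
def Lb (c : ℝ) (j : Fin 3) (f : Fn) : Fn :=
  fun t x => (x j / c) * pt f t x + c * t * pd j f t x

/-- Scaling field `S = t ∂_t + x·∇_x`. -/
def Sc (f : Fn) : Fn := fun t x => t * pt f t x + ∑ j, x j * pd j f t x

/-- `v(t,r,ω) = r u(t, rω)`. -/
def Vrad (u : Fn) (ω : E3) (t r : ℝ) : ℝ := r * u t (r • ω)

/-- `(∂_t + ∂_r) v` in the variables `(t,r)` for fixed `ω`. -/
def DpV (u : Fn) (ω : E3) (t r : ℝ) : ℝ :=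
  deriv (fun s => Vrad u ω s r) t + deriv (fun ρ' => Vrad u ω t ρ') r

/-- Cross product in ℝ³. -/
def cross3 (a b : Fin 3 → ℝ) : Fin 3 → ℝ :=
  ![a 1 * b 2 - a 2 * b 1, a 2 * b 0 - a 0 * b 2, a 0 * b 1 - a 1 * b 0]

/-- `Ωv = (Ω_{23}v, −Ω_{13}v, Ω_{12}v)`. -/
def OmegaVec (v : Fn) (t : ℝ) (x : E3) : Fin 3 → ℝ :=
  ![rotA 1 2 v t x, -(rotA 0 2 v t x), rotA 0 1 v t x]

/-- `∂^α` for a multi-index with `|α| ≤ 1`: either the identity or a single `∂_a`. -/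
def Dle1 : Option (Fin 4) → Fn → Fn
  | none => id
  | some a => pda a

/-- A linear combination, with constant real coefficients, of the null forms
`Q_0(u_j, ∂^α u_k; c)` and `Q_{ab}(u_j, ∂^α u_k)` with `0 ≤ a < b ≤ 3`, `|α| ≤ 1`. -/
def NullF (c : ℝ) (m : ℕ)
    (a0 : Fin m → Fin m → Fin m → Option (Fin 4) → ℝ)
    (aQ : Fin m → Fin m → Fin m → Fin 4 → Fin 4 → Option (Fin 4) → ℝ)
    (v : Fin m → Fn) (i : Fin m) : Fn := fun t x =>
  (∑ j, ∑ k, ∑ o : Option (Fin 4), a0 i j k o * Q0f c (v j) (Dle1 o (v k)) t x) +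
    ∑ j, ∑ k, ∑ p ∈ Finset.univ.filter (fun p : Fin 4 × Fin 4 => p.1 < p.2),
      ∑ o : Option (Fin 4), aQ i j k p.1 p.2 o * Qab p.1 p.2 (v j) (Dle1 o (v k)) t x

section

open MeasureTheory Set Filter Topology

lemma lintegral_Ioi_deriv {F f : ℝ → ℝ} {a l : ℝ} (hc : ContinuousWithinAt F (Ici a) a)
    (hd : ∀ x ∈ Ioi a, HasDerivAt F (f x) x) (h0 : ∀ x ∈ Ioi a, 0 ≤ f x)
    (hl : Tendsto F atTop (𝓝 l)) :
    ∫⁻ x in Ioi a, ENNReal.ofReal (f x) = ENNReal.ofReal (l - F a) := by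
  rw [← integral_Ioi_of_hasDerivAt_of_nonneg hc hd h0 hl]
  exact (ofReal_integral_eq_lintegral_ofReal (integrableOn_Ioi_deriv_of_nonneg hc hd h0 hl)
    ((ae_restrict_iff' measurableSet_Ioi).2 (Eventually.of_forall h0))).symm

lemma lintegral_Ioo_deriv {F f : ℝ → ℝ} {a b : ℝ} (hab : a ≤ b) (hc : ContinuousOn F (Icc a b))
    (hd : ∀ x ∈ Ioo a b, HasDerivAt F (f x) x) (h0 : ∀ x ∈ Ioo a b, 0 ≤ f x) :
    ∫⁻ x in Ioo a b, ENNReal.ofReal (f x) = ENNReal.ofReal (F b - F a) := by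
  have hi : IntegrableOn f (Ioc a b) := intervalIntegral.integrableOn_deriv_of_nonneg hc hd h0
  have h1 : ∫ y in a..b, f y = F b - F a := by
    apply intervalIntegral.integral_eq_sub_of_hasDerivAt_of_le hab hc hd
    rwa [intervalIntegrable_iff_integrableOn_Ioc_of_le hab]
  rw [← h1, intervalIntegral.integral_of_le hab, integral_Ioc_eq_integral_Ioo]
  exact (ofReal_integral_eq_lintegral_ofReal (hi.mono_set Ioo_subset_Ioc_self)
    ((ae_restrict_iff' measurableSet_Ioo).2 (Eventually.of_forall h0))).symm

lemma lintegral_Ioi_inv_sqrt_three_halves {M : ℝ} (hM : 0 < M) :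
    ∫⁻ p in Ioi (0 : ℝ), ENNReal.ofReal (1 / ((M + p) * √(M + p) * √p)) =
      ENNReal.ofReal (2 / M) := by
  have hd : ∀ x ∈ Ioi (0 : ℝ), HasDerivAt (fun p => 2 / M * (√p / √(M + p)))
      (1 / ((M + x) * √(M + x) * √x)) x := by
    intro x hx
    have hx : 0 < x := hx
    have h1 : HasDerivAt (fun p : ℝ => √p) (1 / (2 * √x)) x := Real.hasDerivAt_sqrt hx.ne'
    have h2 : HasDerivAt (fun p : ℝ => √(M + p)) (1 / (2 * √(M + x))) x := by
      have := ((hasDerivAt_id x).const_add M).sqrt (by simp; positivity)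
      simpa using this
    have h3 := (h1.div h2 (by positivity)).const_mul (2 / M)
    refine h3.congr_deriv ?_
    have e1 := Real.sq_sqrt hx.le
    have e2 := Real.sq_sqrt (show 0 ≤ M + x by positivity)
    have p1 : 0 < √x := by positivity
    have p2 : 0 < √(M + x) := by positivity
    field_simp
    rw [e1, e2]
    ring
  have hl : Tendsto (fun p => 2 / M * (√p / √(M + p))) atTop (𝓝 (2 / M * 1)) := by
    apply Tendsto.const_mul
    have : Tendsto (fun p : ℝ => √(1 - M / (M + p))) atTop (𝓝 √(1 - 0)) := by
      apply (Real.continuous_sqrt.tendsto _).comp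
      apply Tendsto.const_sub
      exact tendsto_const_nhds.div_atTop (tendsto_atTop_add_const_left _ _ tendsto_id)
    simp only [sub_zero, Real.sqrt_one] at this
    refine this.congr' ?_
    filter_upwards [eventually_gt_atTop 0] with p hp
    rw [← Real.sqrt_div' _ (by positivity)]
    congr 1
    field_simp
    ring
  rw [lintegral_Ioi_deriv (F := fun p => 2 / M * (√p / √(M + p))) ?_ hd ?_ hl]
  · simp
  · apply ContinuousAt.continuousWithinAt
    have : √(M + 0) ≠ 0 := by simp; positivity
    fun_prop (disch := assumption)
  · intro x hx
    have hx : 0 < x := hx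
    positivity

lemma lintegral_Ioi_inv_sqrt {M : ℝ} (hM : 0 < M) :
    ∫⁻ p in Ioi (0 : ℝ), ENNReal.ofReal (1 / ((M + p) * √p)) =
      ENNReal.ofReal (Real.pi / √M) := by
  have hd : ∀ x ∈ Ioi (0 : ℝ), HasDerivAt (fun p => 2 / √M * Real.arctan (√p / √M))
      (1 / ((M + x) * √x)) x := by
    intro x hx
    have hx : 0 < x := hx
    have h1 : HasDerivAt (fun p : ℝ => √p) (1 / (2 * √x)) x := Real.hasDerivAt_sqrt hx.ne'
    have h3 := ((h1.div_const √M).arctan).const_mul (2 / √M)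
    refine h3.congr_deriv ?_
    have e1 := Real.sq_sqrt hx.le
    have e2 := Real.sq_sqrt hM.le
    have p1 : 0 < √x := by positivity
    have p2 : 0 < √M := by positivity
    field_simp
    rw [e1, e2]
  have hl : Tendsto (fun p => 2 / √M * Real.arctan (√p / √M)) atTop
      (𝓝 (2 / √M * (Real.pi / 2))) := by
    apply Tendsto.const_mul
    refine (tendsto_nhds_of_tendsto_nhdsWithin Real.tendsto_arctan_atTop).comp ?_
    exact Real.tendsto_sqrt_atTop.atTop_div_const (by positivity)
  rw [lintegral_Ioi_deriv (F := fun p => 2 / √M * Real.arctan (√p / √M)) ?_ hd ?_ hl]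
  · congr 1
    simp
  · apply ContinuousAt.continuousWithinAt
    have := Real.continuous_arctan
    fun_prop
  · intro x hx
    have hx : 0 < x := hx
    positivity

lemma lintegral_Ioo_inv_sqrt {X : ℝ} (hX : 0 ≤ X) :
    ∫⁻ p in Ioo (0 : ℝ) X, ENNReal.ofReal (1 / √p) = ENNReal.ofReal (2 * √X) := by
  rw [lintegral_Ioo_deriv (F := fun p => 2 * √p) hX (by fun_prop)]
  · simp
  · intro x hx
    have h1 := (Real.hasDerivAt_sqrt hx.1.ne').const_mul 2
    refine h1.congr_deriv ?_
    field_simp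
  · intro x _
    positivity

lemma exists_lintegral_bracket_le {ν : ℝ} (hν : 1 < ν) :
    ∃ C > 0, ∀ a : ℝ, ∫⁻ x : ℝ, ENNReal.ofReal ((1 + |x - a|) ^ (-ν)) ≤ ENNReal.ofReal C := by
  have h : Integrable (fun x : ℝ => (1 + ‖x‖) ^ (-ν)) :=
    integrable_one_add_norm (by simpa using hν)
  refine ⟨(∫ x : ℝ, (1 + ‖x‖) ^ (-ν)) + 1, ?_, fun a => ?_⟩
  · have : 0 ≤ ∫ x : ℝ, (1 + ‖x‖) ^ (-ν) := integral_nonneg fun x => by positivity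
    linarith
  · rw [lintegral_sub_right_eq_self (fun x : ℝ => ENNReal.ofReal ((1 + |x|) ^ (-ν))) a]
    simp only [Real.norm_eq_abs] at h ⊢
    rw [← ofReal_integral_eq_lintegral_ofReal h (Eventually.of_forall fun x => by positivity)]
    exact ENNReal.ofReal_le_ofReal (by linarith)

lemma exists_lintegral_bracket_mul_le {ν : ℝ} (hν : 1 < ν) {g : ℝ} (hg : g ≠ 0) :
    ∃ C > 0, ∀ a : ℝ, ∫⁻ x : ℝ, ENNReal.ofReal ((1 + |a - g * x|) ^ (-ν)) ≤
      ENNReal.ofReal C := by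
  obtain ⟨C, hC, h⟩ := exists_lintegral_bracket_le hν
  refine ⟨|g⁻¹| * C, by positivity, fun a => ?_⟩
  have hm : (volume : Measure ℝ).map (g * ·) = ENNReal.ofReal |g⁻¹| • volume :=
    Real.map_volume_mul_left hg
  have h1 : ∫⁻ x : ℝ, ENNReal.ofReal ((1 + |a - g * x|) ^ (-ν)) =
      ∫⁻ y, ENNReal.ofReal ((1 + |y - a|) ^ (-ν)) ∂((volume : Measure ℝ).map (g * ·)) := by
    rw [lintegral_map (by fun_prop) (by fun_prop)]
    simp_rw [abs_sub_comm a]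
  rw [h1, hm, lintegral_smul_measure, ENNReal.ofReal_mul (abs_nonneg _), smul_eq_mul]
  gcongr
  exact h a

lemma exists_lintegral_sqrt_bracket_le {ν : ℝ} (hν : 1 < ν) :
    ∃ C > 0, ∫⁻ p in Ioi (0 : ℝ), ENNReal.ofReal (1 / √p * (1 + p) ^ (-(ν / 2))) ≤
      ENNReal.ofReal C := by
  obtain ⟨C, hC, h⟩ := exists_lintegral_bracket_le (ν := (1 + ν) / 2) (by linarith)
  refine ⟨2 + √2 * C, by positivity, ?_⟩
  have key : ∀ p ∈ Ioi (0 : ℝ), ENNReal.ofReal (1 / √p * (1 + p) ^ (-(ν / 2))) ≤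
      (Ioo (0 : ℝ) 1).indicator (fun p => ENNReal.ofReal (1 / √p)) p +
        ENNReal.ofReal √2 * ENNReal.ofReal ((1 + |p - 0|) ^ (-((1 + ν) / 2))) := by
    intro p hp
    have hp : 0 < p := hp
    by_cases h1 : p < 1
    · rw [indicator_of_mem (show p ∈ Ioo (0 : ℝ) 1 from ⟨hp, h1⟩)]
      refine le_trans (ENNReal.ofReal_le_ofReal ?_) le_self_add
      have : (1 + p) ^ (-(ν / 2)) ≤ 1 :=
        Real.rpow_le_one_of_one_le_of_nonpos (by linarith) (by linarith)
      exact mul_le_of_le_one_right (by positivity) this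
    · refine le_trans ?_ le_add_self
      rw [← ENNReal.ofReal_mul (by positivity)]
      refine ENNReal.ofReal_le_ofReal ?_
      rw [sub_zero, abs_of_pos hp, show -((1 + ν) / 2) = -(1 / 2) + -(ν / 2) by ring,
        Real.rpow_add (by positivity), ← mul_assoc]
      gcongr
      rw [Real.rpow_neg (by positivity), ← Real.sqrt_eq_rpow, ← div_eq_mul_inv,
        div_le_div_iff₀ (by positivity) (by positivity), one_mul, ← Real.sqrt_mul (by norm_num)]
      exact Real.sqrt_le_sqrt (by linarith)
  calc _ ≤ ∫⁻ p in Ioi (0 : ℝ), ((Ioo (0 : ℝ) 1).indicator (fun p => ENNReal.ofReal (1 / √p)) p +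
        ENNReal.ofReal √2 * ENNReal.ofReal ((1 + |p - 0|) ^ (-((1 + ν) / 2)))) :=
        setLIntegral_mono (by
          refine Measurable.add (Measurable.indicator (by fun_prop) measurableSet_Ioo) (by fun_prop))
          key
    _ ≤ ∫⁻ p, ((Ioo (0 : ℝ) 1).indicator (fun p => ENNReal.ofReal (1 / √p)) p +
        ENNReal.ofReal √2 * ENNReal.ofReal ((1 + |p - 0|) ^ (-((1 + ν) / 2)))) :=
        setLIntegral_le_lintegral _ _
    _ ≤ _ := by
      rw [lintegral_add_right _ (by fun_prop), lintegral_indicator measurableSet_Ioo,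
        lintegral_Ioo_inv_sqrt zero_le_one, lintegral_const_mul _ (by fun_prop),
        ENNReal.ofReal_add (by positivity) (by positivity), ENNReal.ofReal_mul (p := √2) (by positivity)]
      gcongr
      · simp
      · exact h 0

end

section

open MeasureTheory Set Filter Topology

/-- The singular kernel that governs the incoming derivative. -/
def singKer (ν g M b p P : ℝ) : ℝ :=
  1 / ((M + p) * √p * √P) * (1 + |b - g * p - P|) ^ (-ν)

lemma bracket_rpow_le_one {x ν : ℝ} (hx : 0 ≤ x) (hν : 0 ≤ ν) : (1 + x) ^ (-ν) ≤ 1 :=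
  Real.rpow_le_one_of_one_le_of_nonpos (by linarith) (by linarith)

lemma bracket_rpow_le_inv {x ν : ℝ} (hx : 0 ≤ x) (hν : 1 ≤ ν) : (1 + x) ^ (-ν) ≤ 1 / (1 + x) := by
  rw [one_div, ← Real.rpow_neg_one]
  exact Real.rpow_le_rpow_of_exponent_le (by linarith) (by linarith)

lemma exists_singKer_one_le {ν : ℝ} (hν : 1 < ν) :
    ∃ C > 0, ∀ M b : ℝ, 1 ≤ M → b ≤ 0 →
      ∫⁻ p in Ioi (0 : ℝ), ∫⁻ P in Ioi (0 : ℝ), ENNReal.ofReal (singKer ν 1 M b p P) ≤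
        ENNReal.ofReal (C / M) := by
  obtain ⟨C, hC, h⟩ := exists_lintegral_sqrt_bracket_le hν
  refine ⟨C * C, by positivity, fun M b hM hb => ?_⟩
  have key : ∀ p ∈ Ioi (0 : ℝ), ∀ P ∈ Ioi (0 : ℝ), ENNReal.ofReal (singKer ν 1 M b p P) ≤
      ENNReal.ofReal (1 / M * (1 / √p * (1 + p) ^ (-(ν / 2)))) *
        ENNReal.ofReal (1 / √P * (1 + P) ^ (-(ν / 2))) := by
    intro p hp P hP
    have hp : 0 < p := hp
    have hP : 0 < P := hP
    rw [← ENNReal.ofReal_mul (by positivity)]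
    refine ENNReal.ofReal_le_ofReal ?_
    have h1 : (1 + |b - 1 * p - P|) ^ (-ν) ≤ (1 + p) ^ (-(ν / 2)) * (1 + P) ^ (-(ν / 2)) := by
      rw [show -ν = -(ν / 2) + -(ν / 2) by ring, Real.rpow_add (by positivity)]
      have : p + P ≤ |b - 1 * p - P| := by
        rw [abs_of_nonpos (by linarith)]
        linarith
      gcongr ?_ * ?_
      · exact Real.rpow_le_rpow_of_nonpos (by positivity) (by linarith) (by linarith)
      · exact Real.rpow_le_rpow_of_nonpos (by positivity) (by linarith) (by linarith)
    have h2 : 1 / ((M + p) * √p * √P) ≤ 1 / (M * √p * √P) := by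
      gcongr
      linarith
    unfold singKer
    calc _ ≤ 1 / (M * √p * √P) * ((1 + p) ^ (-(ν / 2)) * (1 + P) ^ (-(ν / 2))) := by gcongr
      _ = _ := by
        field_simp
  calc _ ≤ ∫⁻ p in Ioi (0 : ℝ), ∫⁻ P in Ioi (0 : ℝ),
        ENNReal.ofReal (1 / M * (1 / √p * (1 + p) ^ (-(ν / 2)))) *
        ENNReal.ofReal (1 / √P * (1 + P) ^ (-(ν / 2))) := by
        refine setLIntegral_mono' measurableSet_Ioi fun p hp => ?_
        exact setLIntegral_mono' measurableSet_Ioi fun P hP => key p hp P hP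
    _ = ENNReal.ofReal (1 / M) *
        (∫⁻ p in Ioi (0 : ℝ), ENNReal.ofReal (1 / √p * (1 + p) ^ (-(ν / 2)))) *
        ∫⁻ P in Ioi (0 : ℝ), ENNReal.ofReal (1 / √P * (1 + P) ^ (-(ν / 2))) := by
        rw [← lintegral_const_mul' _ _ ENNReal.ofReal_ne_top, ← lintegral_mul_const _ (by fun_prop)]
        refine lintegral_congr fun p => ?_
        rw [lintegral_const_mul' _ _ ENNReal.ofReal_ne_top, ENNReal.ofReal_mul (by positivity)]
    _ ≤ ENNReal.ofReal (1 / M) * ENNReal.ofReal C * ENNReal.ofReal C := by gcongr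
    _ = _ := by
        rw [← ENNReal.ofReal_mul (by positivity), ← ENNReal.ofReal_mul (by positivity)]
        congr 1
        ring

lemma exists_singKer_zero_le {ν : ℝ} (hν : 1 < ν) :
    ∃ C > 0, ∀ M b : ℝ, 1 ≤ M → M - 2 ≤ |b| →
      ∫⁻ p in Ioi (0 : ℝ), ∫⁻ P in Ioi (0 : ℝ), ENNReal.ofReal (singKer ν 0 M b p P) ≤
        ENNReal.ofReal (C / M) := by
  obtain ⟨C, hC, h⟩ := exists_lintegral_bracket_le hν
  refine ⟨Real.pi * (√8 * C + 16 / 7 * 2), by positivity, fun M b hM hb => ?_⟩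
  have hM0 : 0 < M := by linarith
  have key : ∀ p ∈ Ioi (0 : ℝ), ∀ P ∈ Ioi (0 : ℝ), ENNReal.ofReal (singKer ν 0 M b p P) ≤
      ENNReal.ofReal (1 / ((M + p) * √p)) *
        (ENNReal.ofReal (√8 / √M) * ENNReal.ofReal ((1 + |P - b|) ^ (-ν)) +
          ENNReal.ofReal (16 / 7 / M) *
            (Ioo (0 : ℝ) M).indicator (fun P => ENNReal.ofReal (1 / √P)) P) := by
    intro p hp P hP
    have hp : 0 < p := hp
    have hP : 0 < P := hP
    have e0 : singKer ν 0 M b p P = 1 / ((M + p) * √p) * (1 / √P * (1 + |P - b|) ^ (-ν)) := by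
      unfold singKer
      rw [zero_mul, sub_zero, abs_sub_comm]
      field_simp
    rw [e0, ENNReal.ofReal_mul (by positivity)]
    gcongr
    by_cases hc : M / 8 ≤ P
    · refine le_trans ?_ le_self_add
      rw [← ENNReal.ofReal_mul (by positivity)]
      refine ENNReal.ofReal_le_ofReal ?_
      gcongr ?_ * _
      rw [div_le_div_iff₀ (by positivity) (by positivity), one_mul, ← Real.sqrt_mul (by norm_num)]
      exact Real.sqrt_le_sqrt (by linarith)
    · push Not at hc
      refine le_trans ?_ le_add_self
      rw [indicator_of_mem (show P ∈ Ioo (0 : ℝ) M from ⟨hP, by linarith⟩),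
        ← ENNReal.ofReal_mul (by positivity)]
      refine ENNReal.ofReal_le_ofReal ?_
      rw [mul_comm]
      gcongr
      refine (bracket_rpow_le_inv (abs_nonneg _) hν.le).trans ?_
      rw [div_le_div_iff₀ (by positivity) (by positivity)]
      have h1 : |b| ≤ |P - b| + P := by
        have := abs_sub_abs_le_abs_sub b P
        rw [abs_of_pos hP, abs_sub_comm] at this
        linarith
      have := abs_nonneg (P - b)
      linarith
  calc _ ≤ ∫⁻ p in Ioi (0 : ℝ), ∫⁻ P in Ioi (0 : ℝ),
        ENNReal.ofReal (1 / ((M + p) * √p)) *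
        (ENNReal.ofReal (√8 / √M) * ENNReal.ofReal ((1 + |P - b|) ^ (-ν)) +
          ENNReal.ofReal (16 / 7 / M) *
            (Ioo (0 : ℝ) M).indicator (fun P => ENNReal.ofReal (1 / √P)) P) := by
        refine setLIntegral_mono' measurableSet_Ioi fun p hp => ?_
        exact setLIntegral_mono' measurableSet_Ioi fun P hP => key p hp P hP
    _ ≤ ∫⁻ p in Ioi (0 : ℝ), ∫⁻ P,
        ENNReal.ofReal (1 / ((M + p) * √p)) *
        (ENNReal.ofReal (√8 / √M) * ENNReal.ofReal ((1 + |P - b|) ^ (-ν)) +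
          ENNReal.ofReal (16 / 7 / M) *
            (Ioo (0 : ℝ) M).indicator (fun P => ENNReal.ofReal (1 / √P)) P) :=
        lintegral_mono fun p => setLIntegral_le_lintegral _ _
    _ ≤ ∫⁻ p in Ioi (0 : ℝ), ENNReal.ofReal (1 / ((M + p) * √p)) *
        (ENNReal.ofReal (√8 / √M) * ENNReal.ofReal C +
          ENNReal.ofReal (16 / 7 / M) * ENNReal.ofReal (2 * √M)) := by
        refine lintegral_mono fun p => ?_
        have hm : Measurable ((Ioo (0 : ℝ) M).indicator (fun P => ENNReal.ofReal (1 / √P))) :=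
          Measurable.indicator (by fun_prop) measurableSet_Ioo
        rw [lintegral_const_mul _ (by fun_prop), lintegral_add_left (by fun_prop),
          lintegral_const_mul _ (by fun_prop), lintegral_const_mul _ hm,
          lintegral_indicator measurableSet_Ioo, lintegral_Ioo_inv_sqrt hM0.le]
        gcongr
        exact h b
    _ = _ := by
        rw [lintegral_mul_const _ (by fun_prop), lintegral_Ioi_inv_sqrt hM0,
          ← ENNReal.ofReal_mul (by positivity), ← ENNReal.ofReal_mul (by positivity),
          ← ENNReal.ofReal_add (by positivity) (by positivity),
          ← ENNReal.ofReal_mul (by positivity)]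
        congr 1
        obtain ⟨s, hs, rfl⟩ : ∃ s : ℝ, 0 < s ∧ M = s ^ 2 :=
          ⟨√M, by positivity, (Real.sq_sqrt hM0.le).symm⟩
        rw [Real.sqrt_sq hs.le]
        field_simp

lemma exists_singKer_mid_le {ν : ℝ} (hν : 1 < ν) {g : ℝ} (hg : -1 < g) (hg1 : g < 1)
    (hg0 : g ≠ 0) :
    ∃ C > 0, ∀ M b : ℝ, 1 ≤ M → (1 - g) * (M - 1) - 1 ≤ |b| →
      ∫⁻ p in Ioi (0 : ℝ), ∫⁻ P in Ioi (0 : ℝ), ENNReal.ofReal (singKer ν g M b p P) ≤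
        ENNReal.ofReal (C / M) := by
  obtain ⟨C₁, hC₁, h₁⟩ := exists_lintegral_bracket_le hν
  obtain ⟨C₂, hC₂, h₂⟩ := exists_lintegral_bracket_mul_le hν hg0
  obtain ⟨θ, hθ⟩ : ∃ θ, θ = 1 - g := ⟨_, rfl⟩
  have hθ0 : 0 < θ := by linarith
  have hθ2 : θ < 2 := by linarith
  obtain ⟨L, hL⟩ : ∃ L, L = 6 / θ + 1 := ⟨_, rfl⟩
  have hL0 : 0 < L := hL ▸ (by positivity)
  have hgabs : |g| ≤ 1 := abs_le.2 ⟨hg.le, hg1.le⟩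
  obtain ⟨a₁, ha₁⟩ : ∃ a, a = 1 / √(θ / 8) := ⟨_, rfl⟩
  obtain ⟨a₂, ha₂⟩ : ∃ a, a = 8 / θ + L := ⟨_, rfl⟩
  obtain ⟨a₃, ha₃⟩ : ∃ a, a = √L * (2 * √2) := ⟨_, rfl⟩
  have ha₁0 : 0 < a₁ := by subst ha₁; positivity
  have ha₂0 : 0 < a₂ := by subst ha₂; positivity
  have ha₃0 : 0 < a₃ := by subst ha₃; positivity
  refine ⟨a₁ * (2 * C₁) + a₂ * 4 + a₃ * (2 * C₂), by positivity, fun M b hM hb => ?_⟩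
  have hM0 : 0 < M := by linarith
  set B : ℝ → ℝ → ℝ := fun p P => (1 + |b - g * p - P|) ^ (-ν) with hB
  have hB0 : ∀ p P, 0 ≤ B p P := fun p P => by positivity
  set f₁ : ℝ → ℝ → ENNReal := fun p P =>
    ENNReal.ofReal (1 / ((M + p) * √(M + p) * √p)) * ENNReal.ofReal (B p P) with hf₁
  set f₂ : ℝ → ℝ → ENNReal := fun p P =>
    ENNReal.ofReal (1 / ((M + p) ^ 2 * √p)) *
      (Ioo (0 : ℝ) (M + p)).indicator (fun P => ENNReal.ofReal (1 / √P)) P with hf₂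
  set f₃ : ℝ → ℝ → ENNReal := fun p P =>
    ENNReal.ofReal (1 / ((M + P) * √(M + P) * √P)) * ENNReal.ofReal (B p P) with hf₃
  have key : ∀ p ∈ Ioi (0 : ℝ), ∀ P ∈ Ioi (0 : ℝ), ENNReal.ofReal (singKer ν g M b p P) ≤
      (ENNReal.ofReal a₁ * f₁ p P + ENNReal.ofReal a₂ * f₂ p P) + ENNReal.ofReal a₃ * f₃ p P := by
    intro p hp P hP
    have hp : 0 < p := hp
    have hP : 0 < P := hP
    have hMp : 0 < M + p := by positivity
    have hf2 : P < M + p → ∀ a, 0 ≤ a → a ≤ a₂ → B p P ≤ a / (M + p) →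
        ENNReal.ofReal (singKer ν g M b p P) ≤ ENNReal.ofReal a₂ * f₂ p P := by
      intro hPM a ha haa hBa
      simp only [hf₂]
      rw [indicator_of_mem (show P ∈ Ioo (0 : ℝ) (M + p) from ⟨hP, hPM⟩),
        ← ENNReal.ofReal_mul (by positivity), ← ENNReal.ofReal_mul (by positivity)]
      refine ENNReal.ofReal_le_ofReal ?_
      calc singKer ν g M b p P ≤ 1 / ((M + p) * √p * √P) * (a₂ / (M + p)) := by
            unfold singKer
            gcongr
            exact hBa.trans (by gcongr)
        _ = _ := by field_simp
    by_cases c1 : θ / 8 * (M + p) ≤ P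
    · refine le_trans ?_ (le_self_add.trans le_self_add)
      simp only [hf₁]
      rw [← ENNReal.ofReal_mul (by positivity), ← ENNReal.ofReal_mul (by positivity)]
      refine ENNReal.ofReal_le_ofReal ?_
      unfold singKer
      rw [← mul_assoc]
      gcongr ?_ * _
      have : 1 / √P ≤ a₁ / √(M + p) := by
        rw [ha₁, div_div, ← Real.sqrt_mul (by positivity)]
        gcongr
      calc 1 / ((M + p) * √p * √P) = 1 / ((M + p) * √p) * (1 / √P) := by field_simp
        _ ≤ 1 / ((M + p) * √p) * (a₁ / √(M + p)) := by gcongr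
        _ = _ := by field_simp
    push Not at c1
    have hPM : P < M + p := by nlinarith
    by_cases c2 : θ / 8 * (M + p) ≤ |b - g * p - P|
    · refine (hf2 hPM (8 / θ) (by positivity) (by linarith) ?_).trans
        (le_add_self.trans le_self_add)
      refine (bracket_rpow_le_inv (abs_nonneg _) hν.le).trans ?_
      rw [div_div]
      rw [div_le_div_iff₀ (by positivity) (by positivity)]
      have : θ * (M + p) ≤ 8 * |b - g * p - P| := by linarith
      linarith
    push Not at c2
    have hb2 : |b| ≤ p + |b - g * p - P| + P := by
      have e : b = g * p + (b - g * p - P) + P := by ring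
      have i1 : |g * p| ≤ p := by
        rw [abs_mul, abs_of_pos hp]
        exact mul_le_of_le_one_left hp.le hgabs
      calc |b| = |g * p + (b - g * p - P) + P| := by rw [← e]
        _ ≤ |g * p| + |b - g * p - P| + |P| := abs_add_three _ _ _
        _ ≤ _ := by rw [abs_of_pos hP]; linarith
    rw [← hθ] at hb
    have hM2 : θ * M ≤ 4 + 2 * p := by nlinarith
    by_cases c3 : 1 ≤ p
    · refine le_trans ?_ le_add_self
      simp only [hf₃]
      rw [← ENNReal.ofReal_mul (by positivity), ← ENNReal.ofReal_mul (by positivity)]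
      refine ENNReal.ofReal_le_ofReal ?_
      unfold singKer
      rw [← mul_assoc]
      gcongr ?_ * _
      have hLp : M + p ≤ L * p := by
        have : M ≤ 6 / θ * p := by
          rw [div_mul_eq_mul_div, le_div_iff₀ hθ0]
          linarith
        rw [hL]
        linarith
      have i1 : 1 / √p ≤ √L / √(M + p) := by
        rw [div_le_div_iff₀ (by positivity) (by positivity), one_mul, ← Real.sqrt_mul hL0.le]
        exact Real.sqrt_le_sqrt hLp
      have i2 : M + P ≤ 2 * (M + p) := by nlinarith
      have i3 : 1 / (M + p) ≤ 2 / (M + P) := by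
        rw [div_le_div_iff₀ (by positivity) (by positivity)]
        linarith
      have i4 : 1 / √(M + p) ≤ √2 / √(M + P) := by
        rw [div_le_div_iff₀ (by positivity) (by positivity), one_mul,
          ← Real.sqrt_mul (by norm_num)]
        exact Real.sqrt_le_sqrt i2
      calc 1 / ((M + p) * √p * √P) = 1 / (M + p) * (1 / √p) * (1 / √P) := by field_simp
        _ ≤ 2 / (M + P) * (√L / √(M + p)) * (1 / √P) := by gcongr
        _ = 2 / (M + P) * (√L * (1 / √(M + p))) * (1 / √P) := by field_simp
        _ ≤ 2 / (M + P) * (√L * (√2 / √(M + P))) * (1 / √P) := by gcongr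
        _ = _ := by
          rw [ha₃]
          field_simp
    · push Not at c3
      refine (hf2 hPM L hL0.le ?_ ?_).trans (le_add_self.trans le_self_add)
      · rw [ha₂]
        have : 0 < 8 / θ := by positivity
        linarith
      · refine (bracket_rpow_le_one (abs_nonneg _) (by linarith)).trans ?_
        rw [le_div_iff₀ hMp, one_mul, hL]
        have : M ≤ 6 / θ := by
          rw [le_div_iff₀ hθ0]
          linarith
        linarith
  have mB : Measurable (Function.uncurry B) := by
    simp only [hB]
    unfold Function.uncurry
    fun_prop
  have mf₁ : Measurable (Function.uncurry f₁) := by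
    refine Measurable.mul ?_ mB.ennreal_ofReal
    fun_prop
  have mf₂ : Measurable (Function.uncurry f₂) := by
    have e : Function.uncurry f₂ = fun z : ℝ × ℝ =>
        ENNReal.ofReal (1 / ((M + z.1) ^ 2 * √z.1)) *
        {z : ℝ × ℝ | 0 < z.2 ∧ z.2 < M + z.1}.indicator (fun z => ENNReal.ofReal (1 / √z.2)) z := by
      ext ⟨p, P⟩
      simp [hf₂, indicator]
    rw [e]
    refine Measurable.mul (by fun_prop) (Measurable.indicator (by fun_prop) ?_)
    exact (measurableSet_lt measurable_const measurable_snd).inter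
      (measurableSet_lt measurable_snd (by fun_prop))
  have mf₃ : Measurable (Function.uncurry f₃) := by
    refine Measurable.mul ?_ mB.ennreal_ofReal
    fun_prop
  have I₁ : ∫⁻ p in Ioi (0 : ℝ), ∫⁻ P in Ioi (0 : ℝ), f₁ p P ≤ ENNReal.ofReal (2 * C₁ / M) := by
    calc _ ≤ ∫⁻ p in Ioi (0 : ℝ), ENNReal.ofReal (1 / ((M + p) * √(M + p) * √p)) *
          ENNReal.ofReal C₁ := by
          refine lintegral_mono fun p => ?_
          simp only [hf₁]
          rw [lintegral_const_mul' _ _ ENNReal.ofReal_ne_top]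
          gcongr
          refine (setLIntegral_le_lintegral _ _).trans ?_
          simp only [hB, abs_sub_comm (b - g * p)]
          exact h₁ _
      _ = _ := by
          rw [lintegral_mul_const' _ _ ENNReal.ofReal_ne_top,
            lintegral_Ioi_inv_sqrt_three_halves hM0, ← ENNReal.ofReal_mul (by positivity)]
          congr 1
          ring
  have I₂ : ∫⁻ p in Ioi (0 : ℝ), ∫⁻ P in Ioi (0 : ℝ), f₂ p P ≤ ENNReal.ofReal (4 / M) := by
    calc _ ≤ ∫⁻ p in Ioi (0 : ℝ), ENNReal.ofReal 2 *
          ENNReal.ofReal (1 / ((M + p) * √(M + p) * √p)) := by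
          refine setLIntegral_mono' measurableSet_Ioi fun p hp => ?_
          have hp : 0 < p := hp
          have hMp : 0 < M + p := by positivity
          simp only [hf₂]
          rw [lintegral_const_mul' _ _ ENNReal.ofReal_ne_top]
          calc _ ≤ ENNReal.ofReal (1 / ((M + p) ^ 2 * √p)) * ENNReal.ofReal (2 * √(M + p)) := by
                gcongr
                refine (setLIntegral_le_lintegral _ _).trans ?_
                rw [lintegral_indicator measurableSet_Ioo, lintegral_Ioo_inv_sqrt hMp.le]
            _ = _ := by
                rw [← ENNReal.ofReal_mul (by positivity), ← ENNReal.ofReal_mul (by positivity)]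
                congr 1
                have := Real.sq_sqrt hMp.le
                field_simp
                linarith
      _ = _ := by
          rw [lintegral_const_mul' _ _ ENNReal.ofReal_ne_top,
            lintegral_Ioi_inv_sqrt_three_halves hM0, ← ENNReal.ofReal_mul (by positivity)]
          congr 1
          ring
  have I₃ : ∫⁻ p in Ioi (0 : ℝ), ∫⁻ P in Ioi (0 : ℝ), f₃ p P ≤ ENNReal.ofReal (2 * C₂ / M) := by
    rw [lintegral_lintegral_swap mf₃.aemeasurable]
    calc _ ≤ ∫⁻ P in Ioi (0 : ℝ), ENNReal.ofReal (1 / ((M + P) * √(M + P) * √P)) *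
          ENNReal.ofReal C₂ := by
          refine lintegral_mono fun P => ?_
          simp only [hf₃]
          rw [lintegral_const_mul' _ _ ENNReal.ofReal_ne_top]
          gcongr
          refine (setLIntegral_le_lintegral _ _).trans ?_
          have e : ∀ p, B p P = (1 + |b - P - g * p|) ^ (-ν) := fun p => by
            simp only [hB]
            congr 3
            ring
          simp only [e]
          exact h₂ _
      _ = _ := by
          rw [lintegral_mul_const' _ _ ENNReal.ofReal_ne_top,
            lintegral_Ioi_inv_sqrt_three_halves hM0, ← ENNReal.ofReal_mul (by positivity)]
          congr 1
          ring
  have dbl : ∀ (a : ENNReal) (_ : a ≠ ⊤) (f : ℝ → ℝ → ENNReal),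
      ∫⁻ p in Ioi (0 : ℝ), ∫⁻ P in Ioi (0 : ℝ), a * f p P =
        a * ∫⁻ p in Ioi (0 : ℝ), ∫⁻ P in Ioi (0 : ℝ), f p P := by
    intro a ha f
    simp_rw [lintegral_const_mul' _ _ ha]
  have dbladd : ∀ (f h : ℝ → ℝ → ENNReal), Measurable (Function.uncurry h) →
      ∫⁻ p in Ioi (0 : ℝ), ∫⁻ P in Ioi (0 : ℝ), (f p P + h p P) =
        (∫⁻ p in Ioi (0 : ℝ), ∫⁻ P in Ioi (0 : ℝ), f p P) +
        ∫⁻ p in Ioi (0 : ℝ), ∫⁻ P in Ioi (0 : ℝ), h p P := by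
    intro f h hh
    rw [← lintegral_add_right _ hh.lintegral_prod_right]
    refine lintegral_congr fun p => ?_
    exact lintegral_add_right _ (hh.comp measurable_prodMk_left)
  calc _ ≤ ∫⁻ p in Ioi (0 : ℝ), ∫⁻ P in Ioi (0 : ℝ), ((ENNReal.ofReal a₁ * f₁ p P +
        ENNReal.ofReal a₂ * f₂ p P) + ENNReal.ofReal a₃ * f₃ p P) := by
        refine setLIntegral_mono' measurableSet_Ioi fun p hp => ?_
        exact setLIntegral_mono' measurableSet_Ioi fun P hP => key p hp P hP
    _ = ENNReal.ofReal a₁ * (∫⁻ p in Ioi (0 : ℝ), ∫⁻ P in Ioi (0 : ℝ), f₁ p P) +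
        ENNReal.ofReal a₂ * (∫⁻ p in Ioi (0 : ℝ), ∫⁻ P in Ioi (0 : ℝ), f₂ p P) +
        ENNReal.ofReal a₃ * ∫⁻ p in Ioi (0 : ℝ), ∫⁻ P in Ioi (0 : ℝ), f₃ p P := by
        rw [dbladd _ (fun p P => ENNReal.ofReal a₃ * f₃ p P) (mf₃.const_mul _),
          dbladd _ (fun p P => ENNReal.ofReal a₂ * f₂ p P) (mf₂.const_mul _),
          dbl _ ENNReal.ofReal_ne_top, dbl _ ENNReal.ofReal_ne_top, dbl _ ENNReal.ofReal_ne_top]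
    _ ≤ ENNReal.ofReal a₁ * ENNReal.ofReal (2 * C₁ / M) + ENNReal.ofReal a₂ * ENNReal.ofReal (4 / M)
        + ENNReal.ofReal a₃ * ENNReal.ofReal (2 * C₂ / M) := by gcongr
    _ = _ := by
        rw [← ENNReal.ofReal_mul ha₁0.le, ← ENNReal.ofReal_mul ha₂0.le, ← ENNReal.ofReal_mul ha₃0.le,
          ← ENNReal.ofReal_add (by positivity) (by positivity),
          ← ENNReal.ofReal_add (by positivity) (by positivity)]
        congr 1
        ring

/-- The singular kernel has total mass `O(1/M)`. -/
lemma exists_singKer_le {ν : ℝ} (hν : 1 < ν) {g : ℝ} (hg : -1 < g) (hg1 : g ≤ 1) :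
    ∃ C > 0, ∀ M b : ℝ, 1 ≤ M → (1 - g) * (M - 1) - 1 ≤ |b| → (g = 1 → b ≤ 0) →
      ∫⁻ p in Ioi (0 : ℝ), ∫⁻ P in Ioi (0 : ℝ), ENNReal.ofReal (singKer ν g M b p P) ≤
        ENNReal.ofReal (C / M) := by
  rcases hg1.eq_or_lt with rfl | h1
  · obtain ⟨C, hC, h⟩ := exists_singKer_one_le hν
    exact ⟨C, hC, fun M b hM _ hb => h M b hM (hb rfl)⟩
  by_cases h0 : g = 0
  · subst h0
    obtain ⟨C, hC, h⟩ := exists_singKer_zero_le hν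
    exact ⟨C, hC, fun M b hM hb _ => h M b hM (by linarith)⟩
  · obtain ⟨C, hC, h⟩ := exists_singKer_mid_le hν hg h1 h0
    exact ⟨C, hC, fun M b hM hb _ => h M b hM hb⟩

end

section

open MeasureTheory Set Filter Topology

/-- Differentiation under the integral sign over a compact interval. -/
lemma hasDerivAt_intervalIntegral_of_continuous {f f' : ℝ → ℝ → ℝ}
    (hf : Continuous (Function.uncurry f)) (hf' : Continuous (Function.uncurry f'))
    (h : ∀ x y, HasDerivAt (fun x => f x y) (f' x y) x) (a b x : ℝ) :
    HasDerivAt (fun x => ∫ y in a..b, f x y) (∫ y in a..b, f' x y) x := by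
  obtain ⟨B, hB⟩ := ((isCompact_closedBall x 1).prod (isCompact_uIcc (a := a) (b := b))).exists_bound_of_continuousOn
    hf'.continuousOn
  refine (intervalIntegral.hasDerivAt_integral_of_dominated_loc_of_deriv_le (bound := fun _ => B)
    (Metric.closedBall_mem_nhds x one_pos) ?_ ?_ ?_ ?_ ?_ ?_).2
  · exact Eventually.of_forall fun x => Continuous.aestronglyMeasurable (by fun_prop)
  · exact Continuous.intervalIntegrable (by fun_prop) _ _
  · exact Continuous.aestronglyMeasurable (by fun_prop)
  · exact Eventually.of_forall fun y hy z hz => hB (z, y) ⟨hz, uIoc_subset_uIcc hy⟩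
  · exact intervalIntegrable_const
  · exact Eventually.of_forall fun y _ z _ => h z y

/-- The mean (up to the factor `4π`) over the unit sphere, in polar coordinates. -/
def sphInt (f : ℝ → ℝ → ℝ) : ℝ :=
  ∫ ϑ in (0 : ℝ)..Real.pi, ∫ φ in (0 : ℝ)..2 * Real.pi, Real.sin ϑ * f ϑ φ

lemma continuous_sphInt {X : Type*} [TopologicalSpace X] {f : X → ℝ → ℝ → ℝ}
    (hf : Continuous fun z : X × ℝ × ℝ => f z.1 z.2.1 z.2.2) :
    Continuous fun x => sphInt (f x) := by
  unfold sphInt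
  refine intervalIntegral.continuous_parametric_intervalIntegral_of_continuous' ?_ _ _
  refine intervalIntegral.continuous_parametric_intervalIntegral_of_continuous'
    (f := fun (z : X × ℝ) φ => Real.sin z.2 * f z.1 z.2 φ) ?_ _ _
  have : Continuous fun z : (X × ℝ) × ℝ => f z.1.1 z.1.2 z.2 :=
    hf.comp (f := fun z : (X × ℝ) × ℝ => (z.1.1, z.1.2, z.2)) (by fun_prop)
  unfold Function.uncurry
  fun_prop

lemma hasDerivAt_sphInt {f f' : ℝ → ℝ → ℝ → ℝ}
    (hf : Continuous fun z : ℝ × ℝ × ℝ => f z.1 z.2.1 z.2.2)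
    (hf' : Continuous fun z : ℝ × ℝ × ℝ => f' z.1 z.2.1 z.2.2)
    (h : ∀ x ϑ φ, HasDerivAt (fun x => f x ϑ φ) (f' x ϑ φ) x) (x : ℝ) :
    HasDerivAt (fun x => sphInt (f x)) (sphInt (f' x)) x := by
  have c1 : ∀ {g : ℝ → ℝ → ℝ → ℝ} (_ : Continuous fun z : ℝ × ℝ × ℝ => g z.1 z.2.1 z.2.2),
      Continuous (Function.uncurry fun x ϑ => ∫ φ in (0 : ℝ)..2 * Real.pi,
        Real.sin ϑ * g x ϑ φ) := by
    intro g hg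
    refine intervalIntegral.continuous_parametric_intervalIntegral_of_continuous'
      (f := fun (z : ℝ × ℝ) φ => Real.sin z.2 * g z.1 z.2 φ) ?_ _ _
    have : Continuous fun z : (ℝ × ℝ) × ℝ => g z.1.1 z.1.2 z.2 :=
      hg.comp (f := fun z : (ℝ × ℝ) × ℝ => (z.1.1, z.1.2, z.2)) (by fun_prop)
    unfold Function.uncurry
    fun_prop
  refine hasDerivAt_intervalIntegral_of_continuous (c1 hf) (c1 hf') (fun x ϑ => ?_) _ _ x
  refine hasDerivAt_intervalIntegral_of_continuous ?_ ?_ (fun x φ => (h x ϑ φ).const_mul _) _ _ x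
  · have : Continuous fun z : ℝ × ℝ => f z.1 ϑ z.2 :=
      hf.comp (f := fun z : ℝ × ℝ => (z.1, ϑ, z.2)) (by fun_prop)
    unfold Function.uncurry
    fun_prop
  · have : Continuous fun z : ℝ × ℝ => f' z.1 ϑ z.2 :=
      hf'.comp (f := fun z : ℝ × ℝ => (z.1, ϑ, z.2)) (by fun_prop)
    unfold Function.uncurry
    fun_prop

lemma sphInt_const (a : ℝ) : sphInt (fun _ _ => a) = 4 * Real.pi * a := by
  unfold sphInt
  simp [integral_sin]
  ring

lemma exists_orthonormal_zero_eq {e : E3} (he : ‖e‖ = 1) :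
    ∃ b : Fin 3 → E3, Orthonormal ℝ b ∧ b 0 = e := by
  have h : Orthonormal ℝ (({0} : Set (Fin 3)).domRestrict fun _ => e) := by
    rw [orthonormal_iff_ite]
    rintro ⟨i, hi⟩ ⟨j, hj⟩
    simp only [mem_singleton_iff] at hi hj
    subst hi hj
    simp only [domRestrict_apply, if_true]
    simp [he]
  obtain ⟨b, hb⟩ := h.exists_orthonormalBasis_extension_of_card_eq (by simp)
  exact ⟨b, b.orthonormal, hb 0 rfl⟩

lemma trace_eq_sum_frame {b : Fin 3 → E3} (hb : Orthonormal ℝ b) (B : E3 →L[ℝ] E3 →L[ℝ] ℝ) :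
    B (b 0) (b 0) + B (b 1) (b 1) + B (b 2) (b 2) =
      ∑ j, B (EuclideanSpace.single j 1) (EuclideanSpace.single j 1) := by
  obtain ⟨v, hv⟩ : ∃ v : OrthonormalBasis (Fin 3) ℝ E3, ⇑v = b :=
    ⟨(basisOfOrthonormalOfCardEqFinrank hb (by simp)).toOrthonormalBasis (by
      rwa [coe_basisOfOrthonormalOfCardEqFinrank]), by simp⟩
  have h : ∀ j : Fin 3, B (EuclideanSpace.single j 1) (EuclideanSpace.single j 1) =
      ∑ i, ∑ k, (b i) j * (b k) j * B (b i) (b k) := by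
    intro j
    have e : EuclideanSpace.single j (1 : ℝ) = ∑ i, (b i) j • b i := by
      conv_lhs => rw [← v.sum_repr' (EuclideanSpace.single j (1 : ℝ))]
      simp [hv, EuclideanSpace.inner_single_right]
    rw [e]
    simp only [Fin.sum_univ_three, map_add, add_apply, map_smul, smul_apply, smul_eq_mul]
    ring
  have o : ∀ i k : Fin 3, ∑ j, (b i) j * (b k) j = if i = k then 1 else 0 := by
    intro i k
    have := orthonormal_iff_ite.1 hb k i
    rw [PiLp.inner_apply] at this
    simpa [eq_comm] using this
  simp_rw [h]
  simp only [Fin.sum_univ_three] at o ⊢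
  linear_combination (norm := (simp only [Fin.reduceEq, if_true, if_false]; ring)) -(o 0 0) * B (b 0) (b 0) - (o 0 1) * B (b 0) (b 1)
    - (o 0 2) * B (b 0) (b 2) - (o 1 0) * B (b 1) (b 0) - (o 1 1) * B (b 1) (b 1)
    - (o 1 2) * B (b 1) (b 2) - (o 2 0) * B (b 2) (b 0) - (o 2 1) * B (b 2) (b 1)
    - (o 2 2) * B (b 2) (b 2)

/-- Polar coordinates on the unit sphere with respect to a frame. -/
def om (b : Fin 3 → E3) (ϑ φ : ℝ) : E3 :=
  Real.cos ϑ • b 0 + Real.sin ϑ • (Real.cos φ • b 1 + Real.sin φ • b 2)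

/-- The polar derivative of `om`. -/
def omPolar (b : Fin 3 → E3) (ϑ φ : ℝ) : E3 :=
  -Real.sin ϑ • b 0 + Real.cos ϑ • (Real.cos φ • b 1 + Real.sin φ • b 2)

/-- The unit azimuthal direction. -/
def omAzim (b : Fin 3 → E3) (φ : ℝ) : E3 := -Real.sin φ • b 1 + Real.cos φ • b 2

lemma hasDerivAt_om_polar (b : Fin 3 → E3) (ϑ φ : ℝ) :
    HasDerivAt (fun ϑ => om b ϑ φ) (omPolar b ϑ φ) ϑ :=
  ((Real.hasDerivAt_cos ϑ).smul_const _).add ((Real.hasDerivAt_sin ϑ).smul_const _)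

/-- Integrated over the sphere of radius `ρ`, the Laplacian reduces to its radial part. -/
lemma sphInt_laplacian {b : Fin 3 → E3} {L : E3 → E3 →L[ℝ] ℝ} {L' : E3 → E3 →L[ℝ] E3 →L[ℝ] ℝ}
    (hL : ∀ y, HasFDerivAt L (L' y) y) (hL' : Continuous L') (x : E3) (ρ : ℝ) :
    sphInt (fun ϑ φ => ρ * (L' (x + ρ • om b ϑ φ) (b 0) (b 0) + L' (x + ρ • om b ϑ φ) (b 1) (b 1) +
      L' (x + ρ • om b ϑ φ) (b 2) (b 2)) -
      ρ * L' (x + ρ • om b ϑ φ) (om b ϑ φ) (om b ϑ φ) - 2 * L (x + ρ • om b ϑ φ) (om b ϑ φ)) = 0 := by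
  have hcL : Continuous L := continuous_iff_continuousAt.2 fun y => (hL y).continuousAt
  have com : Continuous fun z : ℝ × ℝ => om b z.1 z.2 := by
    unfold om
    fun_prop
  have cpol : Continuous fun z : ℝ × ℝ => omPolar b z.1 z.2 := by
    unfold omPolar
    fun_prop
  have caz : Continuous fun φ : ℝ => omAzim b φ := by
    unfold omAzim
    fun_prop
  set P : ℝ → ℝ → ℝ := fun ϑ φ => Real.sin ϑ * L (x + ρ • om b ϑ φ) (omPolar b ϑ φ) with hP
  set P' : ℝ → ℝ → ℝ := fun ϑ φ => Real.cos ϑ * L (x + ρ • om b ϑ φ) (omPolar b ϑ φ) +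
    Real.sin ϑ * (L' (x + ρ • om b ϑ φ) (ρ • omPolar b ϑ φ) (omPolar b ϑ φ) +
      L (x + ρ • om b ϑ φ) (-om b ϑ φ)) with hP'
  set Q : ℝ → ℝ → ℝ := fun ϑ φ => L (x + ρ • om b ϑ φ) (omAzim b φ) with hQ
  set Q' : ℝ → ℝ → ℝ := fun ϑ φ =>
    L' (x + ρ • om b ϑ φ) (ρ • Real.sin ϑ • omAzim b φ) (omAzim b φ) +
      L (x + ρ • om b ϑ φ) (-(Real.cos φ • b 1 + Real.sin φ • b 2)) with hQ'
  have dP : ∀ ϑ φ, HasDerivAt (fun ϑ => P ϑ φ) (P' ϑ φ) ϑ := by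
    intro ϑ φ
    have h1 : HasDerivAt (fun ϑ => x + ρ • om b ϑ φ) (ρ • omPolar b ϑ φ) ϑ :=
      ((hasDerivAt_om_polar b ϑ φ).const_smul ρ).const_add x
    have h2 : HasDerivAt (fun ϑ => omPolar b ϑ φ) (-om b ϑ φ) ϑ := by
      refine (((Real.hasDerivAt_sin ϑ).neg.smul_const (b 0)).add
        ((Real.hasDerivAt_cos ϑ).smul_const (Real.cos φ • b 1 + Real.sin φ • b 2))).congr_deriv ?_
      unfold om
      module
    exact (Real.hasDerivAt_sin ϑ).mul (((hL _).comp_hasDerivAt ϑ h1).clm_apply h2)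
  have dQ : ∀ ϑ φ, HasDerivAt (fun φ => Q ϑ φ) (Q' ϑ φ) φ := by
    intro ϑ φ
    have h1 : HasDerivAt (fun φ => x + ρ • om b ϑ φ) (ρ • Real.sin ϑ • omAzim b φ) φ := by
      have h0 := ((Real.hasDerivAt_cos φ).smul_const (b 1)).add
        ((Real.hasDerivAt_sin φ).smul_const (b 2))
      exact (((h0.const_smul (Real.sin ϑ)).const_add (Real.cos ϑ • b 0)).const_smul ρ).const_add x
    have h2 : HasDerivAt (fun φ => omAzim b φ) (-(Real.cos φ • b 1 + Real.sin φ • b 2)) φ := by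
      refine (((Real.hasDerivAt_sin φ).neg.smul_const (b 1)).add
        ((Real.hasDerivAt_cos φ).smul_const (b 2))).congr_deriv ?_
      module
    exact ((hL _).comp_hasDerivAt φ h1).clm_apply h2
  have cP : Continuous (Function.uncurry P) := by
    simp only [hP]
    unfold Function.uncurry
    fun_prop
  have cP' : Continuous (Function.uncurry P') := by
    simp only [hP']
    unfold Function.uncurry
    fun_prop
  have cQ' : Continuous (Function.uncurry Q') := by
    simp only [hQ']
    unfold Function.uncurry
    fun_prop
  have IP : ∫ ϑ in (0 : ℝ)..Real.pi, ∫ φ in (0 : ℝ)..2 * Real.pi, P' ϑ φ = 0 := by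
    rw [intervalIntegral.integral_eq_sub_of_hasDerivAt
      (f := fun ϑ => ∫ φ in (0 : ℝ)..2 * Real.pi, P ϑ φ)]
    · simp [hP]
    · exact fun ϑ _ => hasDerivAt_intervalIntegral_of_continuous cP cP' dP _ _ ϑ
    · exact (intervalIntegral.continuous_parametric_intervalIntegral_of_continuous' cP' _ _).intervalIntegrable _ _
  have IQ : ∀ ϑ, ∫ φ in (0 : ℝ)..2 * Real.pi, Q' ϑ φ = 0 := by
    intro ϑ
    rw [intervalIntegral.integral_eq_sub_of_hasDerivAt (f := fun φ => Q ϑ φ)]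
    · simp [hQ, om, omAzim]
    · exact fun φ _ => dQ ϑ φ
    · exact Continuous.intervalIntegrable (by fun_prop) _ _
  rw [← IP]
  unfold sphInt
  refine intervalIntegral.integral_congr fun ϑ _ => ?_
  simp only
  have hsum : ∫ φ in (0 : ℝ)..2 * Real.pi, P' ϑ φ =
      ∫ φ in (0 : ℝ)..2 * Real.pi, (P' ϑ φ + Q' ϑ φ) := by
    rw [intervalIntegral.integral_add (f := P' ϑ) (g := Q' ϑ), IQ, add_zero]
    · exact Continuous.intervalIntegrable (by fun_prop) _ _
    · exact Continuous.intervalIntegrable (by fun_prop) _ _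
  rw [hsum]
  refine intervalIntegral.integral_congr fun φ _ => ?_
  simp only [hP', hQ', om, omPolar, omAzim]
  generalize L (x + _) = l
  generalize L' (x + _) = B
  simp only [map_add, map_neg, map_smul, add_apply, smul_apply, smul_eq_mul]
  have s1 := Real.sin_sq_add_cos_sq ϑ
  have s2 := Real.sin_sq_add_cos_sq φ
  generalize Real.sin ϑ = s at *
  generalize Real.cos ϑ = c at *
  generalize Real.sin φ = s' at *
  generalize Real.cos φ = c' at *
  linear_combination (-(c' * l (b 1) + s' * l (b 2)) - s * ρ * (B (b 0) (b 0) +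
    (c' * (c' * B (b 1) (b 1) + s' * B (b 1) (b 2)) +
      s' * (c' * B (b 2) (b 1) + s' * B (b 2) (b 2))))) * s1 -
    s * ρ * (B (b 1) (b 1) + B (b 2) (b 2)) * s2

end

section

open MeasureTheory Set Filter Topology

/-- The wave operator. -/
def box (c : ℝ) (u : Fn) : Fn := fun t x => pt (pt u) t x - c ^ 2 * ∑ j, pd j (pd j u) t x

/-- Uncurrying of a space-time function. -/
def unc (f : Fn) : ℝ × E3 → ℝ := fun p => f p.1 p.2

lemma Smooth.differentiable {f : Fn} (hf : Smooth f) : Differentiable ℝ (unc f) :=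
  ContDiff.differentiable hf (by simp)

lemma Smooth.hasFDerivAt {f : Fn} (hf : Smooth f) (p : ℝ × E3) :
    HasFDerivAt (unc f) (fderiv ℝ (unc f) p) p :=
  (hf.differentiable p).hasFDerivAt

lemma Smooth.continuous {f : Fn} (hf : Smooth f) : Continuous (unc f) :=
  ContDiff.continuous hf

lemma Smooth.contDiff_fderiv {f : Fn} (hf : Smooth f) :
    ContDiff ℝ (⊤ : ℕ∞) (fderiv ℝ (unc f)) :=
  ContDiff.fderiv_right (m := (⊤ : ℕ∞)) hf (by simp)

lemma Smooth.hasFDerivAt_fderiv {f : Fn} (hf : Smooth f) (p : ℝ × E3) :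
    HasFDerivAt (fderiv ℝ (unc f)) (fderiv ℝ (fderiv ℝ (unc f)) p) p :=
  (hf.contDiff_fderiv.differentiable (by simp) p).hasFDerivAt

lemma Smooth.pt_eq {f : Fn} (hf : Smooth f) (t : ℝ) (x : E3) :
    pt f t x = fderiv ℝ (unc f) (t, x) (1, 0) := by
  have h : HasDerivAt (fun s : ℝ => ((s, x) : ℝ × E3)) (1, 0) t :=
    (hasDerivAt_id t).prodMk (hasDerivAt_const t x)
  exact ((hf.hasFDerivAt (t, x)).comp_hasDerivAt t h).deriv

lemma Smooth.hasFDerivAt_space {f : Fn} (hf : Smooth f) (t : ℝ) (x : E3) :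
    HasFDerivAt (f t) ((fderiv ℝ (unc f) (t, x)).comp (ContinuousLinearMap.inr ℝ ℝ E3)) x := by
  have h : HasFDerivAt (fun y : E3 => ((t, y) : ℝ × E3)) (ContinuousLinearMap.inr ℝ ℝ E3) x :=
    hasFDerivAt_prodMk_right t x
  exact (hf.hasFDerivAt (t, x)).comp x h

lemma Smooth.fderiv_space {f : Fn} (hf : Smooth f) (t : ℝ) (x v : E3) :
    fderiv ℝ (f t) x v = fderiv ℝ (unc f) (t, x) (0, v) := by
  rw [(hf.hasFDerivAt_space t x).fderiv]
  simp

lemma Smooth.pd_eq {f : Fn} (hf : Smooth f) (j : Fin 3) (t : ℝ) (x : E3) :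
    pd j f t x = fderiv ℝ (unc f) (t, x) (0, EuclideanSpace.single j 1) :=
  hf.fderiv_space t x _

lemma Smooth.unc_pt {f : Fn} (hf : Smooth f) :
    unc (pt f) = fun p => fderiv ℝ (unc f) p (1, 0) := by
  ext p
  exact hf.pt_eq p.1 p.2

lemma Smooth.unc_pd {f : Fn} (hf : Smooth f) (j : Fin 3) :
    unc (pd j f) = fun p => fderiv ℝ (unc f) p (0, EuclideanSpace.single j 1) := by
  ext p
  exact hf.pd_eq j p.1 p.2

lemma Smooth.pt {f : Fn} (hf : Smooth f) : Smooth (pt f) := by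
  have : ContDiff ℝ (⊤ : ℕ∞) (unc (PaperKatayama.pt f)) := by
    rw [hf.unc_pt]
    exact hf.contDiff_fderiv.clm_apply contDiff_const
  exact this

lemma Smooth.pd {f : Fn} (hf : Smooth f) (j : Fin 3) : Smooth (pd j f) := by
  have : ContDiff ℝ (⊤ : ℕ∞) (unc (PaperKatayama.pd j f)) := by
    rw [hf.unc_pd]
    exact hf.contDiff_fderiv.clm_apply contDiff_const
  exact this

lemma Smooth.fderiv_fderiv_apply {f : Fn} (hf : Smooth f) (p v w : ℝ × E3) :
    fderiv ℝ (fun p => fderiv ℝ (unc f) p v) p w = fderiv ℝ (fderiv ℝ (unc f)) p w v := by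
  have := (hf.hasFDerivAt_fderiv p).clm_apply (hasFDerivAt_const v p)
  rw [this.fderiv]
  simp

lemma Smooth.box_eq {f : Fn} (hf : Smooth f) (c t : ℝ) (x : E3) :
    box c f t x = fderiv ℝ (fderiv ℝ (unc f)) (t, x) (1, 0) (1, 0) - c ^ 2 * ∑ j : Fin 3,
      fderiv ℝ (fderiv ℝ (unc f)) (t, x) (0, EuclideanSpace.single j 1)
        (0, EuclideanSpace.single j 1) := by
  unfold box
  rw [hf.pt.pt_eq, hf.unc_pt, hf.fderiv_fderiv_apply]
  simp_rw [(hf.pd _).pd_eq, hf.unc_pd, hf.fderiv_fderiv_apply]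

lemma Smooth.box {f : Fn} (hf : Smooth f) (c : ℝ) : Smooth (box c f) := by
  refine ContDiff.sub hf.pt.pt (contDiff_const.mul (ContDiff.sum fun j _ => ?_))
  exact (hf.pd j).pd j

lemma sphInt_const_mul (a : ℝ) (f : ℝ → ℝ → ℝ) :
    sphInt (fun ϑ φ => a * f ϑ φ) = a * sphInt f := by
  unfold sphInt
  simp_rw [mul_left_comm _ a, intervalIntegral.integral_const_mul]

lemma sphInt_add {f g : ℝ → ℝ → ℝ} (hf : Continuous (Function.uncurry f))
    (hg : Continuous (Function.uncurry g)) :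
    sphInt (fun ϑ φ => f ϑ φ + g ϑ φ) = sphInt f + sphInt g := by
  have c1 : ∀ {h : ℝ → ℝ → ℝ}, Continuous (Function.uncurry h) →
      Continuous (Function.uncurry fun ϑ φ => Real.sin ϑ * h ϑ φ) := by
    intro h hh
    unfold Function.uncurry at hh ⊢
    fun_prop
  unfold sphInt
  rw [← intervalIntegral.integral_add]
  · refine intervalIntegral.integral_congr fun ϑ _ => ?_
    simp only
    rw [← intervalIntegral.integral_add]
    · simp_rw [mul_add]
    · exact ((c1 hf).comp (Continuous.prodMk_right ϑ)).intervalIntegrable _ _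
    · exact ((c1 hg).comp (Continuous.prodMk_right ϑ)).intervalIntegrable _ _
  · exact (intervalIntegral.continuous_parametric_intervalIntegral_of_continuous' (c1 hf) _ _).intervalIntegrable _ _
  · exact (intervalIntegral.continuous_parametric_intervalIntegral_of_continuous' (c1 hg) _ _).intervalIntegrable _ _

lemma continuous_om (b : Fin 3 → E3) : Continuous fun z : ℝ × ℝ => om b z.1 z.2 := by
  unfold om
  fun_prop

/-- Retarded potential. -/
def kir (c : ℝ) (b : Fin 3 → E3) (F : Fn) (t : ℝ) (x : E3) : ℝ :=
  t ^ 2 / (4 * Real.pi) * ∫ η in (0 : ℝ)..1, η *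
    sphInt fun ϑ φ => F (t * (1 - η)) (x + (c * t * η) • om b ϑ φ)

lemma hasDerivAt_add_mul_fderiv {E : Type*} [NormedAddCommGroup E] [NormedSpace ℝ E] {U : E → ℝ}
    {D : E → E →L[ℝ] ℝ} {D2 : E → E →L[ℝ] E →L[ℝ] ℝ} (hU : ∀ p, HasFDerivAt U (D p) p)
    (hD : ∀ p, HasFDerivAt D (D2 p) p) {p : ℝ → E} {p' : E} {η : ℝ} (dp : HasDerivAt p p' η)
    (a c : ℝ) (v : E) :
    HasDerivAt (fun η => c * U (p η) + a * η * D (p η) v)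
      (c * D (p η) p' + (a * D (p η) v + a * η * D2 (p η) p' v)) η := by
  have e1 : HasDerivAt (fun η => U (p η)) (D (p η) p') η := (hU (p η)).comp_hasDerivAt η dp
  have e2 : HasDerivAt (fun η => D (p η)) (D2 (p η) p') η := (hD (p η)).comp_hasDerivAt η dp
  have e3 : HasDerivAt (fun η => D (p η) v) (D2 (p η) p' v) η := by
    have := e2.clm_apply (hasDerivAt_const η v)
    simpa using this
  have e4 : HasDerivAt (fun η : ℝ => a * η) a η := by
    simpa using (hasDerivAt_id η).const_mul a
  exact (e1.const_mul c).add (e4.mul e3)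

lemma eq_kir {c : ℝ} (hc : 0 < c) {b : Fin 3 → E3} (hb : Orthonormal ℝ b) {u : Fn} (hu : Smooth u)
    (h0 : ∀ x, u 0 x = 0) (h1 : ∀ x, pt u 0 x = 0) (t : ℝ) (x : E3) :
    u t x = kir c b (box c u) t x := by
  set D := fderiv ℝ (unc u) with hD
  set D2 := fderiv ℝ D with hD2
  have cD : Continuous D := hu.contDiff_fderiv.continuous
  have cD2 : Continuous D2 := hu.contDiff_fderiv.continuous_fderiv (by simp)
  have cU := hu.continuous
  have com : Continuous fun z : ℝ × ℝ × ℝ => om b z.2.1 z.2.2 :=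
    (continuous_om b).comp (f := fun z : ℝ × ℝ × ℝ => (z.2.1, z.2.2)) (by fun_prop)
  set p : ℝ → ℝ → ℝ → ℝ × E3 := fun η ϑ φ => (t * (1 - η), x + (c * t * η) • om b ϑ φ) with hp
  have cp : Continuous fun z : ℝ × ℝ × ℝ => p z.1 z.2.1 z.2.2 := by
    simp only [hp]
    fun_prop
  set W : ℝ → ℝ → ℝ → ℝ := fun η ϑ φ =>
    c * unc u (p η ϑ φ) + c * t * η * D (p η ϑ φ) (1, c • om b ϑ φ) with hW
  set W' : ℝ → ℝ → ℝ → ℝ := fun η ϑ φ =>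
    c * D (p η ϑ φ) (-t, (c * t) • om b ϑ φ) + (c * t * D (p η ϑ φ) (1, c • om b ϑ φ) +
      c * t * η * D2 (p η ϑ φ) (-t, (c * t) • om b ϑ φ) (1, c • om b ϑ φ)) with hW'
  have cW : Continuous fun z : ℝ × ℝ × ℝ => W z.1 z.2.1 z.2.2 := by
    simp only [hW]
    fun_prop
  have cW' : Continuous fun z : ℝ × ℝ × ℝ => W' z.1 z.2.1 z.2.2 := by
    simp only [hW']
    fun_prop
  have dW : ∀ η ϑ φ, HasDerivAt (fun η => W η ϑ φ) (W' η ϑ φ) η := by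
    intro η ϑ φ
    have dp : HasDerivAt (fun η => p η ϑ φ) (-t, (c * t) • om b ϑ φ) η := by
      refine HasDerivAt.prodMk ?_ ?_
      · have := ((hasDerivAt_id η).const_sub 1).const_mul t
        simpa using this
      · have := (((hasDerivAt_id η).const_mul (c * t)).smul_const (om b ϑ φ)).const_add x
        simpa using this
    exact hasDerivAt_add_mul_fderiv hu.hasFDerivAt hu.hasFDerivAt_fderiv dp (c * t) c _
  have ftc : ∫ η in (0 : ℝ)..1, sphInt (W' η) = sphInt (W 1) - sphInt (W 0) :=
    intervalIntegral.integral_eq_sub_of_hasDerivAt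
      (fun η _ => hasDerivAt_sphInt cW cW' dW η)
      ((continuous_sphInt cW').intervalIntegrable _ _)
  have W1 : sphInt (W 1) = 0 := by
    have : W 1 = fun _ _ => 0 := by
      ext ϑ φ
      have z1 : unc u (p 1 ϑ φ) = 0 := by
        simp [hp, unc, h0]
      have z2 : D (p 1 ϑ φ) (1, c • om b ϑ φ) = 0 := by
        have e : ((1, c • om b ϑ φ) : ℝ × E3) = (1, 0) + (0, c • om b ϑ φ) := by simp
        have hz : u 0 = fun _ => 0 := funext h0
        rw [e, map_add]
        simp only [hp, sub_self, mul_zero]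
        rw [← hu.pt_eq, ← hu.fderiv_space, h1, hz]
        simp
      simp only [hW]
      rw [z1, z2]
      ring
    rw [this, sphInt_const, mul_zero]
  have W0 : sphInt (W 0) = 4 * Real.pi * (c * u t x) := by
    rw [← sphInt_const]
    congr 1
    ext ϑ φ
    simp [hW, hp, unc]
  have main : ∀ η, sphInt (W' η) = -(c * t ^ 2) * (η *
      sphInt fun ϑ φ => box c u (t * (1 - η)) (x + (c * t * η) • om b ϑ φ)) := by
    intro η
    set s := t * (1 - η) with hs
    set R := (ContinuousLinearMap.inr ℝ ℝ E3) with hR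
    have dL : ∀ y, HasFDerivAt (fun y => (D (s, y)).comp R)
        (((ContinuousLinearMap.compL ℝ E3 (ℝ × E3) ℝ).flip R).comp ((D2 (s, y)).comp R)) y := by
      intro y
      have h : HasFDerivAt (fun y : E3 => ((s, y) : ℝ × E3)) R y := hasFDerivAt_prodMk_right s y
      exact ((ContinuousLinearMap.compL ℝ E3 (ℝ × E3) ℝ).flip R).hasFDerivAt.comp y
        ((hu.hasFDerivAt_fderiv (s, y)).comp y h)
    have dar := sphInt_laplacian (b := b) dL (by fun_prop) x (c * t * η)
    have cx : Continuous (Function.uncurry fun ϑ φ => box c u s (x + (c * t * η) • om b ϑ φ)) := by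
      have := (hu.box c).continuous
      have e : (Function.uncurry fun ϑ φ => box c u s (x + (c * t * η) • om b ϑ φ)) =
          unc (box c u) ∘ fun z : ℝ × ℝ => (s, x + (c * t * η) • om b z.1 z.2) := rfl
      rw [e]
      have := continuous_om b
      fun_prop
    have com2 := continuous_om b
    rw [← mul_assoc, ← sphInt_const_mul, ← add_zero (sphInt fun ϑ φ => _ * _),
      ← mul_zero (-(c ^ 2 * t)), ← dar, ← sphInt_const_mul, ← sphInt_add]
    · congr 1
      ext ϑ φ
      have sym : D2 (p η ϑ φ) (0, om b ϑ φ) (1, 0) = D2 (p η ϑ φ) (1, 0) (0, om b ϑ φ) := by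
        have : IsSymmSndFDerivAt ℝ (unc u) (p η ϑ φ) :=
          (ContDiff.contDiffAt hu).isSymmSndFDerivAt (by
            simp only [minSmoothness_of_isRCLikeNormedField]
            exact WithTop.coe_le_coe.2 le_top)
        exact this _ _
      have e1 : ((-t, (c * t) • om b ϑ φ) : ℝ × E3) = (-t) • (1, 0) + (c * t) • (0, om b ϑ φ) := by
        simp
      have e2 : ((1, c • om b ϑ φ) : ℝ × E3) = (1, 0) + c • (0, om b ϑ φ) := by
        simp
      have tr := trace_eq_sum_frame hb
        (((ContinuousLinearMap.compL ℝ E3 (ℝ × E3) ℝ).flip R).comp ((D2 (p η ϑ φ)).comp R))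
      simp only [hR, ContinuousLinearMap.comp_apply, ContinuousLinearMap.flip_apply,
        ContinuousLinearMap.compL_apply, ContinuousLinearMap.inr_apply] at tr
      rw [hu.box_eq]
      simp only [hW', hR, ContinuousLinearMap.comp_apply, ContinuousLinearMap.flip_apply,
        ContinuousLinearMap.compL_apply, ContinuousLinearMap.inr_apply]
      rw [e1, e2]
      simp only [map_add, map_smul, add_apply, smul_apply, smul_eq_mul]
      rw [sym]
      change _ = -(c * t ^ 2) * η * (D2 (p η ϑ φ) (1, 0) (1, 0) - c ^ 2 * ∑ j : Fin 3,
        D2 (p η ϑ φ) (0, EuclideanSpace.single j 1) (0, EuclideanSpace.single j 1)) +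
        -(c ^ 2 * t) * (c * t * η * (D2 (p η ϑ φ) (0, b 0) (0, b 0) +
          D2 (p η ϑ φ) (0, b 1) (0, b 1) + D2 (p η ϑ φ) (0, b 2) (0, b 2)) -
          c * t * η * D2 (p η ϑ φ) (0, om b ϑ φ) (0, om b ϑ φ) -
          2 * D (p η ϑ φ) (0, om b ϑ φ))
      rw [← tr]
      ring
    · unfold Function.uncurry at cx ⊢
      fun_prop
    · unfold Function.uncurry
      fun_prop
  simp_rw [main] at ftc
  rw [W1, W0, intervalIntegral.integral_const_mul] at ftc
  unfold kir
  have hpi := Real.pi_pos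
  have hc' : c ≠ 0 := hc.ne'
  generalize (∫ η in (0 : ℝ)..1, η *
    sphInt fun ϑ φ => box c u (t * (1 - η)) (x + (c * t * η) • om b ϑ φ)) = I at ftc ⊢
  field_simp
  refine mul_left_cancel₀ hc' ?_
  linear_combination ftc

end

section

open MeasureTheory Set Filter Topology

/-- The distance `|x + ρω|`, for `|x| = r` and polar angle `ϑ`. -/
def bipDist (r ρ ϑ : ℝ) : ℝ := Real.sqrt (r ^ 2 + ρ ^ 2 + 2 * r * ρ * Real.cos ϑ)

section
variable {r ρ ϑ : ℝ}

lemma bipDist_arg_pos (hr : 0 < r) (hρ : 0 < ρ) (hϑ : ϑ ∈ Ioo 0 Real.pi) :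
    0 < r ^ 2 + ρ ^ 2 + 2 * r * ρ * Real.cos ϑ := by
  have h : -1 < Real.cos ϑ := by
    rw [← Real.cos_pi]
    exact Real.strictAntiOn_cos ⟨hϑ.1.le, hϑ.2.le⟩ ⟨Real.pi_pos.le, le_rfl⟩ hϑ.2
  nlinarith [mul_pos hr hρ, sq_nonneg (r - ρ)]

lemma bipDist_pos (hr : 0 < r) (hρ : 0 < ρ) (hϑ : ϑ ∈ Ioo 0 Real.pi) : 0 < bipDist r ρ ϑ :=
  Real.sqrt_pos.2 (bipDist_arg_pos hr hρ hϑ)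

lemma bipDist_sq (hr : 0 < r) (hρ : 0 < ρ) (hϑ : ϑ ∈ Ioo 0 Real.pi) :
    bipDist r ρ ϑ ^ 2 = r ^ 2 + ρ ^ 2 + 2 * r * ρ * Real.cos ϑ :=
  Real.sq_sqrt (bipDist_arg_pos hr hρ hϑ).le

lemma hasDerivAt_bipDist (hr : 0 < r) (hρ : 0 < ρ) (hϑ : ϑ ∈ Ioo 0 Real.pi) :
    HasDerivAt (bipDist r ρ) (-(r * ρ * Real.sin ϑ) / bipDist r ρ ϑ) ϑ := by
  have h := (((Real.hasDerivAt_cos ϑ).const_mul (2 * r * ρ)).const_add (r ^ 2 + ρ ^ 2)).sqrt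
    (bipDist_arg_pos hr hρ hϑ).ne'
  refine h.congr_deriv ?_
  have := bipDist_pos hr hρ hϑ
  unfold bipDist at this ⊢
  field_simp

lemma injOn_bipDist (hr : 0 < r) (hρ : 0 < ρ) : InjOn (bipDist r ρ) (Ioo 0 Real.pi) := by
  intro a ha b hb hab
  have h : bipDist r ρ a ^ 2 = bipDist r ρ b ^ 2 := by rw [hab]
  rw [bipDist_sq hr hρ ha, bipDist_sq hr hρ hb] at h
  refine Real.injOn_cos ⟨ha.1.le, ha.2.le⟩ ⟨hb.1.le, hb.2.le⟩ ?_
  have := (mul_pos hr hρ).ne'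
  have h2 : r * ρ * Real.cos a = r * ρ * Real.cos b := by linarith
  exact mul_left_cancel₀ this h2

lemma image_bipDist (hr : 0 < r) (hρ : 0 < ρ) :
    bipDist r ρ '' Ioo 0 Real.pi = Ioo |r - ρ| (r + ρ) := by
  have hrρ := mul_pos hr hρ
  ext l
  constructor
  · rintro ⟨ϑ, hϑ, rfl⟩
    have h : -1 < Real.cos ϑ := by
      rw [← Real.cos_pi]
      exact Real.strictAntiOn_cos ⟨hϑ.1.le, hϑ.2.le⟩ ⟨Real.pi_pos.le, le_rfl⟩ hϑ.2
    have h' : Real.cos ϑ < 1 := by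
      rw [← Real.cos_zero]
      exact Real.strictAntiOn_cos ⟨le_rfl, Real.pi_pos.le⟩ ⟨hϑ.1.le, hϑ.2.le⟩ hϑ.1
    have hs := bipDist_sq hr hρ hϑ
    have hp := bipDist_pos hr hρ hϑ
    constructor
    · refine lt_of_pow_lt_pow_left₀ 2 hp.le ?_
      rw [sq_abs]
      nlinarith
    · refine lt_of_pow_lt_pow_left₀ 2 (by positivity) ?_
      nlinarith
  · rintro ⟨h1, h2⟩
    have hl : 0 < l := (abs_nonneg _).trans_lt h1
    have h1' : (r - ρ) ^ 2 < l ^ 2 := by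
      rw [← sq_abs]
      gcongr
    have h2' : l ^ 2 < (r + ρ) ^ 2 := by gcongr
    have l1 : -1 < (l ^ 2 - r ^ 2 - ρ ^ 2) / (2 * r * ρ) := by
      rw [lt_div_iff₀ (by positivity)]
      nlinarith
    have l2 : (l ^ 2 - r ^ 2 - ρ ^ 2) / (2 * r * ρ) < 1 := by
      rw [div_lt_iff₀ (by positivity)]
      nlinarith
    refine ⟨Real.arccos ((l ^ 2 - r ^ 2 - ρ ^ 2) / (2 * r * ρ)), ⟨Real.arccos_pos.2 l2, ?_⟩, ?_⟩
    · refine lt_of_le_of_ne (Real.arccos_le_pi _) fun h => ?_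
      rw [Real.arccos_eq_pi] at h
      linarith
    · unfold bipDist
      rw [Real.cos_arccos l1.le l2.le]
      rw [show r ^ 2 + ρ ^ 2 + 2 * r * ρ * ((l ^ 2 - r ^ 2 - ρ ^ 2) / (2 * r * ρ)) = l ^ 2 by
        field_simp
        ring]
      exact Real.sqrt_sq hl.le

lemma bipDist_smul_om (hr : 0 < r) (hρ : 0 < ρ) (hϑ : ϑ ∈ Ioo 0 Real.pi) (b : Fin 3 → E3) (φ : ℝ) :
    bipDist r ρ ϑ • om b (Real.arccos ((bipDist r ρ ϑ ^ 2 + r ^ 2 - ρ ^ 2) /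
      (2 * r * bipDist r ρ ϑ))) φ = r • b 0 + ρ • om b ϑ φ := by
  have hs := bipDist_sq hr hρ hϑ
  have hp := bipDist_pos hr hρ hϑ
  set l := bipDist r ρ ϑ
  have e : (l ^ 2 + r ^ 2 - ρ ^ 2) / (2 * r * l) = (r + ρ * Real.cos ϑ) / l := by
    rw [hs]
    field_simp
    ring
  rw [e]
  have hcs := Real.sin_sq_add_cos_sq ϑ
  have hsin : 0 < Real.sin ϑ := Real.sin_pos_of_mem_Ioo hϑ
  have hsq : ((r + ρ * Real.cos ϑ) / l) ^ 2 + (ρ * Real.sin ϑ / l) ^ 2 = 1 := by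
    rw [div_pow, div_pow, ← add_div, div_eq_one_iff_eq (by positivity), hs]
    linear_combination ρ ^ 2 * hcs
  have habs : |(r + ρ * Real.cos ϑ) / l| ≤ 1 := by
    rw [← sq_le_one_iff_abs_le_one]
    nlinarith [sq_nonneg (ρ * Real.sin ϑ / l)]
  have hc : Real.cos (Real.arccos ((r + ρ * Real.cos ϑ) / l)) = (r + ρ * Real.cos ϑ) / l :=
    Real.cos_arccos (abs_le.1 habs).1 (abs_le.1 habs).2
  have hsn : Real.sin (Real.arccos ((r + ρ * Real.cos ϑ) / l)) = ρ * Real.sin ϑ / l := by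
    rw [Real.sin_arccos, show 1 - ((r + ρ * Real.cos ϑ) / l) ^ 2 = (ρ * Real.sin ϑ / l) ^ 2 by
      linarith]
    exact Real.sqrt_sq (by positivity)
  unfold om
  rw [hc, hsn]
  simp only [smul_add, smul_smul, ← mul_assoc]
  rw [mul_div_cancel₀ _ hp.ne', mul_div_cancel₀ _ hp.ne', add_smul]
  abel

/-- Spherical integrals in bipolar coordinates. -/
lemma sphInt_eq_bipolar (hr : 0 < r) (hρ : 0 < ρ) (b : Fin 3 → E3) (h : E3 → ℝ) :
    r * ρ * sphInt (fun ϑ φ => h (r • b 0 + ρ • om b ϑ φ)) =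
      ∫ l in Ioo |r - ρ| (r + ρ), l * ∫ φ in (0 : ℝ)..2 * Real.pi,
        h (l • om b (Real.arccos ((l ^ 2 + r ^ 2 - ρ ^ 2) / (2 * r * l))) φ) := by
  rw [← image_bipDist hr hρ, integral_image_eq_integral_abs_deriv_smul measurableSet_Ioo
    (fun ϑ hϑ => (hasDerivAt_bipDist hr hρ hϑ).hasDerivWithinAt) (injOn_bipDist hr hρ)]
  unfold sphInt
  simp_rw [intervalIntegral.integral_const_mul]
  rw [intervalIntegral.integral_of_le Real.pi_pos.le, integral_Ioc_eq_integral_Ioo,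
    ← integral_const_mul]
  refine setIntegral_congr_fun measurableSet_Ioo fun ϑ hϑ => ?_
  have hp := bipDist_pos hr hρ hϑ
  have hsin : 0 < Real.sin ϑ := Real.sin_pos_of_mem_Ioo hϑ
  simp only [smul_eq_mul]
  simp_rw [bipDist_smul_om hr hρ hϑ b]
  rw [neg_div, abs_neg, abs_of_pos (by positivity)]
  field_simp

end

/-- Domain of integration `{|r - c(t-s)| < l < r + c(t-s), 0 < s}` in bipolar coordinates. -/
def bipDom (c t r : ℝ) : Set (ℝ × ℝ) :=
  {z | c * t - r < c * z.1 + z.2 ∧ c * z.1 + z.2 < c * t + r ∧ c * z.1 - z.2 < c * t - r ∧ 0 < z.1}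

/-- The polar angle of a point of the backward light cone in bipolar coordinates. -/
def bipAng (c t r : ℝ) (z : ℝ × ℝ) : ℝ :=
  Real.arccos ((z.2 ^ 2 + r ^ 2 - (c * (t - z.1)) ^ 2) / (2 * r * z.2))

/-- Azimuthal integral. -/
def azInt (b : Fin 3 → E3) (H : Fn) (s l θ : ℝ) : ℝ :=
  ∫ φ in (0 : ℝ)..2 * Real.pi, H s (l • om b θ φ)

/-- Integrand of the retarded potential in bipolar coordinates. -/
def bipInt (c : ℝ) (b : Fin 3 → E3) (H : Fn) (t r : ℝ) : ℝ × ℝ → ℝ :=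
  (bipDom c t r).indicator fun z => z.2 * azInt b H z.1 z.2 (bipAng c t r z)

lemma measurableSet_bipDom (c t r : ℝ) : MeasurableSet (bipDom c t r) := by
  have m : ∀ {f g : ℝ × ℝ → ℝ}, Measurable f → Measurable g → MeasurableSet {z | f z < g z} :=
    measurableSet_lt
  exact (m (by fun_prop) (by fun_prop)).inter ((m (by fun_prop) (by fun_prop)).inter
    ((m (by fun_prop) (by fun_prop)).inter (m (by fun_prop) (by fun_prop))))

lemma mem_bipDom_iff {c t r s l : ℝ} :
    (s, l) ∈ bipDom c t r ↔ 0 < s ∧ l ∈ Ioo |r - c * (t - s)| (r + c * (t - s)) := by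
  simp only [bipDom, mem_ofPred_eq, mem_Ioo, abs_lt]
  constructor
  · rintro ⟨h1, h2, h3, h4⟩
    exact ⟨h4, ⟨by linarith, by linarith⟩, by linarith⟩
  · rintro ⟨h4, ⟨h1, h2⟩, h3⟩
    exact ⟨by linarith, by linarith, by linarith, h4⟩

lemma time_lt_of_mem_bipDom {c t r s l : ℝ} (hc : 0 < c) (h : (s, l) ∈ bipDom c t r) : s < t := by
  obtain ⟨h1, h2, h3, h4⟩ := h
  simp only at *
  nlinarith

lemma pos_of_mem_bipDom {c t r s l : ℝ} (h : (s, l) ∈ bipDom c t r) : 0 < l :=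
  (abs_nonneg _).trans_lt (mem_bipDom_iff.1 h).2.1

lemma continuous_azInt (b : Fin 3 → E3) {H : Fn} (hH : Continuous (unc H)) :
    Continuous fun z : ℝ × ℝ × ℝ => azInt b H z.1 z.2.1 z.2.2 := by
  unfold azInt
  refine intervalIntegral.continuous_parametric_intervalIntegral_of_continuous'
    (f := fun (z : ℝ × ℝ × ℝ) φ => H z.1 (z.2.1 • om b z.2.2 φ)) ?_ _ _
  have := (continuous_om b)
  have e : (Function.uncurry fun (z : ℝ × ℝ × ℝ) φ => H z.1 (z.2.1 • om b z.2.2 φ)) =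
    unc H ∘ fun w : (ℝ × ℝ × ℝ) × ℝ => (w.1.1, w.1.2.1 • om b w.1.2.2 w.2) := rfl
  rw [e]
  have h2 : Continuous fun w : (ℝ × ℝ × ℝ) × ℝ => om b w.1.2.2 w.2 :=
    this.comp (f := fun w : (ℝ × ℝ × ℝ) × ℝ => (w.1.2.2, w.2)) (by fun_prop)
  fun_prop

lemma integrable_bipInt {c : ℝ} (hc : 0 < c) (b : Fin 3 → E3) {H : Fn} (hH : Continuous (unc H))
    (t r : ℝ) : Integrable (bipInt c b H t r) := by
  set K : Set (ℝ × ℝ) := Icc 0 t ×ˢ Icc 0 (r + c * t) with hK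
  have hsub : bipDom c t r ⊆ K := by
    rintro ⟨s, l⟩ h
    have h1 := time_lt_of_mem_bipDom hc h
    have h2 := pos_of_mem_bipDom h
    obtain ⟨_, h4, _, h3⟩ := h
    simp only at *
    refine ⟨⟨h3.le, h1.le⟩, h2.le, ?_⟩
    simp only
    nlinarith
  have hcomp : IsCompact (Icc (0 : ℝ) t ×ˢ Icc (0 : ℝ) (r + c * t) ×ˢ Icc (0 : ℝ) Real.pi) :=
    isCompact_Icc.prod (isCompact_Icc.prod isCompact_Icc)
  have cont : Continuous fun z : ℝ × ℝ × ℝ => z.2.1 * azInt b H z.1 z.2.1 z.2.2 := by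
    have := continuous_azInt b hH
    fun_prop
  obtain ⟨B, hB⟩ := hcomp.exists_bound_of_continuousOn cont.continuousOn
  have hm : Measurable fun z : ℝ × ℝ => z.2 * azInt b H z.1 z.2 (bipAng c t r z) := by
    refine cont.measurable.comp (g := fun z : ℝ × ℝ × ℝ => z.2.1 * azInt b H z.1 z.2.1 z.2.2)
      (f := fun z : ℝ × ℝ => (z.1, z.2, bipAng c t r z)) ?_
    have : Measurable (bipAng c t r) := by
      unfold bipAng
      exact Real.measurable_arccos.comp (by fun_prop)
    fun_prop
  have hfin : volume (bipDom c t r) < ⊤ :=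
    (measure_mono hsub).trans_lt (isCompact_Icc.prod isCompact_Icc).measure_lt_top
  unfold bipInt
  rw [integrable_indicator_iff (measurableSet_bipDom c t r)]
  refine Measure.integrableOn_of_bounded (M := B) hfin.ne hm.aestronglyMeasurable ?_
  refine (ae_restrict_iff' (measurableSet_bipDom c t r)).2 (ae_of_all _ ?_)
  rintro ⟨s, l⟩ h
  exact hB (s, l, bipAng c t r (s, l)) ⟨(hsub h).1, (hsub h).2, Real.arccos_nonneg _, Real.arccos_le_pi _⟩

lemma mul_kir_eq {c t r : ℝ} (hc : 0 < c) (ht : 0 < t) (hr : 0 < r) (b : Fin 3 → E3) {H : Fn}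
    (hH : Continuous (unc H)) :
    r * kir c b H t (r • b 0) = 1 / (4 * Real.pi * c) * ∫ z, bipInt c b H t r z := by
  have key : ∀ s ∈ Ioo 0 t, ∫ l, bipInt c b H t r (s, l) =
      ∫ l in Ioo |r - c * (t - s)| (r + c * (t - s)), l * ∫ φ in (0 : ℝ)..2 * Real.pi,
        H s (l • om b (Real.arccos ((l ^ 2 + r ^ 2 - (c * (t - s)) ^ 2) / (2 * r * l))) φ) := by
    intro s hs
    rw [← integral_indicator measurableSet_Ioo]
    congr 1
    ext l
    unfold bipInt azInt bipAng
    by_cases h : l ∈ Ioo |r - c * (t - s)| (r + c * (t - s))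
    · rw [indicator_of_mem h, indicator_of_mem (mem_bipDom_iff.2 ⟨hs.1, h⟩)]
    · rw [indicator_of_notMem h, indicator_of_notMem fun h' => h (mem_bipDom_iff.1 h').2]
  have e1 : ∫ z, bipInt c b H t r z = ∫ s in (0 : ℝ)..t, ∫ l, bipInt c b H t r (s, l) := by
    rw [Measure.volume_eq_prod, integral_prod _ (integrable_bipInt hc b hH t r),
      intervalIntegral.integral_of_le ht.le, integral_Ioc_eq_integral_Ioo, ← integral_indicator measurableSet_Ioo]
    congr 1
    ext s
    by_cases h : s ∈ Ioo 0 t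
    · rw [indicator_of_mem h]
    · rw [indicator_of_notMem h]
      rw [show (fun l => bipInt c b H t r (s, l)) = fun _ => 0 from funext fun l =>
        indicator_of_notMem (fun h' => h ⟨(mem_bipDom_iff.1 h').1, time_lt_of_mem_bipDom hc h'⟩) _]
      simp
  have e2 : ∫ s in (0 : ℝ)..t, ∫ l, bipInt c b H t r (s, l) =
      t * ∫ η in (0 : ℝ)..1, ∫ l, bipInt c b H t r (t - t * η, l) := by
    rw [intervalIntegral.integral_comp_sub_mul (fun s => ∫ l, bipInt c b H t r (s, l)) ht.ne']
    simp only [mul_one, sub_self, mul_zero, sub_zero, smul_eq_mul]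
    field_simp
  have e3 : ∫ η in (0 : ℝ)..1, ∫ l, bipInt c b H t r (t - t * η, l) =
      ∫ η in (0 : ℝ)..1, (r * c * t) * (η *
        sphInt fun ϑ φ => H (t * (1 - η)) (r • b 0 + (c * t * η) • om b ϑ φ)) := by
    rw [intervalIntegral.integral_of_le zero_le_one, intervalIntegral.integral_of_le zero_le_one,
      integral_Ioc_eq_integral_Ioo, integral_Ioc_eq_integral_Ioo]
    refine setIntegral_congr_fun measurableSet_Ioo fun η hη => ?_
    rw [key (t - t * η) ⟨by nlinarith [hη.2], by nlinarith [hη.1]⟩,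
      show c * (t - (t - t * η)) = c * t * η by ring, show t - t * η = t * (1 - η) by ring,
      ← sphInt_eq_bipolar hr (by have := hη.1; positivity) b (H (t * (1 - η)))]
    ring
  rw [e1, e2, e3, intervalIntegral.integral_const_mul]
  unfold kir
  generalize (∫ η in (0 : ℝ)..1, η *
    sphInt fun ϑ φ => H (t * (1 - η)) (r • b 0 + (c * t * η) • om b ϑ φ)) = I
  have := Real.pi_pos
  field_simp

end

section

open MeasureTheory Set Filter Topology

/-- The sum of `|G|` and of all `|Z_i G|`. -/
def zsum (G : Fn) : Fn := fun t x => |G t x| + ∑ i, |Zop i G t x|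

lemma zsum_eq (G : Fn) (t : ℝ) (x : E3) : zsum G t x = |G t x| + (|pt G t x| + |pd 0 G t x| +
    |pd 1 G t x| + |pd 2 G t x| + |rotA 0 1 G t x| + |rotA 0 2 G t x| + |rotA 1 2 G t x|) := by
  simp [zsum, Zop, Fin.sum_univ_succ]
  ring

lemma continuous_zsum {G : Fn} (hG : Smooth G) : Continuous (unc (zsum G)) := by
  have c0 := hG.continuous
  have ct := hG.pt.continuous
  have cd := fun j => (hG.pd j).continuous
  have cr : ∀ j k, Continuous (unc (rotA j k G)) := by
    intro j k
    have e : unc (rotA j k G) = fun p => p.2 j * unc (pd k G) p - p.2 k * unc (pd j G) p := rfl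
    rw [e]
    have := cd j
    have := cd k
    fun_prop
  have e : unc (zsum G) = fun p => |unc G p| + (|unc (pt G) p| + |unc (pd 0 G) p| +
    |unc (pd 1 G) p| + |unc (pd 2 G) p| + |unc (rotA 0 1 G) p| + |unc (rotA 0 2 G) p| +
    |unc (rotA 1 2 G) p|) := by
    ext p
    exact zsum_eq G p.1 p.2
  rw [e]
  have := cd 0
  have := cd 1
  have := cd 2
  have := cr 0 1
  have := cr 0 2
  have := cr 1 2
  fun_prop

lemma zsum_nonneg (G : Fn) (t : ℝ) (x : E3) : 0 ≤ zsum G t x := by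
  unfold zsum
  positivity

lemma abs_le_zsum (G : Fn) (t : ℝ) (x : E3) : |G t x| ≤ zsum G t x := by
  unfold zsum
  have : 0 ≤ ∑ i, |Zop i G t x| := by positivity
  linarith

lemma fderiv_eq_sum_pd (f : Fn) (t : ℝ) (x v : E3) :
    fderiv ℝ (f t) x v = v 0 * pd 0 f t x + v 1 * pd 1 f t x + v 2 * pd 2 f t x := by
  have h : v = v 0 • EuclideanSpace.single 0 1 + v 1 • EuclideanSpace.single 1 1 +
      v 2 • EuclideanSpace.single 2 1 := by
    ext i
    fin_cases i <;> simp
  conv_lhs => rw [h]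
  simp [pd]

lemma abs_apply_le (v : E3) (hv : ‖v‖ ≤ 1) (j : Fin 3) : |v j| ≤ 1 :=
  (PiLp.norm_apply_le v j).trans hv

lemma abs_fderiv_le_zsum (G : Fn) (t : ℝ) (x v : E3) (hv : ‖v‖ ≤ 1) :
    |pt G t x| + |fderiv ℝ (G t) x v| ≤ zsum G t x := by
  rw [fderiv_eq_sum_pd, zsum_eq]
  have h : ∀ j, |v j * pd j G t x| ≤ |pd j G t x| := fun j => by
    rw [abs_mul]
    exact mul_le_of_le_one_left (abs_nonneg _) (abs_apply_le v hv j)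
  have h3 := abs_add_three (v 0 * pd 0 G t x) (v 1 * pd 1 G t x) (v 2 * pd 2 G t x)
  have := h 0
  have := h 1
  have := h 2
  have := abs_nonneg (G t x)
  have := abs_nonneg (rotA 0 1 G t x)
  have := abs_nonneg (rotA 0 2 G t x)
  have := abs_nonneg (rotA 1 2 G t x)
  linarith

lemma inner_eq_sum (y a : E3) : inner ℝ y a = y 0 * a 0 + y 1 * a 1 + y 2 * a 2 := by
  simp [PiLp.inner_apply, Fin.sum_univ_succ]
  ring

/-- The rotation in the plane spanned by `a` and `b` applied to `G`. -/
lemma abs_fderiv_rot_le_zsum (G : Fn) (t : ℝ) (y a b : E3) (ha : ‖a‖ ≤ 1) (hb : ‖b‖ ≤ 1) :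
    |fderiv ℝ (G t) y (inner ℝ y a • b - inner ℝ y b • a)| ≤ 2 * zsum G t y := by
  have e : fderiv ℝ (G t) y (inner ℝ y a • b - inner ℝ y b • a) =
      (a 0 * b 1 - a 1 * b 0) * rotA 0 1 G t y + (a 0 * b 2 - a 2 * b 0) * rotA 0 2 G t y +
        (a 1 * b 2 - a 2 * b 1) * rotA 1 2 G t y := by
    rw [fderiv_eq_sum_pd, inner_eq_sum, inner_eq_sum]
    simp [rotA]
    ring
  have h : ∀ j k, |a j * b k - a k * b j| ≤ 2 := fun j k => by
    refine (abs_sub _ _).trans ?_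
    rw [abs_mul, abs_mul]
    have h1 := abs_apply_le a ha j
    have h2 := abs_apply_le a ha k
    have h3 := abs_apply_le b hb j
    have h4 := abs_apply_le b hb k
    nlinarith [abs_nonneg (a j), abs_nonneg (a k), abs_nonneg (b j), abs_nonneg (b k)]
  have h2 : ∀ j k, |(a j * b k - a k * b j) * rotA j k G t y| ≤ 2 * |rotA j k G t y| := fun j k => by
    rw [abs_mul]
    exact mul_le_mul_of_nonneg_right (h j k) (abs_nonneg _)
  rw [e, zsum_eq]
  refine (abs_add_three _ _ _).trans ?_
  have := h2 0 1
  have := h2 0 2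
  have := h2 1 2
  have := abs_nonneg (G t y)
  have := abs_nonneg (pt G t y)
  have := abs_nonneg (pd 0 G t y)
  have := abs_nonneg (pd 1 G t y)
  have := abs_nonneg (pd 2 G t y)
  linarith

lemma zsum_le_vnorm (G : Fn) (t : ℝ) (x : E3) : zsum G t x ≤ vnorm 1 G t x := by
  unfold zsum vnorm
  set f : Option (Fin 7) → (Fin 7 → ℕ) := fun o => o.elim 0 fun i => Pi.single i 1 with hf
  have hinj : Function.Injective f := by
    rintro (_ | i) (_ | j) h
    · rfl
    · have := congrFun h j
      simp [hf] at this
    · have := congrFun h i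
      simp [hf] at this
    · have := congrFun h i
      by_contra hne
      have hij : i ≠ j := fun h' => hne (by rw [h'])
      simp [hf, hij] at this
  have hsub : Finset.univ.image f ⊆ multiIdx 1 := by
    intro α hα
    obtain ⟨o, -, rfl⟩ := Finset.mem_image.1 hα
    unfold multiIdx
    rw [Finset.mem_filter, Fintype.mem_piFinset]
    rcases o with _ | i
    · simp [hf]
    · refine ⟨fun j => ?_, ?_⟩
      · by_cases hij : j = i
        · subst hij; simp [hf]
        · simp [hf, hij]
      · simp [hf]
  refine le_trans (le_of_eq ?_) (Finset.sum_le_sum_of_subset_of_nonneg hsub fun _ _ _ => abs_nonneg _)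
  rw [Finset.sum_image fun _ _ _ _ h => hinj h, Fintype.sum_option]
  refine congrArg₂ (· + ·) ?_ (Finset.sum_congr rfl fun i _ => ?_)
  · simp [hf, Zpow]
  · fin_cases i <;> simp [hf, Zpow]

lemma sphInt_mono {f g : ℝ → ℝ → ℝ} (hf : Continuous (Function.uncurry f))
    (hg : Continuous (Function.uncurry g)) (h : ∀ ϑ φ, f ϑ φ ≤ g ϑ φ) : sphInt f ≤ sphInt g := by
  have c1 : ∀ {h : ℝ → ℝ → ℝ}, Continuous (Function.uncurry h) →
      Continuous (Function.uncurry fun ϑ φ => Real.sin ϑ * h ϑ φ) := by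
    intro h hh
    unfold Function.uncurry at hh ⊢
    fun_prop
  have hpi := Real.pi_pos
  unfold sphInt
  refine intervalIntegral.integral_mono_on hpi.le
    ((intervalIntegral.continuous_parametric_intervalIntegral_of_continuous' (c1 hf) _ _).intervalIntegrable _ _)
    ((intervalIntegral.continuous_parametric_intervalIntegral_of_continuous' (c1 hg) _ _).intervalIntegrable _ _)
    fun ϑ hϑ => ?_
  refine intervalIntegral.integral_mono_on (by positivity)
    (((c1 hf).comp (Continuous.prodMk_right ϑ)).intervalIntegrable _ _)
    (((c1 hg).comp (Continuous.prodMk_right ϑ)).intervalIntegrable _ _) fun φ _ => ?_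
  exact mul_le_mul_of_nonneg_left (h ϑ φ) (Real.sin_nonneg_of_mem_Icc hϑ)

lemma abs_sphInt_le {f g : ℝ → ℝ → ℝ} (hf : Continuous (Function.uncurry f))
    (hg : Continuous (Function.uncurry g)) (h : ∀ ϑ φ, |f ϑ φ| ≤ g ϑ φ) : |sphInt f| ≤ sphInt g := by
  rw [abs_le]
  constructor
  · have := sphInt_mono (f := fun ϑ φ => (-1) * g ϑ φ) (g := f)
      (by unfold Function.uncurry at hg ⊢; fun_prop) hf
      fun ϑ φ => by linarith [(abs_le.1 (h ϑ φ)).1]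
    rw [sphInt_const_mul] at this
    linarith
  · exact sphInt_mono hf hg fun ϑ φ => (abs_le.1 (h ϑ φ)).2

/-- The points of the backward light cone. -/
lemma continuous_kirPt (c : ℝ) (b : Fin 3 → E3) (t : ℝ) (x : E3) :
    Continuous fun z : ℝ × ℝ × ℝ => ((t * (1 - z.1), x + (c * t * z.1) • om b z.2.1 z.2.2) : ℝ × E3) := by
  have com : Continuous fun z : ℝ × ℝ × ℝ => om b z.2.1 z.2.2 :=
    (continuous_om b).comp (f := fun z : ℝ × ℝ × ℝ => (z.2.1, z.2.2)) (by fun_prop)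
  fun_prop

lemma abs_le_mul_kir {c : ℝ} {b : Fin 3 → E3} {t : ℝ} {x : E3} {H : Fn} (hH : Continuous (unc H))
    {f : ℝ → ℝ → ℝ → ℝ} (hf : Continuous fun z : ℝ × ℝ × ℝ => f z.1 z.2.1 z.2.2) (K : ℝ)
    (h : ∀ η ∈ Icc (0 : ℝ) 1, ∀ ϑ φ, |f η ϑ φ| ≤
      K * H (t * (1 - η)) (x + (c * t * η) • om b ϑ φ)) :
    |t ^ 2 / (4 * Real.pi) * ∫ η in (0 : ℝ)..1, η * sphInt (f η)| ≤ K * kir c b H t x := by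
  have hpi := Real.pi_pos
  have cH : Continuous fun z : ℝ × ℝ × ℝ =>
      K * H (t * (1 - z.1)) (x + (c * t * z.1) • om b z.2.1 z.2.2) := by
    have e : (fun z : ℝ × ℝ × ℝ => K * H (t * (1 - z.1)) (x + (c * t * z.1) • om b z.2.1 z.2.2)) =
      fun z => K * unc H (t * (1 - z.1), x + (c * t * z.1) • om b z.2.1 z.2.2) := rfl
    rw [e]
    exact continuous_const.mul (hH.comp (continuous_kirPt c b t x))
  have cs := continuous_sphInt hf
  have cs2 := continuous_sphInt (f := fun η ϑ φ =>
    K * H (t * (1 - η)) (x + (c * t * η) • om b ϑ φ)) cH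
  have main : |∫ η in (0 : ℝ)..1, η * sphInt (f η)| ≤ ∫ η in (0 : ℝ)..1,
      η * sphInt fun ϑ φ => K * H (t * (1 - η)) (x + (c * t * η) • om b ϑ φ) := by
    refine (intervalIntegral.abs_integral_le_integral_abs zero_le_one).trans ?_
    refine intervalIntegral.integral_mono_on zero_le_one
      (Continuous.intervalIntegrable (by fun_prop) _ _)
      (Continuous.intervalIntegrable (by fun_prop) _ _) fun η hη => ?_
    rw [abs_mul, abs_of_nonneg hη.1]
    refine mul_le_mul_of_nonneg_left (abs_sphInt_le ?_ ?_ (h η hη)) hη.1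
    · exact hf.comp (Continuous.prodMk_right η)
    · exact cH.comp (Continuous.prodMk_right η)
  rw [abs_mul, abs_of_nonneg (by positivity)]
  refine (mul_le_mul_of_nonneg_left main (by positivity)).trans (le_of_eq ?_)
  unfold kir
  simp_rw [sphInt_const_mul, mul_left_comm _ K, intervalIntegral.integral_const_mul]
  ring

lemma hasDerivAt_kirInt {G : Fn} (hG : Smooth G) {P P' : ℝ → ℝ → ℝ → ℝ → ℝ × E3}
    (hP : Continuous fun z : ℝ × ℝ × ℝ × ℝ => P z.1 z.2.1 z.2.2.1 z.2.2.2)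
    (hP' : Continuous fun z : ℝ × ℝ × ℝ × ℝ => P' z.1 z.2.1 z.2.2.1 z.2.2.2)
    (h : ∀ ε η ϑ φ, HasDerivAt (fun ε => P ε η ϑ φ) (P' ε η ϑ φ) ε) (ε : ℝ) :
    HasDerivAt (fun ε => ∫ η in (0 : ℝ)..1, η * sphInt fun ϑ φ => unc G (P ε η ϑ φ))
      (∫ η in (0 : ℝ)..1, η * sphInt fun ϑ φ => fderiv ℝ (unc G) (P ε η ϑ φ) (P' ε η ϑ φ)) ε := by
  have cG := hG.continuous
  have cD := hG.contDiff_fderiv.continuous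
  have c1 : Continuous fun z : ℝ × ℝ × ℝ × ℝ => unc G (P z.1 z.2.1 z.2.2.1 z.2.2.2) := cG.comp hP
  have c2 : Continuous fun z : ℝ × ℝ × ℝ × ℝ => fderiv ℝ (unc G) (P z.1 z.2.1 z.2.2.1 z.2.2.2)
      (P' z.1 z.2.1 z.2.2.1 z.2.2.2) := (cD.comp hP).clm_apply hP'
  refine hasDerivAt_intervalIntegral_of_continuous
    (f := fun ε η => η * sphInt fun ϑ φ => unc G (P ε η ϑ φ))
    (f' := fun ε η => η * sphInt fun ϑ φ => fderiv ℝ (unc G) (P ε η ϑ φ) (P' ε η ϑ φ)) ?_ ?_ ?_ _ _ _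
  · refine continuous_snd.mul (continuous_sphInt (X := ℝ × ℝ)
      (f := fun z ϑ φ => unc G (P z.1 z.2 ϑ φ)) ?_)
    exact c1.comp (f := fun z : (ℝ × ℝ) × ℝ × ℝ => (z.1.1, z.1.2, z.2.1, z.2.2)) (by fun_prop)
  · refine continuous_snd.mul (continuous_sphInt (X := ℝ × ℝ)
      (f := fun z ϑ φ => fderiv ℝ (unc G) (P z.1 z.2 ϑ φ) (P' z.1 z.2 ϑ φ)) ?_)
    exact c2.comp (f := fun z : (ℝ × ℝ) × ℝ × ℝ => (z.1.1, z.1.2, z.2.1, z.2.2)) (by fun_prop)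
  · intro ε η
    refine HasDerivAt.const_mul η ?_
    refine hasDerivAt_sphInt (f := fun ε ϑ φ => unc G (P ε η ϑ φ))
      (f' := fun ε ϑ φ => fderiv ℝ (unc G) (P ε η ϑ φ) (P' ε η ϑ φ)) ?_ ?_ ?_ ε
    · exact c1.comp (f := fun z : ℝ × ℝ × ℝ => (z.1, η, z.2.1, z.2.2)) (by fun_prop)
    · exact c2.comp (f := fun z : ℝ × ℝ × ℝ => (z.1, η, z.2.1, z.2.2)) (by fun_prop)
    · intro ε ϑ φ
      exact (hG.hasFDerivAt (P ε η ϑ φ)).comp_hasDerivAt ε (h ε η ϑ φ)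

end

section

open MeasureTheory Set Filter Topology

section
variable {c : ℝ} {b : Fin 3 → E3} {G u : Fn}

lemma IsWaveSol.eq_kir (hc : 0 < c) (hb : Orthonormal ℝ b) (h : IsWaveSol c G u) {t : ℝ}
    (ht : 0 ≤ t) (x : E3) : u t x = kir c b G t x := by
  obtain ⟨hu, hbox, h0, h1⟩ := h
  rw [PaperKatayama.eq_kir hc hb hu h0 h1]
  rcases ht.eq_or_lt with rfl | ht
  · simp [kir]
  unfold kir
  congr 1
  rw [intervalIntegral.integral_of_le zero_le_one, intervalIntegral.integral_of_le zero_le_one,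
    integral_Ioc_eq_integral_Ioo, integral_Ioc_eq_integral_Ioo]
  refine setIntegral_congr_fun measurableSet_Ioo fun η hη => ?_
  have hs : 0 < t * (1 - η) := mul_pos ht (by linarith [hη.2])
  have : box c u (t * (1 - η)) = G (t * (1 - η)) := funext fun y => hbox _ y hs
  simp only [this]

lemma abs_sol_le (hc : 0 < c) (hb : Orthonormal ℝ b) (hG : Smooth G) (h : IsWaveSol c G u) {t : ℝ}
    (ht : 0 ≤ t) (x : E3) : |u t x| ≤ kir c b (zsum G) t x := by
  rw [h.eq_kir hc hb ht x, ← one_mul (kir c b (zsum G) t x)]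
  refine abs_le_mul_kir (continuous_zsum hG) (hG.continuous.comp (continuous_kirPt c b t x)) 1
    fun η _ ϑ φ => ?_
  rw [one_mul]
  exact abs_le_zsum _ _ _

lemma fderiv_unc_apply (hG : Smooth G) (p : ℝ × E3) (a : ℝ) (v : E3) :
    fderiv ℝ (unc G) p (a, v) = a * pt G p.1 p.2 + fderiv ℝ (G p.1) p.2 v := by
  rw [hG.pt_eq, hG.fderiv_space, ← smul_eq_mul, ← map_smul, ← map_add]
  simp

lemma abs_fderiv_sol_le (hc : 0 < c) (hb : Orthonormal ℝ b) (hG : Smooth G)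
    (h : IsWaveSol c G u) {t : ℝ} (ht : 0 ≤ t) (x v : E3) (hv : ‖v‖ ≤ 1) :
    |fderiv ℝ (u t) x v| ≤ kir c b (zsum G) t x := by
  have com : Continuous fun z : ℝ × ℝ × ℝ × ℝ => om b z.2.2.1 z.2.2.2 :=
    (continuous_om b).comp (f := fun z : ℝ × ℝ × ℝ × ℝ => z.2.2) (by fun_prop)
  have d := hasDerivAt_kirInt hG
    (P := fun ε η ϑ φ => (t * (1 - η), x + ε • v + (c * t * η) • om b ϑ φ))
    (P' := fun _ _ _ _ => (0, v)) (by fun_prop) (by fun_prop) (fun ε η ϑ φ => by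
      refine (hasDerivAt_const _ _).prodMk ?_
      have := (((hasDerivAt_id ε).smul_const v).const_add x).add_const ((c * t * η) • om b ϑ φ)
      simpa using this) 0
  have d1 : HasDerivAt (fun ε : ℝ => u t (x + ε • v)) (fderiv ℝ (u t) x v) 0 := by
    have hd : HasDerivAt (fun ε : ℝ => x + ε • v) v 0 := by
      simpa using ((hasDerivAt_id (0 : ℝ)).smul_const v).const_add x
    have h2 : HasFDerivAt (u t) (fderiv ℝ (u t) x) (x + (0 : ℝ) • v) := by
      rw [zero_smul, add_zero]
      exact (h.1.hasFDerivAt_space t x).differentiableAt.hasFDerivAt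
    exact h2.comp_hasDerivAt 0 hd
  have e : (fun ε : ℝ => u t (x + ε • v)) = fun ε => t ^ 2 / (4 * Real.pi) *
      ∫ η in (0 : ℝ)..1, η * sphInt fun ϑ φ =>
        unc G (t * (1 - η), x + ε • v + (c * t * η) • om b ϑ φ) := by
    ext ε
    rw [h.eq_kir hc hb ht]
    rfl
  rw [e] at d1
  rw [d1.unique (d.const_mul _), ← one_mul (kir c b (zsum G) t x)]
  have cD := hG.contDiff_fderiv.continuous
  refine abs_le_mul_kir (continuous_zsum hG) ((cD.comp ?_).clm_apply continuous_const) 1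
    fun η _ ϑ φ => ?_
  · have := continuous_kirPt c b t x
    simpa using this
  · rw [fderiv_unc_apply hG]
    simp only [zero_mul, zero_add, zero_smul, add_zero, one_mul]
    refine le_trans ?_ (abs_fderiv_le_zsum G _ _ v hv)
    exact le_add_of_nonneg_left (abs_nonneg _)

lemma norm_om (hb : Orthonormal ℝ b) (ϑ φ : ℝ) : ‖om b ϑ φ‖ = 1 := by
  have h := orthonormal_iff_ite.1 hb
  rw [← sq_eq_sq₀ (norm_nonneg _) zero_le_one, ← real_inner_self_eq_norm_sq]
  unfold om
  simp only [inner_add_left, inner_add_right, real_inner_smul_left, real_inner_smul_right, h]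
  simp
  linear_combination Real.sin_sq_add_cos_sq ϑ + Real.sin ϑ ^ 2 * Real.sin_sq_add_cos_sq φ

lemma abs_pt_sol_le (hc : 0 < c) (hb : Orthonormal ℝ b) (hG : Smooth G)
    (h : IsWaveSol c G u) {t : ℝ} (ht : 0 < t) (x : E3) :
    |pt u t x| ≤ 2 / t * |u t x| + (1 + c) * kir c b (zsum G) t x := by
  have com : Continuous fun z : ℝ × ℝ × ℝ × ℝ => om b z.2.2.1 z.2.2.2 :=
    (continuous_om b).comp (f := fun z : ℝ × ℝ × ℝ × ℝ => z.2.2) (by fun_prop)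
  have d := hasDerivAt_kirInt hG
    (P := fun ε η ϑ φ => (ε * (1 - η), x + (c * ε * η) • om b ϑ φ))
    (P' := fun _ η ϑ φ => (1 - η, (c * η) • om b ϑ φ)) (by fun_prop) (by fun_prop)
    (fun ε η ϑ φ => by
      refine HasDerivAt.prodMk ?_ ?_
      · simpa using (hasDerivAt_id ε).mul_const (1 - η)
      · have := ((((hasDerivAt_id ε).const_mul c).mul_const η).smul_const (om b ϑ φ)).const_add x
        simpa using this) t
  have d1 : HasDerivAt (fun s => u s x) (pt u t x) t := by
    have hd : HasDerivAt (fun s : ℝ => ((s, x) : ℝ × E3)) (1, 0) t :=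
      (hasDerivAt_id t).prodMk (hasDerivAt_const t x)
    rw [h.1.pt_eq]
    exact (h.1.hasFDerivAt (t, x)).comp_hasDerivAt t hd
  have e : (fun s => u s x) =ᶠ[𝓝 t] fun s => s ^ 2 / (4 * Real.pi) *
      ∫ η in (0 : ℝ)..1, η * sphInt fun ϑ φ =>
        unc G (s * (1 - η), x + (c * s * η) • om b ϑ φ) := by
    filter_upwards [lt_mem_nhds ht] with s hs
    rw [h.eq_kir hc hb hs.le]
    rfl
  have hut := e.eq_of_nhds
  have d2 : HasDerivAt (fun s : ℝ => s ^ 2 / (4 * Real.pi)) (2 * t / (4 * Real.pi)) t := by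
    simpa using (hasDerivAt_pow 2 t).div_const (4 * Real.pi)
  have d3 := d1.unique ((d2.mul d).congr_of_eventuallyEq e)
  have e4 : 2 * t / (4 * Real.pi) * (∫ η in (0 : ℝ)..1, η * sphInt fun ϑ φ =>
        unc G (t * (1 - η), x + (c * t * η) • om b ϑ φ)) = 2 / t * u t x := by
    rw [hut]
    generalize (∫ η in (0 : ℝ)..1, η * sphInt fun ϑ φ =>
        unc G (t * (1 - η), x + (c * t * η) • om b ϑ φ)) = I
    have := Real.pi_pos
    field_simp
  rw [d3, e4]
  refine (abs_add_le _ _).trans ?_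
  rw [abs_mul, abs_of_pos (show 0 < 2 / t by positivity)]
  refine add_le_add_right ?_ _
  have cD := hG.contDiff_fderiv.continuous
  have com' : Continuous fun z : ℝ × ℝ × ℝ => om b z.2.1 z.2.2 :=
    (continuous_om b).comp (f := fun z : ℝ × ℝ × ℝ => z.2) (by fun_prop)
  refine abs_le_mul_kir (continuous_zsum hG)
    ((cD.comp (continuous_kirPt c b t x)).clm_apply (by fun_prop)) (1 + c) fun η hη ϑ φ => ?_
  rw [fderiv_unc_apply hG, map_smul, smul_eq_mul]
  refine (abs_add_le _ _).trans ?_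
  rw [abs_mul, abs_mul, abs_of_nonneg (show 0 ≤ 1 - η by linarith [hη.2]),
    abs_of_nonneg (mul_nonneg hc.le hη.1)]
  have hz := abs_fderiv_le_zsum G (t * (1 - η)) (x + (c * t * η) • om b ϑ φ) (om b ϑ φ)
    (norm_om hb ϑ φ).le
  have p1 := abs_nonneg (pt G (t * (1 - η)) (x + (c * t * η) • om b ϑ φ))
  have p2 := abs_nonneg (fderiv ℝ (G (t * (1 - η))) (x + (c * t * η) • om b ϑ φ) (om b ϑ φ))
  generalize |pt G (t * (1 - η)) (x + (c * t * η) • om b ϑ φ)| = X at *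
  generalize |fderiv ℝ (G (t * (1 - η))) (x + (c * t * η) • om b ϑ φ) (om b ϑ φ)| = Y at *
  generalize zsum G (t * (1 - η)) (x + (c * t * η) • om b ϑ φ) = Z at *
  have q1 : (1 - η) * X ≤ X := mul_le_of_le_one_left p1 (by linarith [hη.1])
  have q2 : c * η * Y ≤ c * Y := by
    have : η * Y ≤ Y := mul_le_of_le_one_left p2 hη.2
    nlinarith
  nlinarith

/-- Rotation of the first two vectors of a frame. -/
def rotFrame (b : Fin 3 → E3) (ε : ℝ) : Fin 3 → E3 :=
  ![Real.cos ε • b 0 + Real.sin ε • b 1, -Real.sin ε • b 0 + Real.cos ε • b 1, b 2]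

/-- The derivative of `rotFrame`. -/
def rotFrame' (b : Fin 3 → E3) (ε : ℝ) : Fin 3 → E3 :=
  ![-Real.sin ε • b 0 + Real.cos ε • b 1, -Real.cos ε • b 0 + -Real.sin ε • b 1, 0]

lemma orthonormal_rotFrame (hb : Orthonormal ℝ b) (ε : ℝ) : Orthonormal ℝ (rotFrame b ε) := by
  have h := orthonormal_iff_ite.1 hb
  have hcs := Real.sin_sq_add_cos_sq ε
  rw [orthonormal_iff_ite]
  intro i j
  fin_cases i <;> fin_cases j <;>
    simp only [rotFrame, Fin.zero_eta, Fin.mk_one, Fin.reduceFinMk, Matrix.cons_val,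
      inner_add_left, inner_add_right, real_inner_smul_left, real_inner_smul_right, h] <;>
    simp <;>
    first
    | linear_combination hcs
    | ring

lemma hasDerivAt_om_rotFrame (b : Fin 3 → E3) (ε ϑ φ : ℝ) :
    HasDerivAt (fun ε => om (rotFrame b ε) ϑ φ) (om (rotFrame' b ε) ϑ φ) ε := by
  have hs := Real.hasDerivAt_sin ε
  have hc := Real.hasDerivAt_cos ε
  have d0 : HasDerivAt (fun ε => rotFrame b ε 0) (rotFrame' b ε 0) ε :=
    (hc.smul_const _).add (hs.smul_const _)
  have d1 : HasDerivAt (fun ε => rotFrame b ε 1) (rotFrame' b ε 1) ε :=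
    (hs.neg.smul_const _).add (hc.smul_const _)
  have d2 : HasDerivAt (fun ε => rotFrame b ε 2) (rotFrame' b ε 2) ε := hasDerivAt_const ε (b 2)
  exact (d0.const_smul (Real.cos ϑ)).add (((d1.const_smul (Real.cos φ)).add
    (d2.const_smul (Real.sin φ))).const_smul (Real.sin ϑ))

lemma hasDerivAt_rotFrame_zero (b : Fin 3 → E3) (ε : ℝ) :
    HasDerivAt (fun ε => rotFrame b ε 0) (rotFrame' b ε 0) ε :=
  ((Real.hasDerivAt_cos ε).smul_const _).add ((Real.hasDerivAt_sin ε).smul_const _)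

lemma rotFrame_zero (b : Fin 3 → E3) : rotFrame b 0 = b := by
  ext i : 1
  fin_cases i <;> simp [rotFrame]

lemma abs_rot_sol_le (hc : 0 < c) (hb : Orthonormal ℝ b) (hG : Smooth G)
    (h : IsWaveSol c G u) {t : ℝ} (ht : 0 ≤ t) {r : ℝ} (hr : 0 ≤ r) :
    r * |fderiv ℝ (u t) (r • b 0) (b 1)| ≤ 2 * kir c b (zsum G) t (r • b 0) := by
  have cr : ∀ i, Continuous fun ε => rotFrame b ε i := by
    intro i
    fin_cases i <;> simp [rotFrame] <;> fun_prop
  have cr' : ∀ i, Continuous fun ε => rotFrame' b ε i := by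
    intro i
    fin_cases i <;> simp [rotFrame'] <;> fun_prop
  have r0 := cr 0
  have r1 := cr 1
  have r2 := cr 2
  have s0 := cr' 0
  have s1 := cr' 1
  have s2 := cr' 2
  have d := hasDerivAt_kirInt hG
    (P := fun ε η ϑ φ => (t * (1 - η), r • rotFrame b ε 0 + (c * t * η) • om (rotFrame b ε) ϑ φ))
    (P' := fun ε η ϑ φ => (0, r • rotFrame' b ε 0 + (c * t * η) • om (rotFrame' b ε) ϑ φ))
    (by unfold om; fun_prop) (by unfold om; fun_prop) (fun ε η ϑ φ =>
      (hasDerivAt_const _ _).prodMk (((hasDerivAt_rotFrame_zero b ε).const_smul r).add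
        ((hasDerivAt_om_rotFrame b ε ϑ φ).const_smul (c * t * η)))) 0
  have d1 : HasDerivAt (fun ε : ℝ => u t (r • rotFrame b ε 0))
      (fderiv ℝ (u t) (r • b 0) (r • b 1)) 0 := by
    have hd : HasDerivAt (fun ε : ℝ => r • rotFrame b ε 0) (r • b 1) 0 := by
      refine ((hasDerivAt_rotFrame_zero b 0).const_smul r).congr_deriv ?_
      simp [rotFrame']
    have h2 : HasFDerivAt (u t) (fderiv ℝ (u t) (r • b 0)) (r • rotFrame b 0 0) := by
      rw [rotFrame_zero]
      exact (h.1.hasFDerivAt_space t _).differentiableAt.hasFDerivAt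
    exact h2.comp_hasDerivAt 0 hd
  have e : (fun ε : ℝ => u t (r • rotFrame b ε 0)) = fun ε => t ^ 2 / (4 * Real.pi) *
      ∫ η in (0 : ℝ)..1, η * sphInt fun ϑ φ =>
        unc G (t * (1 - η), r • rotFrame b ε 0 + (c * t * η) • om (rotFrame b ε) ϑ φ) := by
    ext ε
    rw [h.eq_kir hc (orthonormal_rotFrame hb ε) ht]
    rfl
  rw [e] at d1
  have d3 := d1.unique (d.const_mul _)
  rw [map_smul, smul_eq_mul] at d3
  rw [← abs_of_nonneg hr, ← abs_mul, abs_of_nonneg hr, d3]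
  have cD := hG.contDiff_fderiv.continuous
  have com : Continuous fun z : ℝ × ℝ × ℝ => om (rotFrame' b 0) z.2.1 z.2.2 :=
    (continuous_om _).comp (f := fun z : ℝ × ℝ × ℝ => z.2) (by fun_prop)
  refine abs_le_mul_kir (continuous_zsum hG) ((cD.comp ?_).clm_apply ?_) 2 fun η _ ϑ φ => ?_
  · rw [rotFrame_zero]
    exact continuous_kirPt c b t _
  · fun_prop
  · rw [fderiv_unc_apply hG, zero_mul, zero_add, rotFrame_zero]
    set y := r • b 0 + (c * t * η) • om b ϑ φ with hy
    have hh := orthonormal_iff_ite.1 hb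
    have ey : r • rotFrame' b 0 0 + (c * t * η) • om (rotFrame' b 0) ϑ φ =
        inner ℝ y (b 0) • b 1 - inner ℝ y (b 1) • b 0 := by
      have i0 : inner ℝ y (b 0) = r + c * t * η * Real.cos ϑ := by
        simp only [hy, om, inner_add_left, real_inner_smul_left, hh]
        simp
      have i1 : inner ℝ y (b 1) = c * t * η * (Real.sin ϑ * Real.cos φ) := by
        simp only [hy, om, inner_add_left, real_inner_smul_left, hh]
        simp
      rw [i0, i1]
      simp [rotFrame', om]
      module
    simp only
    rw [ey]
    exact abs_fderiv_rot_le_zsum G _ y (b 0) (b 1) (hb.norm_eq_one 0).le (hb.norm_eq_one 1).le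

end

end

section

open MeasureTheory Set Filter Topology

lemma lintegral_comp_null {c : ℝ} (hc : 0 < c) {h : ℝ → ℝ → ENNReal}
    (hh : Measurable (Function.uncurry h)) :
    ∫⁻ z : ℝ × ℝ, h (c * z.1 + z.2) (c * z.1 - z.2) =
      ENNReal.ofReal (1 / (2 * c)) * ∫⁻ α, ∫⁻ β, h α β := by
  have m : ∀ {X : Type} [MeasurableSpace X] {f g : X → ℝ}, Measurable f → Measurable g →
      Measurable fun x => h (f x) (g x) := fun hf hg => hh.comp (hf.prodMk hg)
  rw [Measure.volume_eq_prod, lintegral_prod _ (m (by fun_prop) (by fun_prop)).aemeasurable]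
  have e1 : ∀ s : ℝ, ∫⁻ l, h (c * s + l) (c * s - l) = ∫⁻ β, h (2 * c * s - β) β := by
    intro s
    rw [← lintegral_sub_left_eq_self (fun β => h (2 * c * s - β) β) (c * s)]
    refine lintegral_congr fun l => ?_
    congr 1
    ring
  simp_rw [e1]
  have sw1 : ∫⁻ s, ∫⁻ β, h (2 * c * s - β) β = ∫⁻ β, ∫⁻ s, h (2 * c * s - β) β :=
    lintegral_lintegral_swap (m (by fun_prop) (by fun_prop)).aemeasurable
  have sw2 : ∫⁻ α, ∫⁻ β, h α β = ∫⁻ β, ∫⁻ α, h α β :=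
    lintegral_lintegral_swap hh.aemeasurable
  rw [sw1, sw2, ← lintegral_const_mul' _ _ ENNReal.ofReal_ne_top]
  refine lintegral_congr fun β => ?_
  have e2 : ∫⁻ s, h (2 * c * s - β) β = ∫⁻ s, (fun x => h (x - β) β) (2 * c * s) := rfl
  have hc2 : 2 * c ≠ 0 := by positivity
  rw [e2, ← lintegral_sub_right_eq_self (fun α => h α β) β]
  have e3 := (Homeomorph.mulLeft₀ (2 * c) hc2).measurableEmbedding.lintegral_map (μ := volume)
    (fun x => h (x - β) β)
  simp only [Homeomorph.coe_mulLeft₀] at e3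
  rw [← e3, Real.map_volume_mul_left hc2, lintegral_smul_measure, smul_eq_mul,
    abs_of_pos (by positivity), one_div]

/-- The domain of integration in null coordinates. -/
def nullDom (T S : ℝ) : Set (ℝ × ℝ) := {p | T < p.1 ∧ p.1 < S ∧ p.2 < T ∧ 0 < p.1 + p.2}

/-- The polar angle in null coordinates. -/
def nullAng (T S α β : ℝ) : ℝ :=
  Real.arccos (1 - 2 * ((T - β) * (S - α)) / ((S - T) * (α - β)))

lemma measurableSet_nullDom (T S : ℝ) : MeasurableSet (nullDom T S) := by
  have m : ∀ {f g : ℝ × ℝ → ℝ}, Measurable f → Measurable g → MeasurableSet {z | f z < g z} :=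
    measurableSet_lt
  exact (m (by fun_prop) (by fun_prop)).inter ((m (by fun_prop) (by fun_prop)).inter
    ((m (by fun_prop) (by fun_prop)).inter (m (by fun_prop) (by fun_prop))))

lemma measurable_nullAng (T S : ℝ) : Measurable fun p : ℝ × ℝ => nullAng T S p.1 p.2 := by
  unfold nullAng
  exact Real.measurable_arccos.comp (by fun_prop)

lemma mem_nullDom_iff {c t r s l : ℝ} (hc : 0 < c) :
    (c * s + l, c * s - l) ∈ nullDom (c * t - r) (c * t + r) ↔ (s, l) ∈ bipDom c t r := by
  simp only [nullDom, bipDom, mem_ofPred_eq]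
  have : 0 < c * s + l + (c * s - l) ↔ 0 < s := by
    rw [show c * s + l + (c * s - l) = 2 * c * s by ring]
    exact mul_pos_iff_of_pos_left (by positivity)
  rw [this]

lemma bipAng_eq {c t r s l : ℝ} (hr : 0 < r) (hl : 0 < l) :
    bipAng c t r (s, l) = nullAng (c * t - r) (c * t + r) (c * s + l) (c * s - l) := by
  unfold bipAng nullAng
  congr 1
  rw [show c * t + r - (c * t - r) = 2 * r by ring, show c * s + l - (c * s - l) = 2 * l by ring]
  field_simp
  ring

lemma cos_bipAng {c t r s l : ℝ} (hc : 0 < c) (hr : 0 < r) (h : (s, l) ∈ bipDom c t r) :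
    Real.cos (bipAng c t r (s, l)) = (l ^ 2 + r ^ 2 - (c * (t - s)) ^ 2) / (2 * r * l) := by
  have hl := pos_of_mem_bipDom h
  have hs := time_lt_of_mem_bipDom hc h
  have hρ : 0 < c * (t - s) := mul_pos hc (by linarith)
  obtain ⟨-, h1, h2⟩ := mem_bipDom_iff.1 h
  set ρ := c * (t - s)
  obtain ⟨h1, h3⟩ := abs_lt.1 h1
  refine Real.cos_arccos ?_ ?_
  · rw [le_div_iff₀ (by positivity)]
    nlinarith [mul_pos (show 0 < r + l - ρ by linarith) (show 0 < r + l + ρ by linarith)]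
  · rw [div_le_iff₀ (by positivity)]
    nlinarith [mul_pos (show 0 < ρ - r + l by linarith) (show 0 < ρ + r - l by linarith)]

lemma norm_smul_om_sub {b : Fin 3 → E3} (hb : Orthonormal ℝ b) (l r θ φ : ℝ) :
    ‖l • om b θ φ - r • b 0‖ ^ 2 = l ^ 2 + r ^ 2 - 2 * l * r * Real.cos θ := by
  have h := orthonormal_iff_ite.1 hb
  rw [← real_inner_self_eq_norm_sq]
  unfold om
  simp only [inner_add_left, inner_add_right, inner_sub_left, inner_sub_right,
    real_inner_smul_left, real_inner_smul_right, h]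
  simp
  linear_combination l ^ 2 * Real.sin_sq_add_cos_sq θ +
    l ^ 2 * Real.sin θ ^ 2 * Real.sin_sq_add_cos_sq φ

/-- Points over the spherical cap lie in the backward cone. -/
lemma norm_smul_om_sub_le {b : Fin 3 → E3} (hb : Orthonormal ℝ b) {c t r s l θ : ℝ} (hc : 0 < c)
    (hr : 0 < r) (h : (s, l) ∈ bipDom c t r) (h0 : 0 ≤ θ) (hθ : θ ≤ bipAng c t r (s, l)) (φ : ℝ) :
    ‖l • om b θ φ - r • b 0‖ ≤ c * (t - s) := by
  have hl := pos_of_mem_bipDom h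
  have hs := time_lt_of_mem_bipDom hc h
  have hρ : 0 < c * (t - s) := mul_pos hc (by linarith)
  refine le_of_sq_le_sq ?_ hρ.le
  rw [norm_smul_om_sub hb]
  have hcos : Real.cos (bipAng c t r (s, l)) ≤ Real.cos θ :=
    Real.cos_le_cos_of_nonneg_of_le_pi h0 (Real.arccos_le_pi _) hθ
  rw [cos_bipAng hc hr h, div_le_iff₀ (by positivity)] at hcos
  nlinarith

lemma norm_smul_om {b : Fin 3 → E3} (hb : Orthonormal ℝ b) {l : ℝ} (hl : 0 < l) (θ φ : ℝ) :
    ‖l • om b θ φ‖ = l := by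
  have := norm_smul_om_sub hb l 0 θ φ
  simp only [zero_smul, sub_zero] at this
  exact (pow_left_inj₀ (norm_nonneg _) hl.le two_ne_zero).1 (by linarith)

lemma abs_azInt_le {b : Fin 3 → E3} {H : Fn} {s l θ B : ℝ}
    (h : ∀ φ, |H s (l • om b θ φ)| ≤ B) : |azInt b H s l θ| ≤ 2 * Real.pi * B := by
  have hpi := Real.pi_pos
  have := intervalIntegral.norm_integral_le_of_norm_le_const (a := 0) (b := 2 * Real.pi)
    (f := fun φ => H s (l • om b θ φ)) (C := B) fun φ _ => h φ
  unfold azInt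
  rw [sub_zero, abs_of_pos (by positivity)] at this
  rw [← Real.norm_eq_abs]
  linarith

end

section

open MeasureTheory Set Filter Topology

lemma abs_azInt_sub_le {b : Fin 3 → E3} (hb : Orthonormal ℝ b) {G : Fn} (hG : Smooth G)
    {s l θ θ' B : ℝ} (h : ∀ η ∈ uIcc θ θ', ∀ φ, zsum G s (l • om b η φ) ≤ B) :
    |azInt b G s l θ - azInt b G s l θ'| ≤ 2 * Real.pi * (2 * B * |θ - θ'|) := by
  have hpi := Real.pi_pos
  have ho := orthonormal_iff_ite.1 hb
  have com : ∀ η, Continuous fun φ => G s (l • om b η φ) := fun η => by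
    have := (continuous_om b).comp (f := fun φ : ℝ => (η, φ)) (by fun_prop)
    exact hG.continuous.comp (f := fun φ => ((s, l • om b η φ) : ℝ × E3)) (by fun_prop)
  unfold azInt
  rw [← intervalIntegral.integral_sub ((com θ).intervalIntegrable _ _)
    ((com θ').intervalIntegrable _ _)]
  have := intervalIntegral.norm_integral_le_of_norm_le_const (a := 0) (b := 2 * Real.pi)
    (f := fun φ => G s (l • om b θ φ) - G s (l • om b θ' φ)) (C := 2 * B * |θ - θ'|) fun φ _ => ?_
  · rw [sub_zero, abs_of_pos (by positivity : 0 < 2 * Real.pi)] at this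
    rw [← Real.norm_eq_abs]
    linarith
  set n : E3 := Real.cos φ • b 1 + Real.sin φ • b 2 with hn
  have nn : ‖n‖ ≤ 1 := by
    have : ‖n‖ ^ 2 = 1 := by
      rw [← real_inner_self_eq_norm_sq, hn]
      simp only [inner_add_left, inner_add_right, real_inner_smul_left, real_inner_smul_right, ho]
      simp
      linear_combination Real.sin_sq_add_cos_sq φ
    nlinarith [norm_nonneg n]
  have d : ∀ η, HasDerivAt (fun η => G s (l • om b η φ))
      (fderiv ℝ (G s) (l • om b η φ) (l • omPolar b η φ)) η := fun η =>
    ((hG.hasFDerivAt_space s (l • om b η φ)).differentiableAt.hasFDerivAt).comp_hasDerivAt η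
      ((hasDerivAt_om_polar b η φ).const_smul l)
  refine Convex.norm_image_sub_le_of_norm_hasDerivWithin_le (𝕜 := ℝ) (s := uIcc θ θ')
    (f := fun η => G s (l • om b η φ)) (fun η _ => (d η).hasDerivWithinAt) (fun η hη => ?_)
    (convex_uIcc _ _) right_mem_uIcc left_mem_uIcc
  have e : l • omPolar b η φ =
      inner ℝ (l • om b η φ) (b 0) • n - inner ℝ (l • om b η φ) n • b 0 := by
    have e1 : inner ℝ (l • om b η φ) (b 0) = l * Real.cos η := by
      unfold om
      simp only [inner_add_left, real_inner_smul_left, ho]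
      simp
    have e2 : inner ℝ (l • om b η φ) n = l * Real.sin η := by
      unfold om
      rw [hn]
      simp only [inner_add_left, inner_add_right, real_inner_smul_left, real_inner_smul_right, ho]
      simp
      linear_combination l * Real.sin η * Real.sin_sq_add_cos_sq φ
    rw [e1, e2, omPolar, ← hn]
    module
  rw [e, Real.norm_eq_abs]
  exact (abs_fderiv_rot_le_zsum _ _ _ _ _ (hb.1 0).le nn).trans (by linarith [h η hη φ])

/-- On the backward cone of `(t, x)`, the source is controlled by `g` in null coordinates. -/
def Dominated (c t : ℝ) (x : E3) (G : Fn) (g : ℝ → ℝ → ℝ) : Prop :=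
  ∀ s y, 0 < s → s ≤ t → ‖y - x‖ ≤ c * (t - s) →
    ‖y‖ * zsum G s y ≤ g (c * s + ‖y‖) (c * s - ‖y‖)

variable {c t r t' r' : ℝ} {b : Fin 3 → E3} {G : Fn} {g : ℝ → ℝ → ℝ}

lemma Dominated.mul_zsum_le (h : Dominated c t (r • b 0) G g) (hb : Orthonormal ℝ b) (hc : 0 < c)
    (hr : 0 < r) {s l θ : ℝ} (hz : (s, l) ∈ bipDom c t r) (h0 : 0 ≤ θ)
    (hθ : θ ≤ bipAng c t r (s, l)) (φ : ℝ) :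
    l * zsum G s (l • om b θ φ) ≤ g (c * s + l) (c * s - l) := by
  have := h s (l • om b θ φ) hz.2.2.2 (time_lt_of_mem_bipDom hc hz).le
    (norm_smul_om_sub_le hb hc hr hz h0 hθ φ)
  rwa [norm_smul_om hb (pos_of_mem_bipDom hz)] at this

lemma Dominated.mono (h : Dominated c t (r • b 0) G g) (hb : Orthonormal ℝ b)
    (ht : t' ≤ t) (hd : |r - r'| ≤ c * (t - t')) : Dominated c t' (r' • b 0) G g := by
  intro s y hs hst hy
  refine h s y hs (hst.trans ht) ?_
  have e : y - r • b 0 = (y - r' • b 0) + (r' - r) • b 0 := by module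
  rw [e]
  refine (norm_add_le _ _).trans ?_
  rw [norm_smul, hb.1 0, mul_one, Real.norm_eq_abs, abs_sub_comm]
  linarith

lemma Dominated.abs_bipInt_le {H : Fn} (h : Dominated c t (r • b 0) G g) (hb : Orthonormal ℝ b)
    (hc : 0 < c) (hr : 0 < r) (hH : ∀ s y, |H s y| ≤ zsum G s y) {z : ℝ × ℝ}
    (hz : z ∈ bipDom c t r) :
    |bipInt c b H t r z| ≤ 2 * Real.pi * g (c * z.1 + z.2) (c * z.1 - z.2) := by
  obtain ⟨s, l⟩ := z
  have hl := pos_of_mem_bipDom hz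
  unfold bipInt
  rw [indicator_of_mem hz, abs_mul, abs_of_pos hl]
  have := abs_azInt_le (b := b) (H := H) (s := s) (l := l) (θ := bipAng c t r (s, l))
    (B := g (c * s + l) (c * s - l) / l) fun φ => by
      rw [le_div_iff₀' hl]
      exact (mul_le_mul_of_nonneg_left (hH _ _) hl.le).trans
        (h.mul_zsum_le hb hc hr hz (Real.arccos_nonneg _) le_rfl φ)
  calc l * |azInt b H s l (bipAng c t r (s, l))|
      ≤ l * (2 * Real.pi * (g (c * s + l) (c * s - l) / l)) := by gcongr
    _ = _ := by
      simp only
      field_simp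

lemma Dominated.nonneg (h : Dominated c t (r • b 0) G g) (hb : Orthonormal ℝ b)
    (hc : 0 < c) (hr : 0 < r) {z : ℝ × ℝ} (hz : z ∈ bipDom c t r) :
    0 ≤ g (c * z.1 + z.2) (c * z.1 - z.2) := by
  have := (abs_nonneg _).trans (h.abs_bipInt_le (H := G) hb hc hr (abs_le_zsum G) hz)
  have hpi := Real.pi_pos
  by_contra! hn
  nlinarith

theorem Dominated.mul_kir_le (h : Dominated c t (r • b 0) G g) (hb : Orthonormal ℝ b)
    (hG : Smooth G) (hc : 0 < c) (ht : 0 < t) (hr : 0 < r)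
    (hg : Measurable (Function.uncurry g)) :
    ENNReal.ofReal (r * kir c b (zsum G) t (r • b 0)) ≤ ENNReal.ofReal (1 / (4 * c ^ 2)) *
      ∫⁻ α, ∫⁻ β, (nullDom (c * t - r) (c * t + r)).indicator
        (fun p => ENNReal.ofReal (g p.1 p.2)) (α, β) := by
  have hpi := Real.pi_pos
  have hm : Measurable fun p : ℝ × ℝ => (nullDom (c * t - r) (c * t + r)).indicator
      (fun p => ENNReal.ofReal (g p.1 p.2)) p :=
    (ENNReal.measurable_ofReal.comp hg).indicator (measurableSet_nullDom _ _)
  have key := lintegral_comp_null hc (h := fun α β => (nullDom (c * t - r) (c * t + r)).indicator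
        (fun p => ENNReal.ofReal (g p.1 p.2)) (α, β)) hm
  rw [mul_kir_eq hc ht hr b (continuous_zsum hG), ENNReal.ofReal_mul (by positivity)]
  calc _ ≤ ENNReal.ofReal (1 / (4 * Real.pi * c)) * (ENNReal.ofReal (2 * Real.pi) *
        ∫⁻ z : ℝ × ℝ, (nullDom (c * t - r) (c * t + r)).indicator
        (fun p => ENNReal.ofReal (g p.1 p.2)) (c * z.1 + z.2, c * z.1 - z.2)) := by
        gcongr
        refine (ENNReal.ofReal_le_ofReal (le_abs_self _)).trans ?_
        rw [← Real.enorm_eq_ofReal_abs, ← lintegral_const_mul' _ _ ENNReal.ofReal_ne_top]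
        refine (enorm_integral_le_lintegral_enorm _).trans (lintegral_mono fun z => ?_)
        by_cases hz : z ∈ bipDom c t r
        · rw [indicator_of_mem ((mem_nullDom_iff hc).2 hz), Real.enorm_eq_ofReal_abs,
            ← ENNReal.ofReal_mul (by positivity)]
          refine ENNReal.ofReal_le_ofReal (h.abs_bipInt_le hb hc hr (fun s y => ?_) hz)
          rw [abs_of_nonneg (zsum_nonneg _ _ _)]
        · simp [bipInt, hz]
    _ = _ := by
      rw [key, ← mul_assoc, ← mul_assoc, ← ENNReal.ofReal_mul (by positivity),
        ← ENNReal.ofReal_mul (by positivity)]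
      congr 2
      field_simp

/-- Weight comparing the retarded potentials with characteristic parameters `(T, S)` and
`(T', S')`. -/
def diffWt (T S T' S' : ℝ) (p : ℝ × ℝ) : ENNReal :=
  (nullDom T S ∩ nullDom T' S').indicator
    (fun p => ENNReal.ofReal |nullAng T S p.1 p.2 - nullAng T' S' p.1 p.2|) p +
  (nullDom T S \ nullDom T' S').indicator 1 p + (nullDom T' S' \ nullDom T S).indicator 1 p

lemma measurable_diffWt (T S T' S' : ℝ) : Measurable (diffWt T S T' S') := by
  have m1 := measurableSet_nullDom T S
  have m2 := measurableSet_nullDom T' S'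
  have m3 := measurable_nullAng T S
  have m4 := measurable_nullAng T' S'
  refine (Measurable.add ?_ ?_).add ?_
  · refine Measurable.indicator ?_ (m1.inter m2)
    have := (m3.sub m4)
    fun_prop
  · exact measurable_one.indicator (m1.diff m2)
  · exact measurable_one.indicator (m2.diff m1)

theorem Dominated.abs_sub_le (h : Dominated c t (r • b 0) G g) (hb : Orthonormal ℝ b)
    (hG : Smooth G) (hc : 0 < c) (ht' : 0 < t') (hr : 0 < r) (hr' : 0 < r') (ht : t' ≤ t)
    (hd : |r - r'| ≤ c * (t - t')) (hg : Measurable (Function.uncurry g)) :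
    ENNReal.ofReal |r * kir c b G t (r • b 0) - r' * kir c b G t' (r' • b 0)| ≤
      ENNReal.ofReal (1 / (2 * c ^ 2)) * ∫⁻ α, ∫⁻ β,
        diffWt (c * t - r) (c * t + r) (c * t' - r') (c * t' + r') (α, β) *
          ENNReal.ofReal (g α β) := by
  have hpi := Real.pi_pos
  have h' := h.mono hb ht hd
  set D := diffWt (c * t - r) (c * t + r) (c * t' - r') (c * t' + r') with hD
  have hm : Measurable fun p : ℝ × ℝ => D p * ENNReal.ofReal (g p.1 p.2) :=
    (measurable_diffWt _ _ _ _).mul (ENNReal.measurable_ofReal.comp hg)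
  have key := lintegral_comp_null hc (h := fun α β => D (α, β) * ENNReal.ofReal (g α β)) hm
  rw [mul_kir_eq hc (ht'.trans_le ht) hr b hG.continuous, mul_kir_eq hc ht' hr' b hG.continuous,
    ← mul_sub, ← integral_sub (integrable_bipInt hc b hG.continuous t r)
      (integrable_bipInt hc b hG.continuous t' r'), abs_mul,
    abs_of_pos (by positivity : 0 < 1 / (4 * Real.pi * c)), ENNReal.ofReal_mul (by positivity)]
  calc _ ≤ ENNReal.ofReal (1 / (4 * Real.pi * c)) * (ENNReal.ofReal (4 * Real.pi) *
        ∫⁻ z : ℝ × ℝ, D (c * z.1 + z.2, c * z.1 - z.2) *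
          ENNReal.ofReal (g (c * z.1 + z.2) (c * z.1 - z.2))) := by
        gcongr
        rw [← Real.enorm_eq_ofReal_abs, ← lintegral_const_mul' _ _ ENNReal.ofReal_ne_top]
        refine (enorm_integral_le_lintegral_enorm _).trans (lintegral_mono fun z => ?_)
        rw [Real.enorm_eq_ofReal_abs]
        obtain ⟨s, l⟩ := z
        simp only
        have i := mem_nullDom_iff (t := t) (r := r) (s := s) (l := l) hc
        have i' := mem_nullDom_iff (t := t') (r := r') (s := s) (l := l) hc
        by_cases hz : (s, l) ∈ bipDom c t r <;> by_cases hz' : (s, l) ∈ bipDom c t' r'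
        · have hl := pos_of_mem_bipDom hz
          have hs := time_lt_of_mem_bipDom hc hz'
          have e : D (c * s + l, c * s - l) = ENNReal.ofReal |nullAng (c * t - r) (c * t + r)
              (c * s + l) (c * s - l) - nullAng (c * t' - r') (c * t' + r')
              (c * s + l) (c * s - l)| := by
            simp [hD, diffWt, i.2 hz, i'.2 hz']
          rw [e, ← ENNReal.ofReal_mul (abs_nonneg _), ← ENNReal.ofReal_mul (by positivity),
            ← bipAng_eq hr hl, ← bipAng_eq hr' hl]
          refine ENNReal.ofReal_le_ofReal ?_
          have hle : bipAng c t' r' (s, l) ≤ bipAng c t r (s, l) := by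
            have h1 := norm_smul_om_sub_le hb hc hr' hz' (θ := bipAng c t' r' (s, l))
              (Real.arccos_nonneg _) le_rfl 0
            have h2 : ‖l • om b (bipAng c t' r' (s, l)) 0 - r • b 0‖ ≤ c * (t - s) := by
              have e : l • om b (bipAng c t' r' (s, l)) 0 - r • b 0 =
                (l • om b (bipAng c t' r' (s, l)) 0 - r' • b 0) + (r' - r) • b 0 := by module
              rw [e]
              refine (norm_add_le _ _).trans ?_
              rw [norm_smul, hb.1 0, mul_one, Real.norm_eq_abs, abs_sub_comm]
              linarith
            have h3 := pow_le_pow_left₀ (norm_nonneg _) h2 2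
            rw [norm_smul_om_sub hb] at h3
            have h4 : Real.cos (bipAng c t r (s, l)) ≤ Real.cos (bipAng c t' r' (s, l)) := by
              rw [cos_bipAng hc hr hz, div_le_iff₀ (by positivity)]
              linarith
            by_contra! hlt
            exact (Real.cos_lt_cos_of_nonneg_of_le_pi (Real.arccos_nonneg _)
              (Real.arccos_le_pi _) hlt).not_ge h4
          unfold bipInt
          rw [indicator_of_mem hz, indicator_of_mem hz', ← mul_sub, abs_mul, abs_of_pos hl]
          have := abs_azInt_sub_le hb hG (s := s) (l := l) (θ := bipAng c t r (s, l))
            (θ' := bipAng c t' r' (s, l)) (B := g (c * s + l) (c * s - l) / l) fun η hη φ => by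
              rw [uIcc_of_ge hle] at hη
              rw [le_div_iff₀' hl]
              exact h.mul_zsum_le hb hc hr hz ((Real.arccos_nonneg _).trans hη.1) hη.2 φ
          refine (mul_le_mul_of_nonneg_left this hl.le).trans (le_of_eq ?_)
          field_simp
          ring
        · have e : D (c * s + l, c * s - l) = 1 := by
            simp [hD, diffWt, i.2 hz, mt i'.1 hz']
          have e' : bipInt c b G t' r' (s, l) = 0 := by simp [bipInt, hz']
          rw [e, e', one_mul, sub_zero, ← ENNReal.ofReal_mul (by positivity)]
          refine ENNReal.ofReal_le_ofReal ((h.abs_bipInt_le hb hc hr (abs_le_zsum G) hz).trans ?_)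
          have := mul_nonneg hpi.le (h.nonneg hb hc hr hz)
          simp only at *
          linarith
        · have e : D (c * s + l, c * s - l) = 1 := by
            simp [hD, diffWt, i'.2 hz', mt i.1 hz]
          have e' : bipInt c b G t r (s, l) = 0 := by simp [bipInt, hz]
          rw [e, e', one_mul, zero_sub, abs_neg, ← ENNReal.ofReal_mul (by positivity)]
          refine ENNReal.ofReal_le_ofReal
            ((h'.abs_bipInt_le hb hc hr' (abs_le_zsum G) hz').trans ?_)
          have := mul_nonneg hpi.le (h'.nonneg hb hc hr' hz')
          simp only at *
          linarith
        · simp [bipInt, hz, hz']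
    _ = _ := by
      rw [key, ← mul_assoc, ← mul_assoc, ← ENNReal.ofReal_mul (by positivity),
        ← ENNReal.ofReal_mul (by positivity)]
      congr 2
      field_simp

end

section

open MeasureTheory Set Filter Topology

lemma abs_arccos_sub_le {f f' : ℝ → ℝ} {a b B : ℝ} (hab : a ≤ b) (hB : 0 ≤ B)
    (hf : ∀ x ∈ Icc a b, HasDerivAt f (f' x) x) (h1 : ∀ x ∈ Icc a b, f x ^ 2 < 1)
    (h : ∀ x ∈ Icc a b, f' x ^ 2 ≤ B ^ 2 * (1 - f x ^ 2)) :
    |Real.arccos (f b) - Real.arccos (f a)| ≤ B * (b - a) := by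
  have := Convex.norm_image_sub_le_of_norm_hasDerivWithin_le (𝕜 := ℝ) (s := Icc a b) (C := B)
    (f := fun x => Real.arccos (f x)) (f' := fun x => -(1 / √(1 - f x ^ 2)) * f' x)
    (fun x hx => ?_) (fun x hx => ?_)
    (convex_Icc _ _) (left_mem_Icc.2 hab) (right_mem_Icc.2 hab)
  · rwa [Real.norm_eq_abs, Real.norm_eq_abs, abs_of_nonneg (sub_nonneg.2 hab)] at this
  · have := h1 x hx
    refine HasDerivAt.hasDerivWithinAt ?_
    exact (Real.hasDerivAt_arccos (fun e => by rw [e] at this; norm_num at this)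
      (fun e => by rw [e] at this; norm_num at this)).comp x (hf x hx)
  · have h2 : 0 < 1 - f x ^ 2 := by linarith [h1 x hx]
    have h3 := Real.sqrt_pos.2 h2
    rw [Real.norm_eq_abs, abs_mul, abs_neg, abs_of_pos (by positivity : 0 < 1 / √(1 - f x ^ 2)),
      one_div, inv_mul_le_iff₀ h3, mul_comm]
    refine abs_le_of_sq_le_sq ?_ (by positivity)
    rw [mul_pow, Real.sq_sqrt h2.le]
    exact h x hx

lemma one_sub_nullCos_sq {T S α β : ℝ} (h1 : T < S) (h2 : β < α) :
    1 - (1 - 2 * ((T - β) * (S - α)) / ((S - T) * (α - β))) ^ 2 =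
      4 * ((T - β) * (S - α) * (S - β) * (α - T)) / ((S - T) * (α - β)) ^ 2 := by
  have h1 : S - T ≠ 0 := by linarith
  have h2 : α - β ≠ 0 := by linarith
  field_simp
  ring

lemma one_div_sqrt_add_sq {a b : ℝ} (ha : 0 < a) (hb : 0 < b) : 1 / a + 1 / b ≤ (1 / √a + 1 / √b) ^ 2 := by
  have h1 := Real.sqrt_pos.2 ha
  have h2 := Real.sqrt_pos.2 hb
  have e1 : 1 / a = (1 / √a) ^ 2 := by rw [div_pow, Real.sq_sqrt ha.le, one_pow]
  have e2 : 1 / b = (1 / √b) ^ 2 := by rw [div_pow, Real.sq_sqrt hb.le, one_pow]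
  rw [e1, e2]
  have := mul_pos (one_div_pos.2 h1) (one_div_pos.2 h2)
  nlinarith

lemma abs_nullAng_sub_left_le {T S α β δ : ℝ} (hδ : 0 ≤ δ) (hα : T < α) (hαS : α < S)
    (hβ : β < T - δ) : |nullAng T S α β - nullAng (T - δ) S α β| ≤
      δ * (1 / √((S - T) * (α - T)) + 1 / √((α - T) * (T - δ - β))) := by
  have q0 : 0 < S - α := by linarith
  have p0 : 0 < α - T := by linarith
  have P0 : 0 < T - δ - β := by linarith
  have w0 : 0 < α - β := by linarith
  have d0 : 0 < S - T := by linarith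
  have := abs_arccos_sub_le (a := T - δ) (b := T) (by linarith)
    (f := fun τ => 1 - 2 * ((τ - β) * (S - α)) / ((S - τ) * (α - β)))
    (f' := fun τ => -2 * (S - α) * (S - β) / ((α - β) * (S - τ) ^ 2))
    (B := 1 / √((S - T) * (α - T)) + 1 / √((α - T) * (T - δ - β))) (by positivity)
    (fun τ hτ => ?_) (fun τ hτ => ?_) (fun τ hτ => ?_)
  · refine this.trans (le_of_eq ?_)
    ring
  all_goals
    obtain ⟨h1, h2⟩ := hτ
    have d1 : 0 < S - τ := by linarith
    have p1 : 0 < α - τ := by linarith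
    have P1 : 0 < τ - β := by linarith
    have Q1 : 0 < S - β := by linarith
  · have h1 : HasDerivAt (fun τ => 2 * ((τ - β) * (S - α))) (2 * (1 * (S - α))) τ :=
      (((hasDerivAt_id τ).sub_const β).mul_const _).const_mul 2
    have h2 : HasDerivAt (fun τ => (S - τ) * (α - β)) (-1 * (α - β)) τ :=
      ((hasDerivAt_id τ).const_sub S).mul_const _
    refine ((h1.div h2 (by positivity)).const_sub 1).congr_deriv ?_
    field_simp
    ring
  · have := one_sub_nullCos_sq (T := τ) (S := S) (α := α) (β := β) (by linarith) (by linarith)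
    have h3 : 0 < 4 * ((τ - β) * (S - α) * (S - β) * (α - τ)) / ((S - τ) * (α - β)) ^ 2 := by
      positivity
    linarith
  · rw [one_sub_nullCos_sq (by linarith) (by linarith)]
    refine le_trans ?_ (mul_le_mul_of_nonneg_right
      (one_div_sqrt_add_sq (mul_pos d0 p0) (mul_pos p0 P0)) (by positivity))
    have h3 : 1 / ((S - τ) * (α - τ)) + 1 / ((α - τ) * (τ - β)) ≤
        1 / ((S - T) * (α - T)) + 1 / ((α - T) * (T - δ - β)) := by
      gcongr
    refine le_trans ?_ (mul_le_mul_of_nonneg_right h3 (by positivity))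
    have e : (1 / ((S - τ) * (α - τ)) + 1 / ((α - τ) * (τ - β))) *
        (4 * ((τ - β) * (S - α) * (S - β) * (α - τ)) / ((S - τ) * (α - β)) ^ 2) =
        4 * (S - α) * (S - β) ^ 2 * (S - τ) / ((α - β) ^ 2 * (S - τ) ^ 4) := by
      field_simp
      ring
    rw [e, div_pow, show ((α - β) * (S - τ) ^ 2) ^ 2 = (α - β) ^ 2 * (S - τ) ^ 4 by ring]
    gcongr ?_ / _
    nlinarith [mul_pos (mul_pos q0 (pow_pos Q1 2)) p1]

lemma abs_nullAng_sub_right_le {T S α β δ : ℝ} (hδ : 0 ≤ δ) (hα : T < α) (hαS : α < S - δ)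
    (hβ : β < T) : |nullAng T S α β - nullAng T (S - δ) α β| ≤
      δ * (1 / √((S - δ - T) * (S - δ - α))) := by
  have q0 : 0 < S - δ - α := by linarith
  have p0 : 0 < α - T := by linarith
  have P0 : 0 < T - β := by linarith
  have w0 : 0 < α - β := by linarith
  have d0 : 0 < S - δ - T := by linarith
  have := abs_arccos_sub_le (a := S - δ) (b := S) (by linarith)
    (f := fun τ => 1 - 2 * ((T - β) * (τ - α)) / ((τ - T) * (α - β)))
    (f' := fun τ => -2 * (T - β) * (α - T) / ((α - β) * (τ - T) ^ 2))
    (B := 1 / √((S - δ - T) * (S - δ - α))) (by positivity)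
    (fun τ hτ => ?_) (fun τ hτ => ?_) (fun τ hτ => ?_)
  · refine this.trans (le_of_eq ?_)
    ring
  all_goals
    obtain ⟨h1, h2⟩ := hτ
    have d1 : 0 < τ - T := by linarith
    have q1 : 0 < τ - α := by linarith
    have Q1 : 0 < τ - β := by linarith
  · have h1 : HasDerivAt (fun τ => 2 * ((T - β) * (τ - α))) (2 * ((T - β) * 1)) τ :=
      (((hasDerivAt_id τ).sub_const α).const_mul _).const_mul 2
    have h2 : HasDerivAt (fun τ => (τ - T) * (α - β)) (1 * (α - β)) τ :=
      ((hasDerivAt_id τ).sub_const T).mul_const _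
    refine ((h1.div h2 (by positivity)).const_sub 1).congr_deriv ?_
    field_simp
    ring
  · have := one_sub_nullCos_sq (T := T) (S := τ) (α := α) (β := β) (by linarith) (by linarith)
    have h3 : 0 < 4 * ((T - β) * (τ - α) * (τ - β) * (α - T)) / ((τ - T) * (α - β)) ^ 2 := by
      positivity
    linarith
  · rw [one_sub_nullCos_sq (by linarith) (by linarith), div_pow 1, one_pow,
      Real.sq_sqrt (by positivity)]
    have h3 : 1 / ((τ - T) * (τ - α)) ≤ 1 / ((S - δ - T) * (S - δ - α)) := by
      gcongr
    refine le_trans ?_ (mul_le_mul_of_nonneg_right h3 (by positivity))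
    have e : 1 / ((τ - T) * (τ - α)) *
        (4 * ((T - β) * (τ - α) * (τ - β) * (α - T)) / ((τ - T) * (α - β)) ^ 2) =
        4 * (T - β) * (τ - β) * (α - T) * (τ - T) / ((α - β) ^ 2 * (τ - T) ^ 4) := by
      field_simp
    rw [e, div_pow, show ((α - β) * (τ - T) ^ 2) ^ 2 = (α - β) ^ 2 * (τ - T) ^ 4 by ring]
    gcongr ?_ / _
    have h4 : (T - β) * (α - T) ≤ (τ - β) * (τ - T) := by gcongr <;> linarith
    nlinarith [mul_le_mul_of_nonneg_left h4 (mul_pos P0 p0).le]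

end

section

open MeasureTheory Set Filter Topology

/-- Decay of the source off the cone `β = γ α`. -/
def bkt (ν γ α β : ℝ) : ℝ := (1 + |β - γ * α|) ^ (-ν)

/-- The model source in null coordinates. -/
def nullKer (κ ν γ α β : ℝ) : ℝ := (1 + |α|) ^ (-κ) * bkt ν γ α β

lemma bkt_nonneg (ν γ α β : ℝ) : 0 ≤ bkt ν γ α β := by
  unfold bkt
  positivity

lemma nullKer_nonneg (κ ν γ α β : ℝ) : 0 ≤ nullKer κ ν γ α β :=
  mul_nonneg (by positivity) (bkt_nonneg _ _ _ _)

lemma measurable_bkt (ν γ : ℝ) : Measurable fun z : ℝ × ℝ => bkt ν γ z.1 z.2 := by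
  unfold bkt
  fun_prop

lemma measurable_nullKer (κ ν γ : ℝ) : Measurable fun z : ℝ × ℝ => nullKer κ ν γ z.1 z.2 := by
  have := measurable_bkt ν γ
  unfold nullKer
  fun_prop

lemma rpow_bracket_le {κ x y : ℝ} (hκ : 0 ≤ κ) (hx : 0 ≤ x) (h : x ≤ y) :
    (1 + y) ^ (-κ) ≤ (1 + x) ^ (-κ) :=
  Real.rpow_le_rpow_of_nonpos (by linarith) (by linarith) (by linarith)

lemma lintegral_prod_mul_bkt_le {ν γ C : ℝ}
    (hC : ∀ a : ℝ, ∫⁻ x : ℝ, ENNReal.ofReal ((1 + |x - a|) ^ (-ν)) ≤ ENNReal.ofReal C)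
    {a : ℝ → ENNReal} (ha : Measurable a) :
    ∫⁻ z : ℝ × ℝ, a z.1 * ENNReal.ofReal (bkt ν γ z.1 z.2) ≤ ENNReal.ofReal C * ∫⁻ x, a x := by
  have hm := measurable_bkt ν γ
  have hm' : ∀ x, Measurable fun y => ENNReal.ofReal (bkt ν γ x y) := fun x =>
    ENNReal.measurable_ofReal.comp (hm.comp (measurable_prodMk_left))
  have hm2 : Measurable fun z : ℝ × ℝ => a z.1 * ENNReal.ofReal (bkt ν γ z.1 z.2) :=
    (ha.comp measurable_fst).mul (ENNReal.measurable_ofReal.comp hm)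
  rw [Measure.volume_eq_prod, lintegral_prod _ hm2.aemeasurable]
  calc _ = ∫⁻ x, a x * ∫⁻ y, ENNReal.ofReal (bkt ν γ x y) :=
        lintegral_congr fun x => lintegral_const_mul _ (hm' x)
    _ ≤ ∫⁻ x, ENNReal.ofReal C * a x := by
        refine lintegral_mono fun x => ?_
        rw [mul_comm]
        gcongr
        exact hC _
    _ = _ := lintegral_const_mul _ ha

lemma lintegral_inv_sqrt_sub_left {a b : ℝ} (h : a ≤ b) :
    ∫⁻ x in Ioo a b, ENNReal.ofReal (1 / √(x - a)) = ENNReal.ofReal (2 * √(b - a)) := by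
  rw [← lintegral_Ioo_inv_sqrt (sub_nonneg.2 h), ← lintegral_indicator measurableSet_Ioo,
    ← lintegral_indicator measurableSet_Ioo,
    ← lintegral_sub_right_eq_self ((Ioo 0 (b - a)).indicator _) a]
  have e : ∀ x, x - a ∈ Ioo 0 (b - a) ↔ x ∈ Ioo a b := fun x => by simp
  refine lintegral_congr fun x => ?_
  by_cases hx : x ∈ Ioo a b
  · rw [indicator_of_mem hx, indicator_of_mem ((e x).2 hx)]
  · rw [indicator_of_notMem hx, indicator_of_notMem (mt (e x).1 hx)]

lemma lintegral_inv_sqrt_sub_right {a b : ℝ} (h : a ≤ b) :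
    ∫⁻ x in Ioo a b, ENNReal.ofReal (1 / √(b - x)) = ENNReal.ofReal (2 * √(b - a)) := by
  rw [← lintegral_Ioo_inv_sqrt (sub_nonneg.2 h), ← lintegral_indicator measurableSet_Ioo,
    ← lintegral_indicator measurableSet_Ioo,
    ← lintegral_sub_left_eq_self ((Ioo 0 (b - a)).indicator _) b]
  have e : ∀ x, b - x ∈ Ioo 0 (b - a) ↔ x ∈ Ioo a b := fun x => by
    simp only [mem_Ioo, sub_pos, sub_lt_sub_iff_left]
    exact and_comm
  refine lintegral_congr fun x => ?_
  by_cases hx : x ∈ Ioo a b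
  · rw [indicator_of_mem hx, indicator_of_mem ((e x).2 hx)]
  · rw [indicator_of_notMem hx, indicator_of_notMem (mt (e x).1 hx)]

lemma log_two_le_Psi {ρ k : ℝ} (hk : 0 ≤ k) : Real.log 2 ≤ Psi ρ k := by
  unfold Psi
  split_ifs
  · exact Real.log_le_log two_pos (by linarith)
  · have := Real.log_two_lt_d9
    linarith

lemma Psi_pos {ρ k : ℝ} (hk : 0 ≤ k) : 0 < Psi ρ k :=
  (Real.log_pos one_lt_two).trans_le (log_two_le_Psi hk)

/-- Integration of the model source along an incoming characteristic. -/
lemma exists_lintegral_nullKer_le {κ ν γ : ℝ} (hκ : 1 ≤ κ) (hν : 1 < ν) :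
    ∃ C > 0, ∀ β S k : ℝ, 0 ≤ k → 1 + S ≤ (2 + k) * (1 + |β|) →
      ∫⁻ α in Ioo |β| S, ENNReal.ofReal (nullKer κ ν γ α β) ≤
        ENNReal.ofReal (C * ((1 + |β|) ^ (-κ) * Psi (κ - 1) k)) := by
  have hlog := Real.log_pos one_lt_two
  by_cases hγ : γ = 0
  · subst hγ
    have hpt : ∀ β S : ℝ, ∀ α ∈ Ioo |β| S, ENNReal.ofReal (nullKer κ ν 0 α β) ≤
        ENNReal.ofReal ((1 + |β|)⁻¹) * ENNReal.ofReal ((1 + α) ^ (-κ)) := by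
      intro β S α hα
      have h0 := abs_nonneg β
      rw [← ENNReal.ofReal_mul (by positivity)]
      refine ENNReal.ofReal_le_ofReal ?_
      unfold nullKer bkt
      rw [zero_mul, sub_zero, abs_of_pos (h0.trans_lt hα.1), mul_comm]
      rw [inv_eq_one_div]
      exact mul_le_mul_of_nonneg_right (bracket_rpow_le_inv h0 hν.le)
        (Real.rpow_nonneg (by linarith [hα.1]) _)
    rcases hκ.eq_or_lt with rfl | hκ1
    · refine ⟨1, one_pos, fun β S k hk h => ?_⟩
      have h0 := abs_nonneg β
      refine (setLIntegral_mono' measurableSet_Ioo (hpt β S)).trans ?_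
      rw [lintegral_const_mul' _ _ ENNReal.ofReal_ne_top]
      rcases le_or_gt S |β| with hS | hS
      · simp [Ioo_eq_empty_of_le hS]
      rw [lintegral_Ioo_deriv (F := fun α => Real.log (1 + α)) hS.le, ← ENNReal.ofReal_mul
        (by positivity), Psi, if_pos (by ring), one_mul, Real.rpow_neg_one]
      · refine ENNReal.ofReal_le_ofReal ?_
        gcongr
        rw [← Real.log_div (by linarith) (by linarith)]
        refine Real.log_le_log (div_pos (by linarith) (by linarith)) ?_
        rwa [div_le_iff₀ (by linarith)]
      · refine ContinuousOn.log (by fun_prop) fun x hx => ?_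
        linarith [hx.1]
      · intro x hx
        have : 0 < 1 + x := by linarith [hx.1]
        rw [Real.rpow_neg_one]
        exact (((hasDerivAt_id x).const_add 1).log this.ne').congr_deriv (by simp)
      · intro x hx
        have : 0 < 1 + x := by linarith [hx.1]
        positivity
    · refine ⟨1 / (κ - 1), one_div_pos.2 (by linarith), fun β S k hk h => ?_⟩
      have h0 := abs_nonneg β
      have hk1 : 0 < κ - 1 := by linarith
      refine (setLIntegral_mono' measurableSet_Ioo (hpt β S)).trans ?_
      rw [lintegral_const_mul' _ _ ENNReal.ofReal_ne_top]
      rcases le_or_gt S |β| with hS | hS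
      · simp [Ioo_eq_empty_of_le hS]
      rw [lintegral_Ioo_deriv (F := fun α => -(1 / (κ - 1)) * (1 + α) ^ (1 - κ)) hS.le,
        ← ENNReal.ofReal_mul (by positivity), Psi, if_neg (by linarith), mul_one]
      · refine ENNReal.ofReal_le_ofReal ?_
        have h1 : 0 ≤ (1 + S) ^ (1 - κ) := Real.rpow_nonneg (by linarith) _
        have h2 : (1 + |β|) ^ (-κ) = (1 + |β|)⁻¹ * (1 + |β|) ^ (1 - κ) := by
          rw [← Real.rpow_neg_one, ← Real.rpow_add (by linarith)]
          congr 1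
          ring
        rw [h2, mul_left_comm]
        gcongr
        have := mul_nonneg (one_div_pos.2 hk1).le h1
        linarith
      · refine ContinuousOn.mul continuousOn_const
          (ContinuousOn.rpow_const (by fun_prop) fun x hx => Or.inl ?_)
        linarith [hx.1]
      · intro x hx
        have : 0 < 1 + x := by linarith [hx.1]
        have := ((((hasDerivAt_id x).const_add 1).rpow_const (p := 1 - κ)
          (Or.inl this.ne')).const_mul (-(1 / (κ - 1))))
        refine this.congr_deriv ?_
        rw [show 1 - κ - 1 = -κ by ring]
        simp only [id]
        field_simp
        ring
      · intro x hx
        have : 0 < 1 + x := by linarith [hx.1]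
        positivity
  · obtain ⟨C, hC, h⟩ := exists_lintegral_bracket_mul_le hν hγ
    refine ⟨C / Real.log 2, by positivity, fun β S k hk hS => ?_⟩
    have h0 := abs_nonneg β
    calc _ ≤ ∫⁻ α in Ioo |β| S, ENNReal.ofReal ((1 + |β|) ^ (-κ)) *
          ENNReal.ofReal ((1 + |β - γ * α|) ^ (-ν)) := by
          refine setLIntegral_mono' measurableSet_Ioo fun α hα => ?_
          rw [← ENNReal.ofReal_mul (by positivity)]
          refine ENNReal.ofReal_le_ofReal ?_
          unfold nullKer bkt
          refine mul_le_mul_of_nonneg_right ?_ (by positivity)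
          exact rpow_bracket_le (by linarith) h0 (hα.1.le.trans (le_abs_self _))
      _ ≤ ENNReal.ofReal ((1 + |β|) ^ (-κ)) * ENNReal.ofReal C := by
          rw [lintegral_const_mul' _ _ ENNReal.ofReal_ne_top]
          gcongr
          exact (setLIntegral_le_lintegral _ _).trans (h β)
      _ ≤ _ := by
          rw [← ENNReal.ofReal_mul (by positivity)]
          refine ENNReal.ofReal_le_ofReal ?_
          have := mul_le_mul_of_nonneg_left (log_two_le_Psi (ρ := κ - 1) hk)
            (by positivity : 0 ≤ C / Real.log 2 * (1 + |β|) ^ (-κ))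
          refine (le_of_eq ?_).trans (this.trans (le_of_eq (by ring)))
          field_simp

lemma diffWt_mul_le {T S T' S' : ℝ} {p : ℝ × ℝ} {k X Y Z : ENNReal}
    (hX : p ∈ nullDom T S → p ∈ nullDom T' S' →
      ENNReal.ofReal |nullAng T S p.1 p.2 - nullAng T' S' p.1 p.2| * k ≤ X)
    (hY : p ∈ nullDom T S → p ∉ nullDom T' S' → k ≤ Y)
    (hZ : p ∈ nullDom T' S' → p ∉ nullDom T S → k ≤ Z) :
    diffWt T S T' S' p * k ≤ X + Y + Z := by
  unfold diffWt
  by_cases h : p ∈ nullDom T S <;> by_cases h' : p ∈ nullDom T' S'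
  · simp only [indicator, mem_inter_iff, Set.mem_sdiff, h, h', not_true_eq_false, and_self, and_false,
      if_true, if_false, add_zero]
    exact (hX h h').trans (le_add_right le_self_add)
  · simp only [indicator, mem_inter_iff, Set.mem_sdiff, h, h', not_false_eq_true, and_self, and_false,
      false_and, if_true, if_false, add_zero, zero_add, Pi.one_apply, one_mul]
    exact (hY h h').trans (le_add_right le_add_self)
  · simp only [indicator, mem_inter_iff, Set.mem_sdiff, h, h', not_false_eq_true, and_self,
      false_and, if_true, if_false, add_zero, zero_add, Pi.one_apply, one_mul]
    exact (hZ h' h).trans le_add_self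
  · simp [h, h']

lemma abs_lt_of_mem_nullDom {T S : ℝ} {p : ℝ × ℝ} (h : p ∈ nullDom T S) : |T| < p.1 := by
  obtain ⟨h1, -, h3, h4⟩ := h
  exact abs_lt.2 ⟨by linarith, h1⟩

lemma nullKer_le_of_abs_le {κ ν γ α β T : ℝ} (hκ : 0 ≤ κ) (h : |T| ≤ |α|) :
    nullKer κ ν γ α β ≤ (1 + |T|) ^ (-κ) * bkt ν γ α β :=
  mul_le_mul_of_nonneg_right (rpow_bracket_le hκ (abs_nonneg T) h) (bkt_nonneg _ _ _ _)

end

section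

open MeasureTheory Set Filter Topology

lemma lintegral_indicator_mul {s : Set ℝ} (hs : MeasurableSet s) {A : ℝ} (hA : 0 ≤ A)
    (f : ℝ → ℝ) : ∫⁻ x, s.indicator (fun x => ENNReal.ofReal (A * f x)) x =
      ENNReal.ofReal A * ∫⁻ x in s, ENNReal.ofReal (f x) := by
  rw [lintegral_indicator hs, ← lintegral_const_mul' _ _ ENNReal.ofReal_ne_top]
  simp_rw [ENNReal.ofReal_mul hA]

lemma lintegral_indicator_const_ofReal {s : Set ℝ} (hs : MeasurableSet s) (A : ℝ) :
    ∫⁻ x, s.indicator (fun _ => ENNReal.ofReal A) x = ENNReal.ofReal A * volume s := by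
  rw [lintegral_indicator hs, setLIntegral_const]

lemma rpow_bracket_half_le {κ x y : ℝ} (hκ : 0 ≤ κ) (h : 1 + |y| ≤ 2 * (1 + |x|)) :
    (1 + |x|) ^ (-κ) ≤ 2 ^ κ * (1 + |y|) ^ (-κ) := by
  have h1 := Real.rpow_le_rpow_of_nonpos (z := -κ) (by positivity) h (by linarith)
  rw [Real.mul_rpow two_pos.le (by positivity), Real.rpow_neg two_pos.le,
    inv_mul_le_iff₀ (by positivity)] at h1
  exact h1

theorem exists_lintegral_nullDom_le {κ ν : ℝ} (hκ : 1 ≤ κ) (hν : 1 < ν) (γ : ℝ) :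
    ∃ C > 0, ∀ T S : ℝ, T < S → ∫⁻ z : ℝ × ℝ, (nullDom T S).indicator
      (fun p => ENNReal.ofReal (nullKer κ ν γ p.1 p.2)) z ≤
        ENNReal.ofReal (C * ((1 + |T|) ^ (-κ) * (S - T))) := by
  obtain ⟨C, hC, h⟩ := exists_lintegral_bracket_le hν
  refine ⟨C, hC, fun T S hTS => ?_⟩
  calc _ ≤ ∫⁻ z : ℝ × ℝ, (Ioo T S).indicator (fun _ => ENNReal.ofReal ((1 + |T|) ^ (-κ))) z.1 *
        ENNReal.ofReal (bkt ν γ z.1 z.2) := by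
        refine lintegral_mono fun z => ?_
        by_cases hz : z ∈ nullDom T S
        swap
        · rw [indicator_of_notMem hz]
          positivity
        rw [indicator_of_mem hz, indicator_of_mem (show z.1 ∈ Ioo T S from ⟨hz.1, hz.2.1⟩),
          ← ENNReal.ofReal_mul (by positivity)]
        exact ENNReal.ofReal_le_ofReal (nullKer_le_of_abs_le (by linarith)
          ((abs_lt_of_mem_nullDom hz).le.trans (le_abs_self _)))
    _ ≤ _ := by
      refine (lintegral_prod_mul_bkt_le h (by measurability)).trans (le_of_eq ?_)
      rw [lintegral_indicator_const_ofReal measurableSet_Ioo, Real.volume_Ioo,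
        ← ENNReal.ofReal_mul (by positivity), ← ENNReal.ofReal_mul hC.le]

/-- Stability of the retarded potential along outgoing characteristics. -/
theorem exists_lintegral_diffWt_right_le {κ ν : ℝ} (hκ : 1 ≤ κ) (hν : 1 < ν) (γ : ℝ) :
    ∃ C > 0, ∀ T S δ : ℝ, T < S - δ → 0 ≤ δ → ∫⁻ z : ℝ × ℝ, diffWt T S T (S - δ) z *
      ENNReal.ofReal (nullKer κ ν γ z.1 z.2) ≤
        ENNReal.ofReal (C * δ * (1 + |T|) ^ (-κ)) := by
  obtain ⟨C, hC, h⟩ := exists_lintegral_bracket_le hν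
  refine ⟨C * 2 + C, by positivity, fun T S δ hTS hδ => ?_⟩
  set M := (1 + |T|) ^ (-κ) with hM
  have hM0 : 0 < M := by positivity
  have hX : 0 < √(S - δ - T) := Real.sqrt_pos.2 (by linarith)
  have hbk := measurable_bkt ν γ
  set a1 : ℝ → ENNReal := (Ioo T (S - δ)).indicator
    (fun x => ENNReal.ofReal (δ * M / √(S - δ - T) * (1 / √(S - δ - x)))) with ha1
  set a2 : ℝ → ENNReal := (Ico (S - δ) S).indicator (fun _ => ENNReal.ofReal M) with ha2
  have m1 : Measurable a1 := Measurable.indicator (by fun_prop) measurableSet_Ioo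
  have m2 : Measurable a2 := Measurable.indicator (by fun_prop) measurableSet_Ico
  have hke : ∀ {T S : ℝ} {z : ℝ × ℝ}, z ∈ nullDom T S → nullKer κ ν γ z.1 z.2 ≤
      (1 + |T|) ^ (-κ) * bkt ν γ z.1 z.2 := fun hz =>
    nullKer_le_of_abs_le (by linarith) ((abs_lt_of_mem_nullDom hz).le.trans (le_abs_self _))
  calc _ ≤ ∫⁻ z : ℝ × ℝ, (a1 z.1 * ENNReal.ofReal (bkt ν γ z.1 z.2) +
        a2 z.1 * ENNReal.ofReal (bkt ν γ z.1 z.2) + 0) := by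
        refine lintegral_mono fun z => diffWt_mul_le (fun h h' => ?_) (fun h h' => ?_)
          (fun h' h => ?_)
        · have hz : z.1 ∈ Ioo T (S - δ) := ⟨h.1, h'.2.1⟩
          rw [ha1, indicator_of_mem hz, ← ENNReal.ofReal_mul (abs_nonneg _),
            ← ENNReal.ofReal_mul (by positivity)]
          refine ENNReal.ofReal_le_ofReal ((mul_le_mul (abs_nullAng_sub_right_le hδ h.1 h'.2.1
            h.2.2.1) (hke h) (nullKer_nonneg _ _ _ _ _) (by positivity)).trans (le_of_eq ?_))
          rw [Real.sqrt_mul (by linarith)]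
          have := Real.sqrt_pos.2 (show 0 < S - δ - z.1 by linarith [hz.2])
          simp only [← hM]
          field_simp
        · have hz : z.1 ∈ Ico (S - δ) S :=
            ⟨not_lt.1 fun hlt => h' ⟨h.1, hlt, h.2.2.1, h.2.2.2⟩, h.2.1⟩
          rw [ha2, indicator_of_mem hz, ← ENNReal.ofReal_mul (by positivity)]
          exact ENNReal.ofReal_le_ofReal (hke h)
        · exact absurd ⟨h'.1, h'.2.1.trans_le (by linarith), h'.2.2.1, h'.2.2.2⟩ h
    _ ≤ ENNReal.ofReal C * (ENNReal.ofReal (δ * M / √(S - δ - T)) *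
          ENNReal.ofReal (2 * √(S - δ - T))) + ENNReal.ofReal C * (ENNReal.ofReal M *
          ENNReal.ofReal δ) := by
        simp only [add_zero]
        have mm1 : Measurable fun z : ℝ × ℝ => a1 z.1 * ENNReal.ofReal (bkt ν γ z.1 z.2) :=
          (m1.comp measurable_fst).mul (ENNReal.measurable_ofReal.comp hbk)
        rw [lintegral_add_left mm1]
        refine add_le_add ((lintegral_prod_mul_bkt_le h m1).trans (le_of_eq ?_))
          ((lintegral_prod_mul_bkt_le h m2).trans (le_of_eq ?_))
        · rw [ha1, lintegral_indicator_mul measurableSet_Ioo (by positivity),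
            lintegral_inv_sqrt_sub_right hTS.le]
        · rw [ha2, lintegral_indicator_const_ofReal measurableSet_Ico, Real.volume_Ico]
          ring_nf
    _ = _ := by
      simp only [← ENNReal.ofReal_mul' hδ,
        ← ENNReal.ofReal_mul (by positivity : 0 ≤ δ * M / √(S - δ - T)),
        ← ENNReal.ofReal_mul hC.le]
      rw [← ENNReal.ofReal_add (by positivity) (by positivity)]
      congr 1
      field_simp

/-- Stability of the retarded potential along incoming characteristics. -/
theorem exists_lintegral_diffWt_left_le {κ ν γ : ℝ} (hκ : 1 ≤ κ) (hν : 1 < ν) (hγ : -1 < γ)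
    (hγ1 : γ ≤ 1) : ∃ C > 0, ∀ T S δ k : ℝ, T < S → 0 ≤ δ → δ ≤ 1 / 2 → 0 ≤ k →
      2 * (1 + S) ≤ (2 + k) * (1 + |T|) →
      ∫⁻ z : ℝ × ℝ, diffWt T S (T - δ) S z * ENNReal.ofReal (nullKer κ ν γ z.1 z.2) ≤
        ENNReal.ofReal (C * δ * ((1 + |T|) ^ (-κ) * Psi (κ - 1) k)) := by
  obtain ⟨C, hC, h⟩ := exists_lintegral_bracket_le hν
  obtain ⟨C₂, hC₂, h₂⟩ := exists_singKer_le hν hγ hγ1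
  obtain ⟨C₃, hC₃, h₃⟩ := exists_lintegral_nullKer_le (γ := γ) hκ hν
  have hlog := Real.log_pos one_lt_two
  refine ⟨(C * 2 + 3 * C₂ + C * 2 ^ κ) / Real.log 2 + C₃ * 2 ^ κ, by positivity,
    fun T S δ k hTS hδ hδ1 hk hS => ?_⟩
  have hL := log_two_le_Psi (ρ := κ - 1) hk
  set L := Psi (κ - 1) k with hLdef
  have hL0 : 0 < L := hlog.trans_le hL
  set N := 1 + |T| with hN
  have hN1 : 1 ≤ N := by linarith [abs_nonneg T]
  set M := N ^ (-κ) with hM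
  have hM0 : 0 < M := by positivity
  have hX : 0 < √(S - T) := Real.sqrt_pos.2 (by linarith)
  have hbk := measurable_bkt ν γ
  have hnk := measurable_nullKer κ ν γ
  have hMN : 3 * N ^ (1 - κ) * (C₂ / N) = 3 * C₂ * M := by
    rw [hM, sub_eq_add_neg, Real.rpow_add (by linarith), Real.rpow_one]
    field_simp
  set b := (1 - γ) * T - δ with hb
  set a1 : ℝ → ENNReal := (Ioo T S).indicator
    (fun x => ENNReal.ofReal (δ * M / √(S - T) * (1 / √(x - T)))) with ha1
  set a4 : ℝ → ENNReal := (Ioc (T - δ) T).indicator (fun _ => ENNReal.ofReal (2 ^ κ * M)) with ha4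
  set H : ℝ → ℝ → ENNReal := fun p P => (Ioi (0 : ℝ)).indicator (fun p =>
    (Ioi (0 : ℝ)).indicator (fun P => ENNReal.ofReal (δ * (3 * N ^ (1 - κ)) *
      singKer ν γ N b p P)) P) p with hH
  set E : Set (ℝ × ℝ) := {z | T - δ ≤ z.2 ∧ z.2 < T ∧ |z.2| < z.1 ∧ z.1 < S} with hE
  have m1 : Measurable a1 := Measurable.indicator (by fun_prop) measurableSet_Ioo
  have m4 : Measurable a4 := Measurable.indicator (by fun_prop) measurableSet_Ioc
  have mH : Measurable (Function.uncurry H) := by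
    have e : Function.uncurry H = (Ioi (0 : ℝ) ×ˢ Ioi (0 : ℝ)).indicator fun z =>
        ENNReal.ofReal (δ * (3 * N ^ (1 - κ)) * singKer ν γ N b z.1 z.2) := by
      ext ⟨p, P⟩
      by_cases hp : 0 < p <;> by_cases hP : 0 < P <;> simp [hH, indicator, hp, hP]
    rw [e]
    refine Measurable.indicator ?_ (measurableSet_Ioi.prod measurableSet_Ioi)
    unfold singKer
    fun_prop
  have mE : MeasurableSet E := by
    have ml : ∀ {f g : ℝ × ℝ → ℝ}, Measurable f → Measurable g → MeasurableSet {z | f z < g z} :=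
      measurableSet_lt
    have ml' : ∀ {f g : ℝ × ℝ → ℝ}, Measurable f → Measurable g → MeasurableSet {z | f z ≤ g z} :=
      measurableSet_le
    exact (ml' (by fun_prop) (by fun_prop)).inter ((ml (by fun_prop) (by fun_prop)).inter
      ((ml (by fun_prop) (by fun_prop)).inter (ml (by fun_prop) (by fun_prop))))
  set F2 : ℝ × ℝ → ENNReal := fun z => H (z.1 - T) (T - δ - z.2) with hF2
  set F3 : ℝ × ℝ → ENNReal := E.indicator fun z => ENNReal.ofReal (nullKer κ ν γ z.1 z.2) with hF3
  have mF2 : Measurable F2 :=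
    mH.comp (f := fun z : ℝ × ℝ => (z.1 - T, T - δ - z.2)) (by fun_prop)
  have mF3 : Measurable F3 := (ENNReal.measurable_ofReal.comp hnk).indicator mE
  have hke : ∀ {z : ℝ × ℝ}, z ∈ nullDom T S → nullKer κ ν γ z.1 z.2 ≤
      M * bkt ν γ z.1 z.2 := fun hz =>
    nullKer_le_of_abs_le (by linarith) ((abs_lt_of_mem_nullDom hz).le.trans (le_abs_self _))
  have i2 : ∫⁻ z, F2 z ≤ ENNReal.ofReal (δ * (3 * C₂ * M)) := by
    rw [Measure.volume_eq_prod, lintegral_prod _ mF2.aemeasurable]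
    have e1 : ∀ α, ∫⁻ β, F2 (α, β) = ∫⁻ P, H (α - T) P := fun α =>
      lintegral_sub_left_eq_self (fun P => H (α - T) P) (T - δ)
    simp_rw [e1]
    rw [lintegral_sub_right_eq_self (fun p => ∫⁻ P, H p P) T]
    have e2 : ∀ p, ∫⁻ P, H p P = (Ioi (0 : ℝ)).indicator (fun p =>
        ENNReal.ofReal (δ * (3 * N ^ (1 - κ))) *
          ∫⁻ P in Ioi (0 : ℝ), ENNReal.ofReal (singKer ν γ N b p P)) p := by
      intro p
      by_cases hp : p ∈ Ioi (0 : ℝ)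
      · simp only [hH, indicator_of_mem hp]
        exact lintegral_indicator_mul measurableSet_Ioi (by positivity) _
      · simp [hH, indicator_of_notMem hp]
    simp_rw [e2]
    rw [lintegral_indicator measurableSet_Ioi, lintegral_const_mul' _ _ ENNReal.ofReal_ne_top]
    have := h₂ N b hN1 ?_ ?_
    · refine (mul_le_mul_right this _).trans (le_of_eq ?_)
      rw [← ENNReal.ofReal_mul (by positivity), mul_assoc, hMN]
    · have h1 : |(1 - γ) * T| ≤ |b| + |δ| := by
        refine le_trans (le_of_eq ?_) (abs_add_le b δ)
        rw [hb]
        ring_nf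
      rw [abs_mul, abs_of_nonneg (by linarith : 0 ≤ 1 - γ), abs_of_nonneg hδ] at h1
      rw [hN, add_sub_cancel_left]
      linarith
    · rintro rfl
      rw [hb]
      linarith
  have i3 : ∫⁻ z, F3 z ≤ ENNReal.ofReal (C₃ * (2 ^ κ * M * L) * δ) := by
    rw [Measure.volume_eq_prod, lintegral_prod_symm _ mF3.aemeasurable]
    calc _ ≤ ∫⁻ β, (Ico (T - δ) T).indicator
          (fun _ => ENNReal.ofReal (C₃ * (2 ^ κ * M * L))) β := by
          refine lintegral_mono fun β => ?_
          by_cases hβ : β ∈ Ico (T - δ) T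
          · rw [indicator_of_mem hβ]
            have hβT : 1 + |T| ≤ 2 * (1 + |β|) := by
              have h1 : |T| ≤ |β| + |T - β| := by
                refine le_trans (le_of_eq ?_) (abs_add_le β (T - β))
                ring_nf
              rw [abs_of_pos (by linarith [hβ.2] : 0 < T - β)] at h1
              linarith [hβ.1, abs_nonneg β]
            have h1 := h₃ β S k hk (by nlinarith)
            have e : ∀ α, F3 (α, β) = (Ioo |β| S).indicator
                (fun α => ENNReal.ofReal (nullKer κ ν γ α β)) α := by
              intro α
              by_cases hα : α ∈ Ioo |β| S
              · rw [indicator_of_mem hα, hF3,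
                  indicator_of_mem (show (α, β) ∈ E from ⟨hβ.1, hβ.2, hα.1, hα.2⟩)]
              · rw [indicator_of_notMem hα, hF3, indicator_of_notMem]
                exact fun hz => hα ⟨hz.2.2.1, hz.2.2.2⟩
            simp_rw [e]
            rw [lintegral_indicator measurableSet_Ioo]
            refine h1.trans (ENNReal.ofReal_le_ofReal ?_)
            gcongr
            exact rpow_bracket_half_le (by linarith) hβT
          · rw [indicator_of_notMem hβ]
            refine le_of_eq ((lintegral_congr fun α => ?_).trans lintegral_zero)
            rw [hF3, indicator_of_notMem]
            exact fun hz => hβ ⟨hz.1, hz.2.1⟩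
      _ = _ := by
        rw [lintegral_indicator_const_ofReal measurableSet_Ico, Real.volume_Ico,
          ← ENNReal.ofReal_mul (by positivity)]
        ring_nf
  calc _ ≤ ∫⁻ z : ℝ × ℝ, ((a1 z.1 * ENNReal.ofReal (bkt ν γ z.1 z.2) + F2 z) + F3 z +
        a4 z.1 * ENNReal.ofReal (bkt ν γ z.1 z.2)) := by
        refine lintegral_mono fun z => diffWt_mul_le (fun h h' => ?_) (fun h h' => ?_)
          (fun h' h => ?_)
        · obtain ⟨α, β⟩ := z
          have hz : α ∈ Ioo T S := ⟨h.1, h.2.1⟩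
          have hαT := abs_lt_of_mem_nullDom h
          have hα := (abs_nonneg _).trans_lt hαT
          have hβ : β < T - δ := h'.2.2.1
          simp only at hαT hα
          have hp : α - T ∈ Ioi (0 : ℝ) := sub_pos.2 hz.1
          have hP : T - δ - β ∈ Ioi (0 : ℝ) := sub_pos.2 hβ
          simp only [hF2, hH]
          rw [ha1, indicator_of_mem hz, indicator_of_mem hp, indicator_of_mem hP,
            ← ENNReal.ofReal_mul (abs_nonneg _),
            ← ENNReal.ofReal_mul (by positivity),
            ← ENNReal.ofReal_add (mul_nonneg (by positivity) (bkt_nonneg _ _ _ _))]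
          swap
          · have : 0 ≤ singKer ν γ N b (α - T) (T - δ - β) := by
              have : 0 < N + (α - T) := add_pos (by linarith) hp
              unfold singKer
              positivity
            positivity
          refine ENNReal.ofReal_le_ofReal ?_
          refine (mul_le_mul_of_nonneg_right (abs_nullAng_sub_left_le hδ hz.1 hz.2 hβ)
            (nullKer_nonneg _ _ _ _ _)).trans ?_
          rw [mul_add, add_mul]
          have s1 : 0 < √(α - T) := Real.sqrt_pos.2 hp
          have s2 : 0 < √(T - δ - β) := Real.sqrt_pos.2 hP
          rw [Real.sqrt_mul (by linarith), Real.sqrt_mul (le_of_lt hp)]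
          refine add_le_add ?_ ?_
          · refine (mul_le_mul_of_nonneg_left (hke h) (by positivity)).trans (le_of_eq ?_)
            simp only
            field_simp
          · have hbr : bkt ν γ α β = (1 + |b - γ * (α - T) - (T - δ - β)|) ^ (-ν) := by
              unfold bkt
              congr 3
              rw [hb]
              ring
            have h3 : (1 + |α|) ^ (-κ) ≤ N ^ (1 - κ) * (3 / (N + (α - T))) := by
              have hNp : 0 < N + (α - T) := add_pos (by linarith) hp
              rw [abs_of_pos hα, show -κ = (1 - κ) + (-1) by ring, Real.rpow_add (by linarith),
                Real.rpow_neg_one]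
              gcongr ?_ * ?_
              · exact Real.rpow_le_rpow_of_nonpos (by linarith) (by rw [hN]; linarith)
                  (by linarith)
              · rw [inv_eq_one_div, div_le_div_iff₀ (by linarith) hNp, hN]
                linarith [neg_abs_le T]
            unfold nullKer singKer
            rw [← hbr]
            calc _ ≤ δ * (1 / (√(α - T) * √(T - δ - β))) *
                  (N ^ (1 - κ) * (3 / (N + (α - T))) * bkt ν γ α β) := by
                  gcongr
                  exact bkt_nonneg _ _ _ _
              _ = _ := by
                have hNp : 0 < N + (α - T) := add_pos (by linarith) hp
                generalize bkt ν γ α β = B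
                generalize N ^ (1 - κ) = K
                field_simp
        · have hz : z ∈ E := ⟨not_lt.1 fun hlt => h' ⟨by linarith [h.1], h.2.1, hlt, h.2.2.2⟩,
            h.2.2.1, abs_lt.2 ⟨by linarith [h.2.2.2], by linarith [h.1, h.2.2.1]⟩, h.2.1⟩
          rw [hF3, indicator_of_mem hz]
        · have hz : z.1 ∈ Ioc (T - δ) T :=
            ⟨h'.1, not_lt.1 fun hlt => h ⟨hlt, h'.2.1, by linarith [h'.2.2.1], h'.2.2.2⟩⟩
          rw [ha4, indicator_of_mem hz, ← ENNReal.ofReal_mul (by positivity)]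
          refine ENNReal.ofReal_le_ofReal ?_
          unfold nullKer
          refine mul_le_mul_of_nonneg_right ?_ (bkt_nonneg _ _ _ _)
          refine rpow_bracket_half_le (by linarith) ?_
          have h1 : |T| ≤ |z.1| + |T - z.1| := by
            refine le_trans (le_of_eq ?_) (abs_add_le z.1 (T - z.1))
            ring_nf
          rw [abs_of_nonneg (by linarith [hz.2] : 0 ≤ T - z.1)] at h1
          linarith [hz.1, abs_nonneg z.1]
    _ ≤ (ENNReal.ofReal C * (ENNReal.ofReal (δ * M / √(S - T)) *
          ENNReal.ofReal (2 * √(S - T))) + ENNReal.ofReal (δ * (3 * C₂ * M))) +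
          ENNReal.ofReal (C₃ * (2 ^ κ * M * L) * δ) +
          ENNReal.ofReal C * (ENNReal.ofReal (2 ^ κ * M) * ENNReal.ofReal δ) := by
        have mm1 : Measurable fun z : ℝ × ℝ => a1 z.1 * ENNReal.ofReal (bkt ν γ z.1 z.2) :=
          (m1.comp measurable_fst).mul (ENNReal.measurable_ofReal.comp hbk)
        have mm2 : Measurable fun z : ℝ × ℝ =>
            a1 z.1 * ENNReal.ofReal (bkt ν γ z.1 z.2) + F2 z := mm1.add mF2
        have mm3 : Measurable fun z : ℝ × ℝ =>
            a1 z.1 * ENNReal.ofReal (bkt ν γ z.1 z.2) + F2 z + F3 z := mm2.add mF3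
        rw [lintegral_add_left mm3, lintegral_add_left mm2, lintegral_add_left mm1]
        refine add_le_add (add_le_add (add_le_add
          ((lintegral_prod_mul_bkt_le h m1).trans (le_of_eq ?_)) i2) i3)
          ((lintegral_prod_mul_bkt_le h m4).trans (le_of_eq ?_))
        · rw [ha1, lintegral_indicator_mul measurableSet_Ioo (by positivity),
            lintegral_inv_sqrt_sub_left hTS.le]
        · rw [ha4, lintegral_indicator_const_ofReal measurableSet_Ioc, Real.volume_Ioc]
          ring_nf
    _ ≤ _ := by
      simp only [← ENNReal.ofReal_mul (by positivity : 0 ≤ 2 ^ κ * M),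
        ← ENNReal.ofReal_mul (by positivity : 0 ≤ δ * M / √(S - T)),
        ← ENNReal.ofReal_mul hC.le]
      rw [← ENNReal.ofReal_add (by positivity) (by positivity),
        ← ENNReal.ofReal_add (by positivity) (by positivity),
        ← ENNReal.ofReal_add (by positivity) (by positivity)]
      refine ENNReal.ofReal_le_ofReal ?_
      have := mul_le_mul_of_nonneg_left hL
        (by positivity : 0 ≤ (C * 2 + 3 * C₂ + C * 2 ^ κ) / Real.log 2 * δ * M)
      generalize √(S - T) = X at *
      generalize (2 : ℝ) ^ κ = Q at *
      have e1 : C * (δ * M / X * (2 * X)) = C * 2 * δ * M := by field_simp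
      have e2 : (C * 2 + 3 * C₂ + C * Q) / Real.log 2 * δ * M * Real.log 2 =
        (C * 2 + 3 * C₂ + C * Q) * δ * M := by field_simp
      rw [e1]
      linarith

end

section

open MeasureTheory Set Filter Topology

variable {ι : Type*} [Fintype ι] {κ ν : ℝ} {γ : ι → ℝ}

/-- The sum of the weights attached to a finite family of null-coordinate slopes. -/
def nullSum (κ ν : ℝ) (γ : ι → ℝ) (α β : ℝ) : ℝ := ∑ j, nullKer κ ν (γ j) α β

lemma measurable_nullSum (κ ν : ℝ) (γ : ι → ℝ) :
    Measurable fun z : ℝ × ℝ => nullSum κ ν γ z.1 z.2 :=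
  Finset.measurable_sum _ fun j _ => measurable_nullKer κ ν (γ j)

lemma lintegral_mul_nullSum_le {w : ℝ × ℝ → ENNReal} (hw : Measurable w) {C : ι → ℝ}
    (hC : ∀ j, 0 < C j) {B K : ℝ} (hB : 0 ≤ B) (hK : 0 ≤ K)
    (h : ∀ j, ∫⁻ z, w z * ENNReal.ofReal (nullKer κ ν (γ j) z.1 z.2) ≤
      ENNReal.ofReal (C j * B)) :
    ∫⁻ α, ∫⁻ β, w (α, β) * ENNReal.ofReal (K * nullSum κ ν γ α β) ≤
      ENNReal.ofReal ((∑ j, C j) * (K * B)) := by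
  have m1 := measurable_nullSum κ ν γ
  have m2 : Measurable fun z : ℝ × ℝ => w z * ENNReal.ofReal (K * nullSum κ ν γ z.1 z.2) := by
    fun_prop
  have m3 : ∀ j, Measurable fun z : ℝ × ℝ =>
      w z * ENNReal.ofReal (nullKer κ ν (γ j) z.1 z.2) := fun j => by
    have := measurable_nullKer κ ν (γ j)
    fun_prop
  calc _ = ∫⁻ z, w z * ENNReal.ofReal (K * nullSum κ ν γ z.1 z.2) := by
        rw [Measure.volume_eq_prod, lintegral_prod _ m2.aemeasurable]
    _ = ENNReal.ofReal K * ∑ j, ∫⁻ z, w z * ENNReal.ofReal (nullKer κ ν (γ j) z.1 z.2) := by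
        rw [← lintegral_finsetSum _ fun j _ => m3 j,
          ← lintegral_const_mul' _ _ ENNReal.ofReal_ne_top]
        refine lintegral_congr fun z => ?_
        rw [nullSum, ENNReal.ofReal_mul hK,
          ENNReal.ofReal_sum_of_nonneg fun j _ => nullKer_nonneg _ _ _ _ _, ← Finset.mul_sum]
        ring
    _ ≤ ENNReal.ofReal K * ∑ j, ENNReal.ofReal (C j * B) := by
        gcongr with j
        exact h j
    _ = _ := by
        rw [← ENNReal.ofReal_sum_of_nonneg fun j _ => mul_nonneg (hC j).le hB,
          ← ENNReal.ofReal_mul hK, ← Finset.sum_mul]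
        ring_nf

lemma lintegral_indicator_nullSum_le {s : Set (ℝ × ℝ)} (hs : MeasurableSet s) {C : ι → ℝ}
    (hC : ∀ j, 0 < C j) {B K : ℝ} (hB : 0 ≤ B) (hK : 0 ≤ K)
    (h : ∀ j, ∫⁻ z, s.indicator (fun z => ENNReal.ofReal (nullKer κ ν (γ j) z.1 z.2)) z ≤
      ENNReal.ofReal (C j * B)) :
    ∫⁻ α, ∫⁻ β, s.indicator (fun p => ENNReal.ofReal (K * nullSum κ ν γ p.1 p.2)) (α, β) ≤
      ENNReal.ofReal ((∑ j, C j) * (K * B)) := by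
  have e : ∀ (f : ℝ × ℝ → ENNReal) z, s.indicator f z = s.indicator 1 z * f z := fun f z => by
    by_cases hz : z ∈ s <;> simp [hz]
  exact (lintegral_congr fun α => lintegral_congr fun β => e _ (α, β)).trans_le
    (lintegral_mul_nullSum_le (measurable_one.indicator hs) hC hB hK fun j =>
      (lintegral_congr fun z => (e _ z).symm).trans_le (h j))

lemma lintegral_nullDom_le_mul (hκ : 0 ≤ κ) (hν : 0 ≤ ν) (γ : ℝ) {T S : ℝ} (h : T < S) : ∫⁻ z : ℝ × ℝ, (nullDom T S).indicator
      (fun p => ENNReal.ofReal (nullKer κ ν γ p.1 p.2)) z ≤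
        ENNReal.ofReal (1 * ((1 + |T|) ^ (-κ) * ((S - T) * (T + S)))) := by
  calc _ ≤ ∫⁻ z : ℝ × ℝ, (Ioo T S ×ˢ Ioo (-S) T).indicator
        (fun _ => ENNReal.ofReal ((1 + |T|) ^ (-κ))) z := by
        refine lintegral_mono fun z => ?_
        by_cases hz : z ∈ nullDom T S
        swap
        · rw [indicator_of_notMem hz]
          positivity
        rw [indicator_of_mem hz, indicator_of_mem (show z ∈ Ioo T S ×ˢ Ioo (-S) T from
          ⟨⟨hz.1, hz.2.1⟩, by linarith [hz.2.1, hz.2.2.2], hz.2.2.1⟩)]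
        refine ENNReal.ofReal_le_ofReal ((nullKer_le_of_abs_le hκ
          ((abs_lt_of_mem_nullDom hz).le.trans (le_abs_self _))).trans ?_)
        refine mul_le_of_le_one_right (by positivity) ?_
        exact Real.rpow_le_one_of_one_le_of_nonpos (by linarith [abs_nonneg (z.2 - γ * z.1)])
          (by linarith)
    _ = _ := by
        rw [lintegral_indicator (measurableSet_Ioo.prod measurableSet_Ioo), setLIntegral_const,
          Measure.volume_eq_prod, Measure.prod_prod, Real.volume_Ioo, Real.volume_Ioo,
          ← ENNReal.ofReal_mul (by linarith), ← ENNReal.ofReal_mul (by positivity), one_mul]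
        ring_nf

variable {c : ℝ} {b : Fin 3 → E3} {G : Fn}

lemma measurable_mul_nullSum (K κ ν : ℝ) (γ : ι → ℝ) :
    Measurable (Function.uncurry fun α β => K * nullSum κ ν γ α β) :=
  (measurable_nullSum κ ν γ).const_mul K

theorem exists_kir_le (hc : 0 < c) (hκ : 1 ≤ κ) (hν : 1 < ν) (γ : ι → ℝ) :
    ∃ C > 0, ∀ (b : Fin 3 → E3) (G : Fn) (K t r : ℝ), Orthonormal ℝ b → Smooth G → 0 ≤ K →
      0 < t → 0 < r → Dominated c t (r • b 0) G (fun α β => K * nullSum κ ν γ α β) →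
      kir c b (zsum G) t (r • b 0) ≤ C * (K * (1 + |c * t - r|) ^ (-κ)) ∧
      kir c b (zsum G) t (r • b 0) ≤ C * (t * (K * (1 + |c * t - r|) ^ (-κ))) := by
  choose C hC h using fun j => exists_lintegral_nullDom_le hκ hν (γ j)
  have hC0 : 0 ≤ ∑ j, C j := Finset.sum_nonneg fun j _ => (hC j).le
  refine ⟨(∑ j, C j) / c ^ 2 + Fintype.card ι / c + 1, by positivity,
    fun b G K t r hb hG hK ht hr hd => ?_⟩
  have h0 := hd.mul_kir_le hb hG hc ht hr (measurable_mul_nullSum _ _ _ _)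
  have hT : c * t - r < c * t + r := by linarith
  set M := (1 + |c * t - r|) ^ (-κ) with hM
  have hM0 : 0 < M := by positivity
  have hKM : 0 ≤ K * M := by positivity
  have fin : ∀ {X Y : ℝ}, 0 ≤ Y → ∫⁻ α, ∫⁻ β, (nullDom (c * t - r) (c * t + r)).indicator
      (fun p => ENNReal.ofReal (K * nullSum κ ν γ p.1 p.2)) (α, β) ≤ ENNReal.ofReal X →
      1 / (4 * c ^ 2) * X = r * Y → kir c b (zsum G) t (r • b 0) ≤ Y := fun hY hX e => by
    have := h0.trans (mul_le_mul_right hX _)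
    rw [← ENNReal.ofReal_mul (by positivity), e,
      ENNReal.ofReal_le_ofReal_iff (by positivity)] at this
    exact le_of_mul_le_mul_left this hr
  constructor
  · refine (fin (Y := (∑ j, C j) * (K * M) / (2 * c ^ 2)) (by positivity)
      (lintegral_indicator_nullSum_le (measurableSet_nullDom _ _) hC
      (B := M * (c * t + r - (c * t - r))) (by positivity [hT]) hK
      fun j => h j _ _ hT) ?_).trans ?_
    · field_simp
      ring
    · have : (∑ j, C j) * (K * M) / (2 * c ^ 2) ≤ (∑ j, C j) / c ^ 2 * (K * M) := by
        rw [div_mul_eq_mul_div]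
        gcongr
        nlinarith [sq_nonneg c]
      have h2 : 0 ≤ (Fintype.card ι / c + 1) * (K * M) := by positivity
      linarith
  · refine (fin (Y := Fintype.card ι / c * (t * (K * M))) (by positivity)
      (lintegral_indicator_nullSum_le (C := fun _ => 1) (measurableSet_nullDom _ _)
      (fun _ => one_pos)
      (B := M * ((c * t + r - (c * t - r)) * (c * t - r + (c * t + r)))) ?_ hK
      fun j => lintegral_nullDom_le_mul (by linarith) (by linarith) _ hT) ?_).trans ?_
    · have : 0 < c * t := by positivity
      have h1 : 0 ≤ c * t + r - (c * t - r) := by linarith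
      have h2 : 0 ≤ c * t - r + (c * t + r) := by linarith
      positivity
    · simp only [Finset.sum_const, Finset.card_univ, nsmul_eq_mul, mul_one]
      field_simp
      ring
    · have h2 : 0 ≤ ((∑ j, C j) / c ^ 2 + 1) * (t * (K * M)) := by positivity
      linarith

theorem exists_abs_kir_sub_right_le (hc : 0 < c) (hκ : 1 ≤ κ) (hν : 1 < ν) (γ : ι → ℝ) :
    ∃ C > 0, ∀ (b : Fin 3 → E3) (G : Fn) (K t r h : ℝ), Orthonormal ℝ b → Smooth G → 0 ≤ K →
      0 ≤ h → h < t → c * h < r →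
      Dominated c t (r • b 0) G (fun α β => K * nullSum κ ν γ α β) →
      |r * kir c b G t (r • b 0) -
        (r - c * h) * kir c b G (t - h) ((r - c * h) • b 0)| ≤
          C * h * (K * (1 + |c * t - r|) ^ (-κ)) := by
  choose C hC hb using fun j => exists_lintegral_diffWt_right_le hκ hν (γ j)
  have hC0 : 0 ≤ ∑ j, C j := Finset.sum_nonneg fun j _ => (hC j).le
  refine ⟨(∑ j, C j) / c + 1, by positivity, fun b G K t r h hbo hG hK hh hht hhr hd => ?_⟩
  have hch : 0 ≤ c * h := by positivity
  have hr : 0 < r := by linarith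
  have h0 := hd.abs_sub_le (t' := t - h) (r' := r - c * h) hbo hG hc (by linarith) hr
    (by linarith) (by linarith) (by rw [sub_sub_cancel, abs_of_nonneg hch, sub_sub_cancel])
    (measurable_mul_nullSum _ _ _ _)
  rw [show c * (t - h) - (r - c * h) = c * t - r by ring,
    show c * (t - h) + (r - c * h) = c * t + r - 2 * (c * h) by ring] at h0
  set M := (1 + |c * t - r|) ^ (-κ) with hM
  have hM0 : 0 < M := by positivity
  have h1 := h0.trans (mul_le_mul_right (lintegral_mul_nullSum_le (measurable_diffWt _ _ _ _) hC
    (B := 2 * (c * h) * M) (by positivity) hK fun j => (hb j _ _ (2 * (c * h)) (by linarith)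
      (by positivity)).trans (le_of_eq (by rw [mul_assoc]))) _)
  rw [← ENNReal.ofReal_mul (by positivity), ENNReal.ofReal_le_ofReal_iff (by positivity)] at h1
  refine h1.trans ?_
  have e : 1 / (2 * c ^ 2) * ((∑ j, C j) * (K * (2 * (c * h) * M))) =
    (∑ j, C j) / c * h * (K * M) := by field_simp
  rw [e]
  gcongr
  linarith

theorem exists_abs_kir_sub_left_le (hc : 0 < c) (hκ : 1 ≤ κ) (hν : 1 < ν) {γ : ι → ℝ}
    (hγ : ∀ j, -1 < γ j) (hγ1 : ∀ j, γ j ≤ 1) :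
    ∃ C > 0, ∀ (b : Fin 3 → E3) (G : Fn) (K t r h : ℝ), Orthonormal ℝ b → Smooth G → 0 ≤ K →
      0 ≤ h → h < t → 0 < r → 4 * (c * h) ≤ 1 →
      Dominated c t (r • b 0) G (fun α β => K * nullSum κ ν γ α β) →
      |r * kir c b G t (r • b 0) -
        (r + c * h) * kir c b G (t - h) ((r + c * h) • b 0)| ≤
          C * h * (K * ((1 + |c * t - r|) ^ (-κ) * Psi (κ - 1) (4 * c * t))) := by
  choose C hC hb using fun j => exists_lintegral_diffWt_left_le hκ hν (hγ j) (hγ1 j)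
  have hC0 : 0 ≤ ∑ j, C j := Finset.sum_nonneg fun j _ => (hC j).le
  refine ⟨(∑ j, C j) / c + 1, by positivity, fun b G K t r h hbo hG hK hh hht hr hh1 hd => ?_⟩
  have hch : 0 ≤ c * h := by positivity
  have ht : 0 < t := by linarith
  have h0 := hd.abs_sub_le (t' := t - h) (r' := r + c * h) hbo hG hc (by linarith) hr
    (by linarith) (by linarith)
    (by rw [sub_add_cancel_left, abs_neg, abs_of_nonneg hch, sub_sub_cancel])
    (measurable_mul_nullSum _ _ _ _)
  rw [show c * (t - h) - (r + c * h) = c * t - r - 2 * (c * h) by ring,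
    show c * (t - h) + (r + c * h) = c * t + r by ring] at h0
  have hk : 0 ≤ 4 * c * t := by positivity
  set M := (1 + |c * t - r|) ^ (-κ) * Psi (κ - 1) (4 * c * t) with hM
  have hM0 : 0 < M := mul_pos (by positivity) (Psi_pos hk)
  have h1 := h0.trans (mul_le_mul_right (lintegral_mul_nullSum_le (measurable_diffWt _ _ _ _) hC
    (B := 2 * (c * h) * M) (by positivity) hK fun j => (hb j _ _ (2 * (c * h)) (4 * c * t)
      (by linarith) (by positivity) (by linarith) hk ?_).trans
        (le_of_eq (by rw [mul_assoc]))) _)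
  · rw [← ENNReal.ofReal_mul (by positivity), ENNReal.ofReal_le_ofReal_iff (by positivity)] at h1
    refine h1.trans ?_
    have e : 1 / (2 * c ^ 2) * ((∑ j, C j) * (K * (2 * (c * h) * M))) =
      (∑ j, C j) / c * h * (K * M) := by field_simp
    rw [e]
    gcongr
    linarith
  · nlinarith [neg_abs_le (c * t - r), abs_nonneg (c * t - r), mul_nonneg hk (abs_nonneg (c * t - r))]

end

section

open MeasureTheory Set Filter Topology

lemma abs_deriv_le_of_forall_lt {f : ℝ → ℝ} {f' B δ : ℝ} (hδ : 0 < δ)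
    (h : ∀ x, 0 < x → x < δ → |f 0 - f x| ≤ B * x) (hd : HasDerivAt f f' 0) : |f'| ≤ B := by
  have ht := (hasDerivWithinAt_iff_tendsto_slope' (s := Ioi 0) (by simp)).1 hd.hasDerivWithinAt
  refine le_of_tendsto ht.abs ?_
  filter_upwards [Ioo_mem_nhdsGT hδ] with x hx
  rw [slope_def_field, sub_zero, abs_div, abs_of_pos hx.1, div_le_iff₀ hx.1, abs_sub_comm]
  exact h x hx.1 hx.2

lemma abs_apply_le_sum_frame {b : Fin 3 → E3} (hb : Orthonormal ℝ b) (L : E3 →L[ℝ] ℝ) {v : E3}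
    (hv : ‖v‖ ≤ 1) : |L v| ≤ |L (b 0)| + |L (b 1)| + |L (b 2)| := by
  obtain ⟨w, rfl⟩ : ∃ w : OrthonormalBasis (Fin 3) ℝ E3, ⇑w = b :=
    ⟨(basisOfOrthonormalOfCardEqFinrank hb (by simp)).toOrthonormalBasis (by
      simpa using hb), by simp⟩
  conv_lhs => rw [← w.sum_repr' v]
  rw [Fin.sum_univ_three, map_add, map_add, map_smul, map_smul, map_smul]
  simp only [smul_eq_mul]
  have h : ∀ i, |inner ℝ (w i) v * L (w i)| ≤ |L (w i)| := fun i => by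
    rw [abs_mul]
    refine mul_le_of_le_one_left (abs_nonneg _) ((abs_real_inner_le_norm _ _).trans ?_)
    rw [w.orthonormal.1 i, one_mul]
    exact hv
  exact (abs_add_three _ _ _).trans (add_le_add (add_le_add (h 0) (h 1)) (h 2))

lemma hasDerivAt_characteristic {u : Fn} (hu : Smooth u) (t r σ : ℝ) (e : E3) :
    HasDerivAt (fun h => (r + σ * h) * u (t - h) ((r + σ * h) • e))
      (σ * u t (r • e) + r * (σ * fderiv ℝ (u t) (r • e) e - pt u t (r • e))) 0 := by
  have d1 : HasDerivAt (fun h : ℝ => r + σ * h) σ 0 := by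
    simpa using ((hasDerivAt_id (0 : ℝ)).const_mul σ).const_add r
  have d2 : HasDerivAt (fun h : ℝ => t - h) (-1) 0 := by
    simpa using (hasDerivAt_id (0 : ℝ)).const_sub t
  have d3 : HasDerivAt (fun h : ℝ => (t - h, (r + σ * h) • e)) (-1, σ • e) 0 :=
    d2.prodMk (d1.smul_const e)
  have d4 : HasFDerivAt (unc u) (fderiv ℝ (unc u) (t - 0, (r + σ * 0) • e))
      (t - 0, (r + σ * 0) • e) := hu.hasFDerivAt _
  have d5 := d1.mul (d4.comp_hasDerivAt (0 : ℝ) d3)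
  refine d5.congr_deriv ?_
  rw [fderiv_unc_apply hu]
  simp only [unc, mul_zero, add_zero, sub_zero, map_smul, smul_eq_mul, Function.comp_apply]
  ring

variable {ι : Type*} [Fintype ι] {κ ν c : ℝ} {γ : ι → ℝ}

theorem exists_abs_characteristic_le (hc : 0 < c) (hκ : 1 ≤ κ) (hν : 1 < ν)
    (hγ : ∀ j, -1 < γ j) (hγ1 : ∀ j, γ j ≤ 1) :
    ∃ C > 0, ∀ (b : Fin 3 → E3) (G u : Fn) (K t r : ℝ), Orthonormal ℝ b → Smooth G →
      IsWaveSol c G u → 0 ≤ K → 0 < t → 0 < r →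
      Dominated c t (r • b 0) G (fun α β => K * nullSum κ ν γ α β) →
      r * |pt u t (r • b 0) + c * fderiv ℝ (u t) (r • b 0) (b 0)| ≤
        c * |u t (r • b 0)| + C * (K * (1 + |c * t - r|) ^ (-κ)) ∧
      r * |pt u t (r • b 0) - c * fderiv ℝ (u t) (r • b 0) (b 0)| ≤
        c * |u t (r • b 0)| + C * (K * ((1 + |c * t - r|) ^ (-κ) * Psi (κ - 1) (4 * c * t))) := by
  obtain ⟨C₁, hC₁, h₁⟩ := exists_abs_kir_sub_right_le hc hκ hν γ
  obtain ⟨C₂, hC₂, h₂⟩ := exists_abs_kir_sub_left_le hc hκ hν hγ hγ1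
  refine ⟨C₁ + C₂, by positivity, fun b G u K t r hb hG hu hK ht hr hd => ?_⟩
  have hΨ : 0 < Psi (κ - 1) (4 * c * t) := Psi_pos (by positivity)
  set U := u t (r • b 0) with hU
  set D := fderiv ℝ (u t) (r • b 0) (b 0) with hD
  set M := (1 + |c * t - r|) ^ (-κ) with hM
  have hM0 : 0 < M := by positivity
  have tri : ∀ {x y B : ℝ}, |x + y| ≤ B → |x| = c * |U| → |y| ≤ c * |U| + B := by
    intro x y B h e
    have := abs_sub (x + y) x
    rw [add_sub_cancel_left, e] at this
    linarith
  have eU : |c * U| = c * |U| := by rw [abs_mul, abs_of_pos hc]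
  constructor
  · have := abs_deriv_le_of_forall_lt (δ := min t (r / c)) (by positivity) (fun h h0 hlt => ?_)
      (hasDerivAt_characteristic hu.1 t r (-c) (b 0)) (B := C₁ * (K * M))
    · have := tri this (by rw [neg_mul, abs_neg, eU])
      rw [show r * (-c * D - pt u t (r • b 0)) = -(r * (pt u t (r • b 0) + c * D)) by ring, abs_neg,
        abs_mul, abs_of_pos hr] at this
      have h3 : 0 ≤ C₂ * (K * M) := by positivity
      linarith
    · have hht : h < t := hlt.trans_le (min_le_left _ _)
      have hhr : c * h < r := (lt_div_iff₀' hc).1 (hlt.trans_le (min_le_right _ _))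
      have := h₁ b G K t r h hb hG hK h0.le hht hhr hd
      rw [← hu.eq_kir hc hb ht.le, ← hu.eq_kir hc hb (by linarith)] at this
      simp only [mul_zero, add_zero, sub_zero, neg_mul, ← sub_eq_add_neg]
      linarith
  · have := abs_deriv_le_of_forall_lt (δ := min t (1 / (4 * c))) (by positivity) (fun h h0 hlt => ?_)
      (hasDerivAt_characteristic hu.1 t r c (b 0)) (B := C₂ * (K * (M * Psi (κ - 1) (4 * c * t))))
    · have := tri this eU
      rw [show r * (c * D - pt u t (r • b 0)) = -(r * (pt u t (r • b 0) - c * D)) by ring, abs_neg,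
        abs_mul, abs_of_pos hr] at this
      have h3 : 0 ≤ C₁ * (K * (M * Psi (κ - 1) (4 * c * t))) := by positivity
      linarith
    · have hht : h < t := hlt.trans_le (min_le_left _ _)
      have hhr : 4 * c * h < 1 :=
        (lt_div_iff₀' (by positivity)).1 (hlt.trans_le (min_le_right _ _))
      have := h₂ b G K t r h hb hG hK h0.le hht hr (by linarith) hd
      rw [← hu.eq_kir hc hb ht.le, ← hu.eq_kir hc hb (by linarith)] at this
      simp only [mul_zero, add_zero, sub_zero]
      linarith

lemma orthonormal_swap {b : Fin 3 → E3} (hb : Orthonormal ℝ b) :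
    Orthonormal ℝ (b ∘ Equiv.swap 1 2) := hb.comp _ (Equiv.injective _)

/-- Pointwise decay of the gradient when the source is dominated by the null weights. -/
theorem exists_gradient_le (hc : 0 < c) (hκ : 1 ≤ κ) (hν : 1 < ν)
    (hγ : ∀ j, -1 < γ j) (hγ1 : ∀ j, γ j ≤ 1) :
    ∃ C > 0, ∀ (b : Fin 3 → E3) (G u : Fn) (K t r : ℝ), Orthonormal ℝ b → Smooth G →
      IsWaveSol c G u → 0 ≤ K → 0 < t → 0 < r →
      Dominated c t (r • b 0) G (fun α β => K * nullSum κ ν γ α β) →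
      (1 + r) * |pt u t (r • b 0)| ≤
        C * (K * ((1 + |c * t - r|) ^ (-κ) * Psi (κ - 1) (4 * c * t))) ∧
      ∀ v : E3, ‖v‖ ≤ 1 → (1 + r) * |fderiv ℝ (u t) (r • b 0) v| ≤
        C * (K * ((1 + |c * t - r|) ^ (-κ) * Psi (κ - 1) (4 * c * t))) := by
  obtain ⟨C₁, hC₁, h₁⟩ := exists_kir_le hc hκ hν γ
  obtain ⟨C₂, hC₂, h₂⟩ := exists_abs_characteristic_le hc hκ hν hγ hγ1
  have hlog := Real.log_pos one_lt_two
  refine ⟨2 * ((3 + c + 1 / c + 4) * C₁ / Real.log 2 + (1 + 1 / c) * (C₂ / Real.log 2 + C₂)),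
    by positivity, fun b G u K t r hb hG hu hK ht hr hd => ?_⟩
  obtain ⟨k1, k2⟩ := h₁ b G K t r hb hG hK ht hr hd
  obtain ⟨d1, d2⟩ := h₂ b G u K t r hb hG hu hK ht hr hd
  have hb' := orthonormal_swap hb
  have k3 := (h₁ (b ∘ Equiv.swap 1 2) G K t r hb' hG hK ht hr hd).1
  have s0 := abs_sol_le hc hb hG hu ht.le (r • b 0)
  have s1 := abs_pt_sol_le hc hb hG hu ht (r • b 0)
  have s2 := fun v hv => abs_fderiv_sol_le hc hb hG hu ht.le (r • b 0) v hv
  have s3 := abs_rot_sol_le hc hb hG hu ht.le hr.le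
  have s4 := abs_rot_sol_le hc hb' hG hu ht.le hr.le
  have e0 : (b ∘ Equiv.swap 1 2) 0 = b 0 := rfl
  have e1 : (b ∘ Equiv.swap 1 2) 1 = b 2 := by simp
  rw [e0, e1] at s4
  rw [e0] at k3
  have hΨ := log_two_le_Psi (ρ := κ - 1) (k := 4 * c * t) (by positivity)
  set L := Psi (κ - 1) (4 * c * t)
  set M := (1 + |c * t - r|) ^ (-κ) with hM
  have hM0 : 0 < M := by positivity
  set P := K * M with hP
  have hP0 : 0 ≤ P := by positivity
  have hPL : P * Real.log 2 ≤ P * L := by gcongr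
  have eKM : K * (M * L) = P * L := (mul_assoc _ _ _).symm
  rw [eKM] at d2 ⊢
  set kk := kir c b (zsum G) t (r • b 0)
  set U := |u t (r • b 0)|
  set D := fderiv ℝ (u t) (r • b 0) (b 0)
  have hPQ : P ≤ P * L / Real.log 2 := (le_div_iff₀ hlog).2 hPL
  set Y := P * L
  have hY0 : 0 ≤ Y := by
    have := Psi_pos (ρ := κ - 1) (k := 4 * c * t) (by positivity)
    positivity
  set R := C₁ * (Y / Real.log 2) with hR
  set E := C₂ * (Y / Real.log 2) + C₂ * Y with hE
  have hR0 : 0 ≤ R := by positivity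
  have hE0 : 0 ≤ E := by positivity
  have hRP : C₁ * P ≤ R := mul_le_mul_of_nonneg_left hPQ hC₁.le
  have hEP : C₂ * P ≤ C₂ * (Y / Real.log 2) := mul_le_mul_of_nonneg_left hPQ hC₂.le
  have hEY : 0 ≤ C₂ * (Y / Real.log 2) := by positivity
  have hCY : 0 ≤ C₂ * Y := by positivity
  have target : 2 * ((3 + c + 1 / c + 4) * C₁ / Real.log 2 +
      (1 + 1 / c) * (C₂ / Real.log 2 + C₂)) * Y =
      2 * ((7 + c) * R + R / c + E + E / c) := by
    rw [hR, hE]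
    ring
  have hRc : 0 ≤ R / c := by positivity
  have hEc : 0 ≤ E / c := by positivity
  have hcR : 0 ≤ c * R := by positivity
  have hU : c * U ≤ c * R := by gcongr; linarith
  rw [target]
  have small : r ≤ 1 → ∀ {y B : ℝ}, 0 ≤ y → y ≤ B → (1 + r) * y ≤ 2 * B := fun h y B h0 hB =>
    mul_le_mul (by linarith) hB h0 two_pos.le
  have large : 1 ≤ r → ∀ {y B : ℝ}, 0 ≤ y → r * y ≤ B → (1 + r) * y ≤ 2 * B :=
    fun h y B h0 hB => by nlinarith
  constructor
  · rcases le_total r 1 with h | h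
    · refine small h (abs_nonneg _) (s1.trans ?_)
      have h1 : 2 / t * U ≤ 2 * R := by
        rw [div_mul_eq_mul_div, div_le_iff₀ ht]
        have := mul_le_mul_of_nonneg_left hRP ht.le
        linarith
      have h2 : (1 + c) * kk ≤ (1 + c) * R := by gcongr; linarith
      linarith
    · refine large h (abs_nonneg _) ?_
      have h1 : 2 * |pt u t (r • b 0)| ≤ |pt u t (r • b 0) + c * D| +
          |pt u t (r • b 0) - c * D| := by
        have := abs_add_le (pt u t (r • b 0) + c * D) (pt u t (r • b 0) - c * D)
        rwa [add_add_sub_cancel, ← two_mul, abs_mul, abs_two] at this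
      have h2 := mul_le_mul_of_nonneg_left h1 hr.le
      linarith
  · intro v hv
    rcases le_total r 1 with h | h
    · exact small h (abs_nonneg _) (by linarith [s2 v hv])
    · refine large h (abs_nonneg _) ?_
      have h0 : r * |D| ≤ R + E / c := by
        have h1 : 2 * (c * |D|) ≤ |pt u t (r • b 0) + c * D| +
            |pt u t (r • b 0) - c * D| := by
          have := abs_sub (pt u t (r • b 0) + c * D) (pt u t (r • b 0) - c * D)
          rwa [add_sub_sub_cancel, ← two_mul, abs_mul, abs_two, abs_mul, abs_of_pos hc] at this
        have h2 := mul_le_mul_of_nonneg_left h1 hr.le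
        have h3 : c * (r * |D|) ≤ c * (R + E / c) := by
          rw [mul_add, mul_div_cancel₀ _ hc.ne']
          linarith
        exact le_of_mul_le_mul_left h3 hc
      have h1 := mul_le_mul_of_nonneg_left
        (abs_apply_le_sum_frame hb (fderiv ℝ (u t) (r • b 0)) hv) hr.le
      linarith

end

section

open MeasureTheory Set Filter Topology

lemma one_le_jb (a : ℝ) : 1 ≤ jb a := Real.one_le_sqrt.2 (by linarith [sq_nonneg a])

lemma jb_pos (a : ℝ) : 0 < jb a := one_pos.trans_le (one_le_jb a)

lemma continuous_jb : Continuous jb := by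
  unfold jb
  fun_prop

lemma jb_le (a : ℝ) : jb a ≤ 1 + |a| := by
  rw [jb, Real.sqrt_le_left (by positivity)]
  nlinarith [sq_abs a, abs_nonneg a]

lemma one_add_abs_le (a : ℝ) : 1 + |a| ≤ 2 * jb a := by
  have h := Real.abs_le_sqrt (show a ^ 2 ≤ 1 + a ^ 2 by linarith)
  have := one_le_jb a
  unfold jb at *
  linarith

lemma Smooth.rotA_smooth {f : Fn} (hf : Smooth f) (j k : Fin 3) : Smooth (rotA j k f) := by
  have h1 := hf.pd j
  have h2 := hf.pd k
  unfold Smooth at *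
  have h3 : ∀ i : Fin 3, ContDiff ℝ (⊤ : ℕ∞) fun p : ℝ × E3 => p.2 i := fun i => by fun_prop
  exact ((h3 j).mul h2).sub ((h3 k).mul h1)

lemma Smooth.zop {f : Fn} (hf : Smooth f) (i : Fin 7) : Smooth (Zop i f) := by
  fin_cases i
  exacts [hf.pt, hf.pd 0, hf.pd 1, hf.pd 2, hf.rotA_smooth 0 1, hf.rotA_smooth 0 2,
    hf.rotA_smooth 1 2]

lemma Smooth.iterate_zop (i : Fin 7) (n : ℕ) : ∀ {f : Fn}, Smooth f → Smooth ((Zop i)^[n] f) := by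
  induction n with
  | zero => exact id
  | succ n ih => exact fun hf => ih (hf.zop i)

lemma Smooth.zpow {f : Fn} (hf : Smooth f) (α : Fin 7 → ℕ) : Smooth (Zpow α f) := by
  unfold Zpow
  iterate 7 apply Smooth.iterate_zop
  exact hf

lemma continuous_vnorm (s : ℕ) {f : Fn} (hf : Smooth f) :
    Continuous fun p : ℝ × E3 => vnorm s f p.1 p.2 :=
  continuous_finsetSum _ fun α _ => (ContDiff.continuous (hf.zpow α)).abs

lemma vnorm_nonneg (s : ℕ) (f : Fn) (t : ℝ) (x : E3) : 0 ≤ vnorm s f t x :=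
  Finset.sum_nonneg fun _ _ => abs_nonneg _

variable {N : ℕ} {cs : Fin N → ℝ}

lemma wgt_pos (cs : Fin N → ℝ) (t r : ℝ) : 0 < wgt cs t r :=
  (Finset.lt_inf'_iff _).2 fun _ _ => jb_pos _

lemma exists_wgt_eq (cs : Fin N → ℝ) (t r : ℝ) : ∃ j, wgt cs t r = jb (cs0 cs j * t - r) := by
  obtain ⟨j, -, hj⟩ := Finset.exists_mem_eq_inf' (Finset.univ_nonempty (α := Fin (N + 1)))
    fun j => jb (cs0 cs j * t - r)
  exact ⟨j, hj⟩

lemma continuous_wgt (cs : Fin N → ℝ) : Continuous fun p : ℝ × E3 => wgt cs p.1 ‖p.2‖ := by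
  unfold wgt
  refine Continuous.finset_inf'_apply _ fun j _ => continuous_jb.comp ?_
  fun_prop

variable {c κ μ : ℝ} {G : Fn}

lemma continuous_Afun_integrand (hκ : 0 ≤ κ) (hμ : 0 ≤ μ) (hG : Smooth G) (cs : Fin N → ℝ)
    (s : ℕ) : Continuous fun p : ℝ × E3 =>
      ‖p.2‖ * jb (p.1 + ‖p.2‖) ^ κ * wgt cs p.1 ‖p.2‖ ^ (1 + μ) * vnorm s G p.1 p.2 := by
  have h1 := continuous_wgt cs
  have h2 := continuous_vnorm s hG
  have h3 := continuous_jb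
  exact ((continuous_snd.norm.mul ((h3.comp (by fun_prop)).rpow_const fun _ => Or.inr hκ)).mul
    (h1.rpow_const fun _ => Or.inr (by linarith))).mul h2

/-- The values whose supremum defines `Afun`. -/
def coneValues (κ μ : ℝ) (s : ℕ) (G : Fn) (c : ℝ) (cs : Fin N → ℝ) (t : ℝ) (x : E3) : Set ℝ :=
  {a : ℝ | ∃ τ : ℝ, ∃ y : E3, 0 ≤ τ ∧ τ ≤ t ∧ ‖y - x‖ ≤ c * (t - τ) ∧
    a = ‖y‖ * jb (τ + ‖y‖) ^ κ * wgt cs τ ‖y‖ ^ (1 + μ) * vnorm s G τ y}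

lemma bddAbove_coneValues (hc : 0 ≤ c) (hκ : 0 ≤ κ) (hμ : 0 ≤ μ) (hG : Smooth G)
    (cs : Fin N → ℝ) (s : ℕ) (t : ℝ) (x : E3) : BddAbove (coneValues κ μ s G c cs t x) := by
  refine (((isCompact_Icc (a := 0) (b := t)).prod (isCompact_closedBall x (c * t))).bddAbove_image
    (continuous_Afun_integrand hκ hμ hG cs s).continuousOn).mono ?_
  rintro a ⟨τ, y, h0, hτ, hy, rfl⟩
  refine ⟨(τ, y), ⟨⟨h0, hτ⟩, ?_⟩, rfl⟩
  rw [mem_closedBall_iff_norm]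
  nlinarith

lemma Afun_nonneg (κ μ : ℝ) (s : ℕ) (G : Fn) (c : ℝ) (cs : Fin N → ℝ) (t : ℝ) (x : E3) :
    0 ≤ Afun κ μ s G c cs t x := by
  refine Real.sSup_nonneg ?_
  rintro a ⟨τ, y, -, -, -, rfl⟩
  have h1 := jb_pos (τ + ‖y‖)
  have h2 := wgt_pos cs τ ‖y‖
  have h3 := vnorm_nonneg s G τ y
  positivity

lemma Afun_mono (hc : 0 ≤ c) (hκ : 0 ≤ κ) (hμ : 0 ≤ μ) (hG : Smooth G) (cs : Fin N → ℝ) (s : ℕ)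
    {t t' : ℝ} {x x' : E3} (ht' : 0 ≤ t') (ht : t' ≤ t) (hx : ‖x' - x‖ ≤ c * (t - t')) :
    Afun κ μ s G c cs t' x' ≤ Afun κ μ s G c cs t x := by
  refine csSup_le_csSup (bddAbove_coneValues hc hκ hμ hG cs s t x)
    ⟨_, t', x', ht', le_rfl, by simp, rfl⟩ ?_
  rintro a ⟨τ, y, h0, hτ, hy, rfl⟩
  refine ⟨τ, y, h0, hτ.trans ht, ?_, rfl⟩
  have := norm_sub_le_norm_sub_add_norm_sub y x' x
  linarith

lemma cs0_nonneg (hcs : ∀ j, 0 < cs j) (j : Fin (N + 1)) : 0 ≤ cs0 cs j := by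
  refine Fin.cases ?_ (fun i => ?_) j
  · exact le_rfl
  · exact (hcs i).le

/-- The slope, in null coordinates of speed `c`, of the light cone of speed `cs0 cs j`. -/
def slope0 (c : ℝ) (cs : Fin N → ℝ) (j : Fin (N + 1)) : ℝ := (c - cs0 cs j) / (c + cs0 cs j)

lemma neg_one_lt_slope0 (hc : 0 < c) (hcs : ∀ j, 0 < cs j) (j : Fin (N + 1)) :
    -1 < slope0 c cs j := by
  have := cs0_nonneg hcs j
  rw [slope0, lt_div_iff₀ (by linarith)]
  linarith

lemma slope0_le_one (hc : 0 < c) (hcs : ∀ j, 0 < cs j) (j : Fin (N + 1)) :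
    slope0 c cs j ≤ 1 := by
  have := cs0_nonneg hcs j
  rw [slope0, div_le_iff₀ (by linarith)]
  linarith

lemma rpow_neg_le_mul {a b L p : ℝ} (ha : 0 < a) (hb : 0 < b) (hL : 0 < L) (hp : 0 ≤ p)
    (h : a ≤ L * b) : b ^ (-p) ≤ L ^ p * a ^ (-p) := by
  have := Real.rpow_le_rpow_of_nonpos ha h (neg_nonpos.2 hp)
  rwa [Real.mul_rpow hL.le hb.le, Real.rpow_neg hL.le, inv_mul_le_iff₀ (by positivity)] at this

theorem dominated_Afun (hc : 0 < c) (hκ : 0 ≤ κ) (hμ : 0 ≤ μ) (hcs : ∀ j, 0 < cs j)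
    (hG : Smooth G) (t : ℝ) (x : E3) :
    Dominated c t x G fun α β => (2 * (1 + c)) ^ κ * 4 ^ (1 + μ) * Afun κ μ 1 G c cs t x *
      nullSum κ (1 + μ) (slope0 c cs) α β := by
  intro s y hs hst hy
  obtain ⟨j, hj⟩ := exists_wgt_eq cs s ‖y‖
  have hcj := cs0_nonneg hcs j
  have hA : ‖y‖ * jb (s + ‖y‖) ^ κ * wgt cs s ‖y‖ ^ (1 + μ) * vnorm 1 G s y ≤
      Afun κ μ 1 G c cs t x :=
    le_csSup (bddAbove_coneValues hc.le hκ hμ hG cs 1 t x) ⟨s, y, hs.le, hst, hy, rfl⟩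
  have hA0 := Afun_nonneg κ μ 1 G c cs t x
  set A := Afun κ μ 1 G c cs t x
  have hj1 := jb_pos (s + ‖y‖)
  have hw := wgt_pos cs s ‖y‖
  have h1 : jb (s + ‖y‖) ^ (-κ) ≤ (2 * (1 + c)) ^ κ * (1 + |c * s + ‖y‖|) ^ (-κ) := by
    refine rpow_neg_le_mul (by positivity) hj1 (by positivity) hκ ?_
    have := one_add_abs_le (s + ‖y‖)
    have hy0 := norm_nonneg y
    rw [abs_of_nonneg (by positivity)] at this ⊢
    have := mul_le_mul_of_nonneg_left this (by linarith : 0 ≤ 1 + c)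
    have h3 : 0 ≤ c * ‖y‖ := by positivity
    linarith
  have h2 : wgt cs s ‖y‖ ^ (-(1 + μ)) ≤ 4 ^ (1 + μ) *
      bkt (1 + μ) (slope0 c cs j) (c * s + ‖y‖) (c * s - ‖y‖) := by
    unfold bkt
    refine rpow_neg_le_mul (by positivity) hw (by norm_num) (by linarith) ?_
    have e : c * s - ‖y‖ - slope0 c cs j * (c * s + ‖y‖) =
        2 * (c / (c + cs0 cs j)) * (cs0 cs j * s - ‖y‖) := by
      have : c + cs0 cs j ≠ 0 := by positivity
      unfold slope0
      field_simp
      ring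
    have h3 : c / (c + cs0 cs j) ≤ 1 := (div_le_one (by positivity)).2 (by linarith)
    rw [hj, e, abs_mul, abs_of_nonneg (by positivity)]
    have h4 := one_add_abs_le (cs0 cs j * s - ‖y‖)
    have h5 := mul_le_mul_of_nonneg_right h3 (abs_nonneg (cs0 cs j * s - ‖y‖))
    linarith
  calc ‖y‖ * zsum G s y ≤ ‖y‖ * vnorm 1 G s y := by
        gcongr
        exact zsum_le_vnorm G s y
    _ = ‖y‖ * jb (s + ‖y‖) ^ κ * wgt cs s ‖y‖ ^ (1 + μ) * vnorm 1 G s y *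
        (jb (s + ‖y‖) ^ (-κ) * wgt cs s ‖y‖ ^ (-(1 + μ))) := by
        rw [Real.rpow_neg hj1.le, Real.rpow_neg hw.le]
        have e1 : jb (s + ‖y‖) ^ κ ≠ 0 := by positivity
        have e2 : wgt cs s ‖y‖ ^ (1 + μ) ≠ 0 := by positivity
        field_simp
    _ ≤ A * (((2 * (1 + c)) ^ κ * (1 + |c * s + ‖y‖|) ^ (-κ)) *
        (4 ^ (1 + μ) * bkt (1 + μ) (slope0 c cs j) (c * s + ‖y‖) (c * s - ‖y‖))) := by
        gcongr
    _ = (2 * (1 + c)) ^ κ * 4 ^ (1 + μ) * A *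
        nullKer κ (1 + μ) (slope0 c cs j) (c * s + ‖y‖) (c * s - ‖y‖) := by
        unfold nullKer
        ring
    _ ≤ _ := by
        refine mul_le_mul_of_nonneg_left ?_ (by positivity)
        exact Finset.single_le_sum (f := fun j => nullKer κ (1 + μ) (slope0 c cs j)
          (c * s + ‖y‖) (c * s - ‖y‖)) (fun _ _ => nullKer_nonneg _ _ _ _ _) (Finset.mem_univ j)

lemma Psi_le_mul_Psi (ρ : ℝ) (hc : 0 < c) {t : ℝ} (ht : 0 ≤ t) :
    Psi ρ (4 * c * t) ≤ (1 + Real.log (1 + 4 * c) / Real.log 2) * Psi ρ t := by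
  have hlog := Real.log_pos one_lt_two
  have h1 : 0 ≤ Real.log (1 + 4 * c) := Real.log_nonneg (by linarith)
  have h2 := log_two_le_Psi (ρ := ρ) ht
  have h3 : 0 ≤ Real.log (1 + 4 * c) / Real.log 2 := by positivity
  unfold Psi at *
  split_ifs at h2 ⊢ with h
  · have h4 : Real.log (2 + 4 * c * t) ≤ Real.log (1 + 4 * c) + Real.log (2 + t) := by
      rw [← Real.log_mul (by positivity) (by positivity)]
      refine Real.log_le_log (by positivity) ?_
      nlinarith
    have h5 : Real.log (1 + 4 * c) ≤ Real.log (1 + 4 * c) / Real.log 2 * Real.log (2 + t) := by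
      rw [div_mul_eq_mul_div, le_div_iff₀ hlog]
      gcongr
    linarith
  · linarith

lemma Psi_mono (ρ : ℝ) {s t : ℝ} (hs : 0 ≤ s) (h : s ≤ t) : Psi ρ s ≤ Psi ρ t := by
  unfold Psi
  split_ifs
  · exact Real.log_le_log (by linarith) (by linarith)
  · exact le_rfl

end

section

open MeasureTheory Set Filter Topology

variable {N : ℕ} {cs : Fin N → ℝ} {c κ μ : ℝ}

theorem exists_pda_le_of_pos (hc : 0 < c) (hcs : ∀ j, 0 < cs j) (hκ : 1 ≤ κ) (hμ : 0 < μ) :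
    ∃ C > 0, ∀ G u : Fn, Smooth G → IsWaveSol c G u → ∀ (t : ℝ) (x : E3), 0 < t → x ≠ 0 →
      ∀ a : Fin 4, jb ‖x‖ * jb (c * t - ‖x‖) ^ κ * |pda a u t x| ≤
        C * Afun κ μ 1 G c cs t x * Psi (κ - 1) t := by
  obtain ⟨C, hC, h⟩ := exists_gradient_le hc hκ (by linarith : 1 < 1 + μ)
    (neg_one_lt_slope0 hc hcs) (slope0_le_one hc hcs)
  have hL : 0 ≤ Real.log (1 + 4 * c) := Real.log_nonneg (by linarith)
  have hlog := Real.log_pos one_lt_two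
  refine ⟨C * ((2 * (1 + c)) ^ κ * 4 ^ (1 + μ)) * (1 + Real.log (1 + 4 * c) / Real.log 2),
    by positivity, fun G u hG hu t x ht hx a => ?_⟩
  have hr : 0 < ‖x‖ := norm_pos_iff.2 hx
  obtain ⟨b, hb, hb0⟩ := exists_orthonormal_zero_eq (e := ‖x‖⁻¹ • x)
    (by rw [norm_smul, norm_inv, norm_norm, inv_mul_cancel₀ hr.ne'])
  have hxb : ‖x‖ • b 0 = x := by rw [hb0, smul_inv_smul₀ hr.ne']
  have hA0 := Afun_nonneg κ μ 1 G c cs t x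
  have hd := dominated_Afun (κ := κ) hc (by linarith) hμ.le hcs hG t x
  set A := Afun κ μ 1 G c cs t x
  obtain ⟨h1, h2⟩ := h b G u ((2 * (1 + c)) ^ κ * 4 ^ (1 + μ) * A) t ‖x‖ hb hG hu
    (by positivity) ht hr (by rwa [hxb])
  rw [hxb] at h1 h2
  have hΨ := Psi_le_mul_Psi (κ - 1) hc ht.le
  set Ψ := Psi (κ - 1) (4 * c * t)
  set V := 1 + |c * t - ‖x‖| with hV
  have hV0 : 0 < V := by positivity
  have key : (1 + ‖x‖) * |pda a u t x| ≤
      C * ((2 * (1 + c)) ^ κ * 4 ^ (1 + μ) * A * (V ^ (-κ) * Ψ)) := by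
    refine Fin.cases h1 (fun j => ?_) a
    exact h2 (EuclideanSpace.single j 1) (by simp)
  have hj := jb_le ‖x‖
  rw [abs_norm] at hj
  calc _ ≤ (1 + ‖x‖) * V ^ κ * |pda a u t x| := by
        have := jb_le (c * t - ‖x‖)
        have h3 := jb_pos (c * t - ‖x‖)
        gcongr
    _ = V ^ κ * ((1 + ‖x‖) * |pda a u t x|) := by ring
    _ ≤ V ^ κ * (C * ((2 * (1 + c)) ^ κ * 4 ^ (1 + μ) * A * (V ^ (-κ) * Ψ))) := by gcongr
    _ = C * ((2 * (1 + c)) ^ κ * 4 ^ (1 + μ)) * A * Ψ := by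
        rw [Real.rpow_neg hV0.le]
        have : V ^ κ ≠ 0 := by positivity
        field_simp
    _ ≤ C * ((2 * (1 + c)) ^ κ * 4 ^ (1 + μ)) * A *
        ((1 + Real.log (1 + 4 * c) / Real.log 2) * Psi (κ - 1) t) := by gcongr
    _ = _ := by ring

lemma Smooth.continuous_pda {u : Fn} (hu : Smooth u) (a : Fin 4) :
    Continuous fun p : ℝ × E3 => pda a u p.1 p.2 := by
  refine Fin.cases ?_ (fun j => ?_) a
  · exact hu.pt.continuous
  · exact (hu.pd j).continuous

lemma IsWaveSol.pda_zero {G u : Fn} (hu : IsWaveSol c G u) (a : Fin 4) (x : E3) :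
    pda a u 0 x = 0 := by
  refine Fin.cases (hu.2.2.2 x) (fun j => ?_) a
  change fderiv ℝ (u 0) x _ = 0
  rw [show u 0 = fun _ => 0 from funext hu.2.2.1]
  simp

theorem exists_pda_le (hc : 0 < c) (hcs : ∀ j, 0 < cs j) (hκ : 1 ≤ κ) (hμ : 0 < μ) :
    ∃ C > 0, ∀ G u : Fn, Smooth G → IsWaveSol c G u → ∀ (t : ℝ) (x : E3), 0 ≤ t →
      ∀ a : Fin 4, jb ‖x‖ * jb (c * t - ‖x‖) ^ κ * |pda a u t x| ≤
        C * Afun κ μ 1 G c cs t x * Psi (κ - 1) t := by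
  obtain ⟨C, hC, h⟩ := exists_pda_le_of_pos hc hcs hκ hμ
  refine ⟨C, hC, fun G u hG hu t x ht a => ?_⟩
  rcases ht.eq_or_lt with rfl | ht
  · rw [hu.pda_zero, abs_zero, mul_zero]
    exact mul_nonneg (mul_nonneg hC.le (Afun_nonneg _ _ _ _ _ _ _ _)) (Psi_pos le_rfl).le
  by_cases hx : x = 0
  swap
  · exact h G u hG hu t x ht hx a
  subst hx
  set e : E3 := EuclideanSpace.single 0 1 with he
  have he1 : ‖e‖ = 1 := by simp [he]
  have cont : Continuous fun p : ℝ × E3 =>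
      jb ‖p.2‖ * jb (c * p.1 - ‖p.2‖) ^ κ * |pda a u p.1 p.2| := by
    have h1 := hu.1.continuous_pda a
    have h2 := continuous_jb
    exact ((h2.comp continuous_snd.norm).mul ((h2.comp (by fun_prop)).rpow_const
      fun _ => Or.inr (by linarith))).mul h1.abs
  have lim : Tendsto (fun s : ℝ => ((t - s, (c * s) • e) : ℝ × E3)) (𝓝[>] 0) (𝓝 (t, 0)) := by
    refine tendsto_nhdsWithin_of_tendsto_nhds (Continuous.tendsto' (by fun_prop) _ _ ?_)
    simp
  refine le_of_tendsto ((cont.tendsto (t, 0)).comp lim) ?_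
  filter_upwards [Ioo_mem_nhdsGT ht] with s hs
  have hcs' : 0 < c * s := mul_pos hc hs.1
  refine (h G u hG hu (t - s) ((c * s) • e) (by linarith [hs.2]) ?_ a).trans ?_
  · rw [← norm_pos_iff, norm_smul, he1, mul_one, Real.norm_of_nonneg hcs'.le]
    exact hcs'
  · have hA := Afun_mono (κ := κ) (μ := μ) (cs := cs) (s := 1) (t := t) (t' := t - s) (x := 0) (x' := (c * s) • e) hc.le
      (by linarith) hμ.le hG (by linarith [hs.2] : 0 ≤ t - s) (by linarith [hs.1])
      (by rw [sub_zero, norm_smul, he1, mul_one, Real.norm_of_nonneg hcs'.le, sub_sub_cancel])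
    have hΨ := Psi_mono (κ - 1) (by linarith [hs.2] : 0 ≤ t - s) (by linarith [hs.1] : t - s ≤ t)
    have hA0 := Afun_nonneg κ μ 1 G c cs t 0
    have hΨ0 := Psi_pos (ρ := κ - 1) (by linarith [hs.2] : 0 ≤ t - s)
    gcongr

end

theorem stmt5 (c : ℝ) (hc : 0 < c) {N : ℕ} (cs : Fin N → ℝ) (hcs : ∀ j, 0 < cs j)
    (κ μ : ℝ) (hκ : 1 ≤ κ) (hμ : 0 < μ) :
    ∃ C > (0 : ℝ), ∀ G u : Fn, Smooth G → IsWaveSol c G u →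
      ∀ (t : ℝ) (x : E3), 0 ≤ t → ∀ a : Fin 4,
        jb ‖x‖ * jb (c * t - ‖x‖) ^ κ * (Psi (κ - 1) t)⁻¹ * |pda a u t x| ≤
          C * Afun κ μ 1 G c cs t x := by
  obtain ⟨C, hC, h⟩ := exists_pda_le hc hcs hκ hμ
  refine ⟨C, hC, fun G u hG hu t x ht a => ?_⟩
  rw [mul_right_comm, ← div_eq_mul_inv, div_le_iff₀ (Psi_pos ht)]
  exact h G u hG hu t x ht a

end PaperKatayama
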